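/- arXiv:2102.08568 — 2 statements merged into one kernel-verified Lean document; each statement's English description precedes it below -/
import Mathlib

section
/- Let S be a set of primes of natural density δ(S) (i.e. #{p ∈ S : p ≤ x} / π(x) → δ(S) as x → ∞). Then the limit as x → ∞ of −∑_{2 ≤ n ≤ x, p_min(n) ∈ S} μ(n)/n equals δ(S). -/
open scoped Classical
open Finset Filter

section Tauberian
open MeasureTheory Topology Complex
open scoped FourierTransform

theorem taub_fourier (φ : ℝ → ℂ) (hφc : Continuous φ) (hφs : HasCompactSupport φ) (K : ℝ → ℂ)
    (hK : ∀ u, K u = ∫ y, 𝐞 (-(y * u)) • φ y)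
    (f : ℝ → ℂ) (hfm : Measurable f) (hfb : ∀ t, ‖f t‖ ≤ 1) (hf0 : ∀ t < 0, f t = 0)
    (σ : ℝ) (hσ : 0 < σ) (T : ℝ) :
    ∫ t, f t * cexp (-σ * t) * K (T - t) =
      ∫ y, 𝐞 (-(y * T)) • (φ y * ∫ t, f t * cexp (-(σ - 2 * Real.pi * y * I) * t)) := by
  have hI : Integrable (fun t : ℝ => f t * cexp (-σ * t)) := by
    have h1 : IntegrableOn (fun t : ℝ => Real.exp (-σ * t)) (Set.Ioi 0) :=
      integrableOn_exp_mul_Ioi (by linarith) 0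
    have h2 : Integrable (Set.indicator (Set.Ici 0) (fun t : ℝ => Real.exp (-σ * t))) := by
      rw [integrable_indicator_iff measurableSet_Ici]
      exact (integrableOn_Ici_iff_integrableOn_Ioi).mpr h1
    refine h2.mono' ?_ ?_
    · exact (hfm.mul (by fun_prop)).aestronglyMeasurable
    · refine Eventually.of_forall fun t => ?_
      by_cases ht : t < 0
      · simp [hf0 t ht, ht]
      · have : (t : ℝ) ∈ Set.Ici (0:ℝ) := by simpa using ht
        rw [Set.indicator_of_mem this, norm_mul, Complex.norm_exp]
        have : (-(σ:ℂ) * t).re = -σ * t := by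
          simp [← ofReal_neg, ← ofReal_mul]
        rw [this]
        have := hfb t
        have := Real.exp_pos (-σ * t)
        nlinarith
  have hφI : Integrable φ := hφc.integrable_of_hasCompactSupport hφs
  have hprod : Integrable (fun z : ℝ × ℝ => (f z.1 * cexp (-σ * z.1)) * φ z.2) :=
    hI.mul_prod hφI
  have hF : Integrable (Function.uncurry fun t y : ℝ =>
      f t * cexp (-σ * t) * (𝐞 (-(y * (T - t))) • φ y)) (volume.prod volume) := by
    refine hprod.mono ?_ ?_
    · have : Measurable (fun z : ℝ × ℝ => f z.1 * cexp (-σ * z.1) *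
          (𝐞 (-(z.2 * (T - z.1))) • φ z.2)) := by
        simp only [Circle.smul_def, Real.fourierChar_apply, smul_eq_mul]
        have := hφc.measurable
        fun_prop
      exact this.aestronglyMeasurable
    · refine Eventually.of_forall fun z => ?_
      simp [Function.uncurry]
  calc ∫ t, f t * cexp (-σ * t) * K (T - t)
      = ∫ t, ∫ y, f t * cexp (-σ * t) * (𝐞 (-(y * (T - t))) • φ y) := by
        refine integral_congr_ae (Eventually.of_forall fun t => ?_)
        simp only
        rw [hK, ← integral_const_mul]
    _ = ∫ y, ∫ t, f t * cexp (-σ * t) * (𝐞 (-(y * (T - t))) • φ y) := integral_integral_swap hF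
    _ = _ := by
        refine integral_congr_ae (Eventually.of_forall fun y => ?_)
        simp only
        rw [Circle.smul_def, smul_eq_mul, ← mul_assoc, ← integral_const_mul]
        refine integral_congr_ae (Eventually.of_forall fun t => ?_)
        simp only [Circle.smul_def, Real.fourierChar_apply, smul_eq_mul]
        have : cexp (-σ * t) * cexp (↑(2 * Real.pi * -(y * (T - t))) * I) =
          cexp (↑(2 * Real.pi * -(y * T)) * I) * cexp (-(σ - 2 * Real.pi * y * I) * t) := by
          rw [← Complex.exp_add, ← Complex.exp_add]
          congr 1
          push_cast
          ring
        linear_combination (f t * φ y) * this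

theorem taub1 (φ : ℝ → ℂ) (hφc : Continuous φ) (hφs : HasCompactSupport φ) (K : ℝ → ℂ)
    (hK : ∀ u, K u = ∫ y, 𝐞 (-(y * u)) • φ y) (hKi : Integrable K)
    (f : ℝ → ℂ) (hfm : Measurable f) (hfb : ∀ t, ‖f t‖ ≤ 1) (hf0 : ∀ t < 0, f t = 0)
    (g : ℂ → ℂ) (hg : ContinuousOn g {s | 0 ≤ s.re})
    (hG : ∀ s, 0 < s.re → g s = ∫ t : ℝ, f t * cexp (-s * t)) :
    Tendsto (fun T => ∫ t, f t * K (T - t)) atTop (𝓝 0) := by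
  have key : ∀ T, ∫ t, f t * K (T - t) =
      ∫ y, 𝐞 (-(y * T)) • (φ y * g (-(2 * Real.pi * y * I))) := by
    intro T
    have hs : Tendsto (fun n : ℕ => (1 / ((n : ℝ) + 1))) atTop (𝓝 0) :=
      tendsto_one_div_add_atTop_nhds_zero_nat
    have hKT : Integrable (fun t => K (T - t)) := hKi.comp_sub_left T
    have hL : Tendsto (fun n : ℕ => ∫ t, f t * cexp (-((1 / ((n : ℝ) + 1) : ℝ) : ℂ) * t) * K (T - t))
        atTop (𝓝 (∫ t, f t * K (T - t))) := by
      refine tendsto_integral_of_dominated_convergence (fun t => ‖K (T - t)‖) ?_ hKT.norm ?_ ?_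
      · intro n
        exact ((hfm.mul (by fun_prop)).aestronglyMeasurable).mul hKT.aestronglyMeasurable
      · intro n
        refine Eventually.of_forall fun t => ?_
        rw [norm_mul]
        refine mul_le_of_le_one_left (norm_nonneg _) ?_
        by_cases ht : t < 0
        · simp [hf0 t ht]
        · rw [norm_mul, Complex.norm_exp]
          have h1 : (-((1 / ((n : ℝ) + 1) : ℝ) : ℂ) * t).re = -(1 / ((n : ℝ) + 1)) * t := by
            rw [← ofReal_neg, ← ofReal_mul, ofReal_re]
          rw [h1]
          have h2 : -(1 / ((n : ℝ) + 1)) * t ≤ 0 := by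
            have : 0 < 1 / ((n : ℝ) + 1) := by positivity
            nlinarith
          exact mul_le_one₀ (hfb t) (Real.exp_pos _).le (Real.exp_le_one_iff.mpr h2)
      · refine Eventually.of_forall fun t => ?_
        have : Tendsto (fun n : ℕ => f t * cexp (-((1 / ((n : ℝ) + 1) : ℝ) : ℂ) * t) * K (T - t))
            atTop (𝓝 (f t * cexp (-((0 : ℝ) : ℂ) * t) * K (T - t))) := by
          have hc : Continuous (fun s : ℝ => f t * cexp (-(s : ℂ) * t) * K (T - t)) := by fun_prop
          exact (hc.tendsto 0).comp hs
        simpa using this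
    have hR : Tendsto (fun n : ℕ => ∫ y, 𝐞 (-(y * T)) •
          (φ y * g (((1 / ((n : ℝ) + 1) : ℝ) : ℂ) - 2 * Real.pi * y * I)))
        atTop (𝓝 (∫ y, 𝐞 (-(y * T)) • (φ y * g (-(2 * Real.pi * y * I))))) := by
      let Φ : ℝ × ℝ → ℂ := fun z => (z.1 : ℂ) - 2 * Real.pi * z.2 * I
      have hΦc : Continuous Φ := by fun_prop
      have hΦre : ∀ z, (Φ z).re = z.1 := by intro z; simp [Φ]
      have hgΦ : ContinuousOn (fun z => g (Φ z)) (Set.Icc 0 1 ×ˢ tsupport φ) := by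
        refine hg.comp hΦc.continuousOn ?_
        rintro ⟨a, b⟩ ⟨h1, h2⟩
        simp only [Set.mem_ofPred_eq, hΦre]
        exact h1.1
      obtain ⟨B, hB⟩ := (isCompact_Icc.prod hφs.isCompact).exists_bound_of_continuousOn hgΦ
      have hcont : ∀ a : ℝ, 0 ≤ a → Continuous (fun y : ℝ => g (Φ (a, y))) := by
        intro a ha
        rw [← continuousOn_univ]
        refine hg.comp (by fun_prop) ?_
        intro y _
        simp only [Set.mem_ofPred_eq, hΦre]
        exact ha
      refine tendsto_integral_of_dominated_convergence (fun y => ‖φ y‖ * B) ?_ ?_ ?_ ?_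
      · intro n
        have h1 := hcont (1 / ((n : ℝ) + 1)) (by positivity)
        have : Continuous (fun y : ℝ => 𝐞 (-(y * T)) •
          (φ y * g (((1 / ((n : ℝ) + 1) : ℝ) : ℂ) - 2 * Real.pi * y * I))) := by
          simp only [Circle.smul_def, Real.fourierChar_apply, smul_eq_mul]
          exact Continuous.mul (by fun_prop) (hφc.mul h1)
        exact this.aestronglyMeasurable
      · exact (hφc.integrable_of_hasCompactSupport hφs).norm.mul_const B
      · intro n
        refine Eventually.of_forall fun y => ?_
        rw [Circle.norm_smul, norm_mul]
        by_cases hy : y ∈ tsupport φ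
        · refine mul_le_mul_of_nonneg_left ?_ (norm_nonneg _)
          refine hB (1 / ((n : ℝ) + 1), y) ⟨⟨by positivity, ?_⟩, hy⟩
          simp only
          rw [div_le_one (by positivity)]
          have : (0:ℝ) ≤ n := by positivity
          linarith
        · simp [image_eq_zero_of_notMem_tsupport hy]
      · refine Eventually.of_forall fun y => ?_
        refine Tendsto.const_smul (Tendsto.const_mul _ ?_) _
        have h0 : ContinuousWithinAt g {s | 0 ≤ s.re} (Φ (0, y)) := by
          apply hg
          simp [hΦre]
        have h1 : Tendsto (fun n : ℕ => Φ (1 / ((n : ℝ) + 1), y)) atTop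
            (𝓝[{s | 0 ≤ s.re}] (Φ (0, y))) := by
          refine tendsto_nhdsWithin_iff.mpr ⟨?_, ?_⟩
          · have hc : Continuous (fun s : ℝ => Φ (s, y)) := by fun_prop
            exact (hc.tendsto 0).comp hs
          · refine Eventually.of_forall fun n => ?_
            simp only [Set.mem_ofPred_eq, hΦre]
            positivity
        have h2 := h0.tendsto.comp h1
        have h3 : Φ (0, y) = -(2 * Real.pi * y * I) := by simp [Φ]
        rw [h3] at h2
        exact h2
    refine tendsto_nhds_unique hL (hR.congr fun n => ?_)
    rw [taub_fourier φ hφc hφs K hK f hfm hfb hf0 _ (by positivity) T]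
    refine integral_congr_ae (Eventually.of_forall fun y => ?_)
    simp only
    rw [hG]
    rw [sub_re, ofReal_re]
    have : (2 * (Real.pi : ℂ) * y * I).re = 0 := by simp
    rw [this, sub_zero]
    positivity
  simp_rw [key]
  exact (Real.tendsto_integral_exp_smul_cocompact _).mono_left atTop_le_cocompact

end Tauberian

section Tauberian2
open MeasureTheory Topology Complex
open scoped FourierTransform

theorem exists_kernel : ∃ (φ K : ℝ → ℂ), Continuous φ ∧ HasCompactSupport φ ∧
    (∀ u, K u = ∫ y, 𝐞 (-(y * u)) • φ y) ∧ Integrable K ∧ ∫ u, K u = 1 := by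
  let b : ContDiffBump (0 : ℝ) := ⟨1, 2, by norm_num, by norm_num⟩
  let φ : ℝ → ℂ := fun x => (b x : ℂ)
  have hsupp : HasCompactSupport φ := b.hasCompactSupport.comp_left (g := fun x : ℝ => (x : ℂ)) (by simp)
  have hsm : ContDiff ℝ ((⊤ : ℕ∞) : WithTop ℕ∞) φ := by
    exact Complex.ofRealCLM.contDiff.comp b.contDiff
  let Φ : SchwartzMap ℝ ℂ := hsupp.toSchwartzMap hsm
  have hΦ : ∀ x, Φ x = φ x := fun x => rfl
  refine ⟨φ, (𝓕 Φ : SchwartzMap ℝ ℂ), hsm.continuous, hsupp, ?_, (𝓕 Φ).integrable, ?_⟩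
  · intro u
    rw [SchwartzMap.fourier_coe, Real.fourier_real_eq]
    rfl
  · have h1 : 𝓕⁻ (𝓕 Φ) = Φ := FourierTransform.fourierInv_fourier_eq Φ
    have h2 : (𝓕⁻ (𝓕 Φ)) 0 = Φ 0 := by rw [h1]
    rw [SchwartzMap.fourierInv_coe, Real.fourierInv_eq] at h2
    simp only [inner_zero_right, AddChar.map_zero_eq_one, one_smul] at h2
    rw [h2, hΦ]
    simp only [φ]
    rw [b.one_of_mem_closedBall (by simp [b])]
    simp

theorem taub2 (f : ℝ → ℂ) (hfm : Measurable f) (hfb : ∀ t, ‖f t‖ ≤ 1) (hf0 : ∀ t < 0, f t = 0)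
    (g : ℂ → ℂ) (hg : ContinuousOn g {s | 0 ≤ s.re})
    (hG : ∀ s, 0 < s.re → g s = ∫ t : ℝ, f t * cexp (-s * t))
    (hslow : ∀ ε > 0, ∃ h > 0, ∃ t₀, ∀ t ≥ t₀, ∀ s, |s - t| ≤ h → ‖f s - f t‖ ≤ ε) :
    Tendsto f atTop (𝓝 0) := by
  obtain ⟨φ, K, hφc, hφs, hK, hKi, hK1⟩ := exists_kernel
  have hscale : ∀ c : ℝ, 0 < c → Tendsto (fun T => ∫ t, f (c * t) * K (T - t)) atTop (𝓝 0) := by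
    intro c hc
    refine taub1 φ hφc hφs K hK hKi (fun t => f (c * t)) (by fun_prop) (fun t => hfb _)
      (fun t ht => hf0 _ (mul_neg_of_pos_of_neg hc ht)) (fun s => (c : ℂ)⁻¹ * g (s / c)) ?_ ?_
    · refine ContinuousOn.mul continuousOn_const (hg.comp (by fun_prop) ?_)
      intro s hs
      simp only [Set.mem_ofPred_eq] at hs ⊢
      rw [Complex.div_ofReal_re]
      positivity
    · intro s hs
      rw [hG _ (by rw [Complex.div_ofReal_re]; positivity)]
      have := Measure.integral_comp_mul_left (fun t : ℝ => f t * cexp (-(s / c) * t)) c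
      rw [abs_of_pos (inv_pos.mpr hc), Complex.real_smul, ofReal_inv] at this
      rw [← this]
      refine integral_congr_ae (Eventually.of_forall fun t => ?_)
      simp only
      congr 2
      have : (c : ℂ) ≠ 0 := by exact_mod_cast hc.ne'
      push_cast
      field_simp
  rw [Metric.tendsto_atTop]
  intro ε hε
  set B := ∫ u, ‖K u‖ with hB
  have hB0 : 0 ≤ B := integral_nonneg fun _ => norm_nonneg _
  set η := ε / (2 * (B + 4)) with hη
  have hηpos : 0 < η := by positivity
  obtain ⟨h, hh, t₀, hslow⟩ := hslow η hηpos
  -- tail radius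
  obtain ⟨R, hR, hRtail⟩ : ∃ R > 0, ∫ u in {u | R < |u|}, ‖K u‖ ≤ η := by
    have hanti : Tendsto (fun n : ℕ => ∫ u in {u : ℝ | (n : ℝ) < |u|}, ‖K u‖) atTop
        (𝓝 (∫ u in ⋂ n : ℕ, {u : ℝ | (n : ℝ) < |u|}, ‖K u‖)) := by
      refine tendsto_setIntegral_of_antitone ?_ ?_ ⟨0, hKi.norm.integrableOn⟩
      · intro n
        exact measurableSet_lt measurable_const (by fun_prop)
      · intro m n hmn u hu
        simp only [Set.mem_ofPred_eq] at hu ⊢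
        exact lt_of_le_of_lt (by exact_mod_cast hmn) hu
    have hempty : (⋂ n : ℕ, {u : ℝ | (n : ℝ) < |u|}) = ∅ := by
      ext u
      simp only [Set.mem_iInter, Set.mem_ofPred_eq, Set.mem_empty_iff_false, iff_false, not_forall,
        not_lt]
      exact exists_nat_ge |u|
    rw [hempty] at hanti
    simp only [Measure.restrict_empty, integral_zero_measure] at hanti
    obtain ⟨n, hn1, hn2⟩ := ((hanti.eventually (ge_mem_nhds hηpos)).and (eventually_gt_atTop 0)).exists
    exact ⟨n, by exact_mod_cast hn2, hn1⟩
  set c := h / R with hc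
  have hcpos : 0 < c := by positivity
  obtain ⟨T₀, hT₀⟩ := (Metric.tendsto_atTop.mp (hscale c hcpos)) η hηpos
  refine ⟨max t₀ (c * T₀), fun x hx => ?_⟩
  have hx1 : t₀ ≤ x := le_trans (le_max_left _ _) hx
  have hx2 : T₀ ≤ x / c := by
    rw [le_div_iff₀ hcpos]
    linarith [le_trans (le_max_right _ _) hx]
  have h3 := hT₀ _ hx2
  rw [dist_zero_right] at h3 ⊢
  set T := x / c with hT
  have hxT : c * T = x := by rw [hT]; field_simp
  have hsub : ∫ t, f (c * t) * K (T - t) = ∫ u, f (x - c * u) * K u := by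
    rw [← integral_sub_left_eq_self (fun u => f (x - c * u) * K u) volume T]
    refine integral_congr_ae (Eventually.of_forall fun t => ?_)
    simp only
    congr 2
    rw [← hxT]; ring
  have hint1 : Integrable (fun u => f (x - c * u) * K u) := by
    refine hKi.norm.mono' ?_ ?_
    · exact (hfm.comp (by fun_prop)).aestronglyMeasurable.mul hKi.aestronglyMeasurable
    · refine Eventually.of_forall fun u => ?_
      rw [norm_mul]
      exact mul_le_of_le_one_left (norm_nonneg _) (hfb _)
  have hfx : f x = (∫ u, f (x - c * u) * K u) - ∫ u, (f (x - c * u) - f x) * K u := by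
    have : ∫ u, (f (x - c * u) - f x) * K u =
        (∫ u, f (x - c * u) * K u) - ∫ u, f x * K u := by
      rw [← integral_sub hint1 (hKi.const_mul _)]
      simp_rw [sub_mul]
    rw [this, integral_const_mul, hK1]; ring
  have hdiff : ‖∫ u, (f (x - c * u) - f x) * K u‖ ≤ η * B + 2 * η := by
    have hmeas : MeasurableSet {u : ℝ | R < |u|} := measurableSet_lt measurable_const (by fun_prop)
    have hind : Integrable (Set.indicator {u : ℝ | R < |u|} (fun u => ‖K u‖)) :=
      hKi.norm.indicator hmeas
    calc ‖∫ u, (f (x - c * u) - f x) * K u‖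
        ≤ ∫ u, (η * ‖K u‖ + 2 * Set.indicator {u : ℝ | R < |u|} (fun u => ‖K u‖) u) := by
          refine norm_integral_le_of_norm_le ((hKi.norm.const_mul η).add (hind.const_mul 2)) ?_
          refine Eventually.of_forall fun u => ?_
          rw [norm_mul]
          by_cases hu : R < |u|
          · rw [Set.indicator_of_mem (by simpa using hu)]
            have h1 : ‖f (x - c * u) - f x‖ ≤ 2 := by
              refine (norm_sub_le _ _).trans ?_
              linarith [hfb (x - c * u), hfb x]
            have := norm_nonneg (K u)
            nlinarith
          · rw [Set.indicator_of_notMem (by simpa using hu), mul_zero, add_zero]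
            refine mul_le_mul_of_nonneg_right ?_ (norm_nonneg _)
            refine hslow x hx1 _ ?_
            have : x - c * u - x = -(c * u) := by ring
            rw [this, abs_neg, abs_mul, abs_of_pos hcpos]
            calc c * |u| ≤ c * R := by gcongr; exact not_lt.mp hu
              _ = h := by rw [hc]; field_simp
      _ = η * B + 2 * ∫ u in {u | R < |u|}, ‖K u‖ := by
          rw [integral_add (hKi.norm.const_mul η) (hind.const_mul 2), integral_const_mul,
            integral_const_mul, integral_indicator hmeas]
      _ ≤ _ := by gcongr
  rw [hfx, ← hsub]
  refine lt_of_le_of_lt (norm_sub_le _ _) ?_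
  have hη2 : η * (2 * (B + 4)) = ε := by rw [hη]; field_simp
  nlinarith

end Tauberian2

section Mertens
open MeasureTheory Topology Complex
open ArithmeticFunction (moebius)

/-- The summatory function of the Möbius function. -/
noncomputable def mertensM (N : ℕ) : ℝ := ∑ k ∈ Finset.Icc 1 N, (moebius k : ℝ)

theorem moebius_abs_le (n : ℕ) : |(moebius n : ℝ)| ≤ 1 := by
  exact_mod_cast ArithmeticFunction.abs_moebius_le_one (n := n)

theorem mertensM_sub_le {a b : ℕ} (hab : a ≤ b) : |mertensM b - mertensM a| ≤ (b : ℝ) - a := by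
  induction b, hab using Nat.le_induction with
  | base => simp
  | succ b hb ih =>
    have : mertensM (b + 1) = mertensM b + moebius (b + 1) := by
      unfold mertensM
      rw [Finset.sum_Icc_succ_top (by omega)]
    rw [this]
    have h1 := moebius_abs_le (b + 1)
    push_cast
    rw [abs_le] at *
    constructor <;> linarith

theorem mertensM_sub_abs (a b : ℕ) : |mertensM b - mertensM a| ≤ |(b : ℝ) - a| := by
  rcases le_total a b with h | h
  · exact (mertensM_sub_le h).trans (le_abs_self _)
  · rw [abs_sub_comm, abs_sub_comm (b : ℝ)]
    exact (mertensM_sub_le h).trans (le_abs_self _)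

theorem mertensM_abs (a : ℕ) : |mertensM a| ≤ a := by
  have := mertensM_sub_abs 0 a
  simpa [mertensM] using this

/-- The normalized Mertens function on a logarithmic scale. -/
noncomputable def mertensF (t : ℝ) : ℝ :=
  if 0 ≤ t then Real.exp (-t) * mertensM ⌊Real.exp t⌋₊ else 0

theorem mertensF_abs (t : ℝ) : |mertensF t| ≤ 1 := by
  unfold mertensF
  split_ifs with h
  · rw [abs_mul, abs_of_pos (Real.exp_pos _)]
    have h1 := mertensM_abs ⌊Real.exp t⌋₊
    have h2 := Nat.floor_le (Real.exp_pos t).le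
    calc Real.exp (-t) * |mertensM ⌊Real.exp t⌋₊| ≤ Real.exp (-t) * Real.exp t := by
          gcongr; linarith
      _ = 1 := by rw [← Real.exp_add]; simp
  · simp

theorem mertensF_slow (ε : ℝ) (hε : 0 < ε) : ∃ h > 0, ∃ t₀ : ℝ, ∀ t ≥ t₀, ∀ s, |s - t| ≤ h →
    |mertensF s - mertensF t| ≤ ε := by
  have hlim : Tendsto (fun x : ℝ => Real.exp (-x)) atTop (𝓝 0) :=
    Real.tendsto_exp_neg_atTop_nhds_zero
  obtain ⟨t₁, ht₁⟩ := eventually_atTop.mp (hlim.eventually (ge_mem_nhds (half_pos hε)))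
  refine ⟨min 1 (ε / 8), by positivity, max t₁ 0 + 1, fun t ht s hs => ?_⟩
  have hs1 : |s - t| ≤ 1 := hs.trans (min_le_left _ _)
  have hs2 : |s - t| ≤ ε / 8 := hs.trans (min_le_right _ _)
  have hm1 := le_max_left t₁ 0
  have hm2 := le_max_right t₁ 0
  have hs3 := abs_le.mp hs1
  have ht0 : 0 ≤ t := by linarith
  have hs0 : 0 ≤ s := by linarith [hs3.1]
  have hes : Real.exp (-s) ≤ ε / 2 := ht₁ s (by linarith [hs3.1])
  have hex : |Real.exp (t - s) - 1| ≤ 2 * |t - s| := by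
    apply Real.abs_exp_sub_one_le
    rwa [abs_sub_comm]
  rw [abs_sub_comm t s] at hex
  unfold mertensF
  rw [if_pos ht0, if_pos hs0]
  set Ms := mertensM ⌊Real.exp s⌋₊ with hMs
  set Mt := mertensM ⌊Real.exp t⌋₊ with hMt
  have e1 : Real.exp (-s) * Real.exp t = Real.exp (t - s) := by
    rw [← Real.exp_add]; congr 1; ring
  have e2 : Real.exp (-s) * Real.exp s = 1 := by rw [← Real.exp_add]; simp
  have e3 : Real.exp (-t) * Real.exp t = 1 := by rw [← Real.exp_add]; simp
  have hMt_le : |Mt| ≤ Real.exp t :=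
    (mertensM_abs _).trans (Nat.floor_le (Real.exp_pos t).le)
  have hdiff : |Ms - Mt| ≤ |Real.exp t - Real.exp s| + 1 := by
    refine (mertensM_sub_abs _ _).trans ?_
    have a1 := Nat.floor_le (Real.exp_pos t).le
    have a2 := Nat.floor_le (Real.exp_pos s).le
    have a3 := Nat.lt_floor_add_one (Real.exp t)
    have a4 := Nat.lt_floor_add_one (Real.exp s)
    rw [abs_le]
    have b1 := le_abs_self (Real.exp t - Real.exp s)
    have b2 := neg_abs_le (Real.exp t - Real.exp s)
    constructor <;> linarith
  have p1 := Real.exp_pos (-s)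
  have p2 := Real.exp_pos t
  have c1 : Real.exp (-s) * |Real.exp t - Real.exp s| = |Real.exp (t - s) - 1| := by
    rw [← abs_of_pos p1, ← abs_mul, mul_sub, e1, e2]
  have c2 : Real.exp t * |Real.exp (-s) - Real.exp (-t)| = |Real.exp (t - s) - 1| := by
    nth_rewrite 1 [← abs_of_pos p2]
    rw [← abs_mul, mul_sub, mul_comm _ (Real.exp (-s)), mul_comm _ (Real.exp (-t)), e1, e3]
  have hsplit : Real.exp (-s) * Ms - Real.exp (-t) * Mt =
      Real.exp (-s) * (Ms - Mt) + Mt * (Real.exp (-s) - Real.exp (-t)) := by ring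
  rw [hsplit]
  calc |Real.exp (-s) * (Ms - Mt) + Mt * (Real.exp (-s) - Real.exp (-t))|
      ≤ Real.exp (-s) * |Ms - Mt| + |Mt| * |Real.exp (-s) - Real.exp (-t)| := by
        refine (abs_add_le _ _).trans ?_
        rw [abs_mul, abs_mul, abs_of_pos p1]
    _ ≤ Real.exp (-s) * (|Real.exp t - Real.exp s| + 1) +
        Real.exp t * |Real.exp (-s) - Real.exp (-t)| := by gcongr
    _ = 2 * |Real.exp (t - s) - 1| + Real.exp (-s) := by rw [mul_add, c1, c2]; ring
    _ ≤ ε := by linarith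

theorem mertensF_measurable : Measurable mertensF := by
  unfold mertensF
  refine Measurable.ite measurableSet_Ici ?_ measurable_const
  refine Measurable.mul (by fun_prop) ?_
  have h1 : Measurable mertensM := measurable_of_countable _
  exact h1.comp (Nat.measurable_floor.comp Real.measurable_exp)

theorem mertensF_laplace (s : ℂ) (hs : 0 < s.re) :
    (1 + s) * riemannZeta (1 + s) * ∫ t : ℝ, (mertensF t : ℂ) * cexp (-s * t) = 1 := by
  have hs1 : 1 < (1 + s).re := by simp [hs]
  have hsum := ArithmeticFunction.LSeriesSummable_moebius_iff.mpr hs1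
  have hO : (fun n : ℕ => ∑ k ∈ Finset.Icc 1 n, ((moebius k : ℤ) : ℂ)) =O[atTop]
      fun n => (n : ℝ) ^ (1 : ℝ) := by
    refine Asymptotics.IsBigO.of_bound 1 (Eventually.of_forall fun n => ?_)
    have := mertensM_abs n
    have e : ∑ k ∈ Finset.Icc 1 n, ((moebius k : ℤ) : ℂ) = ((mertensM n : ℝ) : ℂ) := by
      unfold mertensM; push_cast; rfl
    rw [e, Complex.norm_real, Real.rpow_one, Real.norm_eq_abs]
    simpa using this
  have hL := LSeries_eq_mul_integral (fun n => ((moebius n : ℤ) : ℂ)) zero_le_one hs1 hsum hO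
  have hz := ArithmeticFunction.LSeries_zeta_mul_Lseries_moebius hs1
  rw [ArithmeticFunction.LSeries_zeta_eq_riemannZeta hs1, hL] at hz
  have himg : Real.exp '' Set.Ioi 0 = Set.Ioi 1 := by
    ext x
    constructor
    · rintro ⟨t, ht, rfl⟩
      exact Real.one_lt_exp_iff.mpr ht
    · intro hx
      have hx' : (1:ℝ) < x := hx
      exact ⟨Real.log x, Real.log_pos hx', Real.exp_log (by linarith)⟩
  have hcv := integral_image_eq_integral_abs_deriv_smul (s := Set.Ioi (0:ℝ)) (f := Real.exp)
    (f' := Real.exp) measurableSet_Ioi (fun x _ => (Real.hasDerivAt_exp x).hasDerivWithinAt)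
    Real.exp_injective.injOn
    (fun t : ℝ => (∑ k ∈ Finset.Icc 1 ⌊t⌋₊, ((moebius k : ℤ) : ℂ)) * (t : ℂ) ^ (-(1 + s + 1)))
  rw [himg] at hcv
  rw [hcv] at hz
  have hInt0 : ∫ t : ℝ, (mertensF t : ℂ) * cexp (-s * t) =
      ∫ x in Set.Ioi (0:ℝ), |Real.exp x| • ((∑ k ∈ Finset.Icc 1 ⌊Real.exp x⌋₊,
        ((moebius k : ℤ) : ℂ)) * (Real.exp x : ℂ) ^ (-(1 + s + 1))) := by
    rw [← integral_Ici_eq_integral_Ioi, ← integral_indicator measurableSet_Ici]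
    refine integral_congr_ae (Eventually.of_forall fun t => ?_)
    simp only
    by_cases ht : 0 ≤ t
    · rw [Set.indicator_of_mem (by simpa using ht)]
      unfold mertensF
      rw [if_pos ht, abs_of_pos (Real.exp_pos t)]
      have e : ∑ k ∈ Finset.Icc 1 ⌊Real.exp t⌋₊, ((moebius k : ℤ) : ℂ) =
          ((mertensM ⌊Real.exp t⌋₊ : ℝ) : ℂ) := by
        unfold mertensM; push_cast; rfl
      rw [e, Complex.real_smul]
      have e2 : (Real.exp t : ℂ) ^ (-(1 + s + 1)) = cexp (t * (-(1 + s + 1))) := by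
        rw [Complex.cpow_def_of_ne_zero (by exact_mod_cast (Real.exp_pos t).ne'),
          ← Complex.ofReal_log (Real.exp_pos t).le, Real.log_exp]
      rw [e2]
      push_cast
      have e3 : cexp (-t) * cexp (-s * t) = cexp t * cexp (t * (-(1 + s + 1))) := by
        rw [← Complex.exp_add, ← Complex.exp_add]
        congr 1; ring
      linear_combination ((mertensM ⌊Real.exp t⌋₊ : ℝ) : ℂ) * e3
    · rw [Set.indicator_of_notMem (by simpa using ht)]
      unfold mertensF
      rw [if_neg ht]; simp
  rw [hInt0]
  linear_combination hz

theorem mertensF_tendsto : Tendsto mertensF atTop (𝓝 0) := by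
  let Z : ℂ → ℂ := Function.update (fun s => (s - 1) * riemannZeta s) 1 1
  have hZc : Continuous Z := by
    rw [continuous_iff_continuousAt]
    intro s
    by_cases h : s = 1
    · subst h
      exact continuousAt_update_same.mpr riemannZeta_residue_one
    · refine (continuousAt_update_of_ne h).mpr ?_
      exact (by fun_prop : ContinuousAt (fun s : ℂ => s - 1) s).mul
        (differentiableAt_riemannZeta h).continuousAt
  have hZ0 : ∀ s : ℂ, 1 ≤ s.re → Z s ≠ 0 := by
    intro s hs
    by_cases h : s = 1
    · subst h; simp [Z]
    · simp only [Z, Function.update_of_ne h]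
      exact mul_ne_zero (sub_ne_zero.mpr h) (riemannZeta_ne_zero_of_one_le_re hs)
  have hne : ∀ s : ℂ, 0 ≤ s.re → (1 + s) ≠ 0 := by
    intro s hs h
    have := congrArg Complex.re h
    simp at this
    linarith
  have hmain : Tendsto (fun t => (mertensF t : ℂ)) atTop (𝓝 0) := by
    refine taub2 (fun t => (mertensF t : ℂ)) (by have := mertensF_measurable; fun_prop) ?_ ?_
      (fun s => s / ((1 + s) * Z (1 + s))) ?_ ?_ ?_
    · intro t
      rw [Complex.norm_real]; exact mertensF_abs t
    · intro t ht
      unfold mertensF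
      rw [if_neg (by linarith)]; simp
    · refine ContinuousOn.div (by fun_prop) (by fun_prop) ?_
      intro s hs
      have hs' : 0 ≤ s.re := hs
      exact mul_ne_zero (hne s hs') (hZ0 _ (by simpa using hs'))
    · intro s hs
      have h := mertensF_laplace s hs
      have hs0 : s ≠ 0 := by rintro rfl; simp at hs
      have h1 : Z (1 + s) = s * riemannZeta (1 + s) := by
        simp only [Z]
        rw [Function.update_of_ne (by simpa using hs0)]
        ring
      rw [h1]
      have h2 := hne s hs.le
      have h3 : riemannZeta (1 + s) ≠ 0 := riemannZeta_ne_zero_of_one_le_re (by simp [hs.le])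
      have h4 : ∫ t : ℝ, (mertensF t : ℂ) * cexp (-s * t) = 1 / ((1 + s) * riemannZeta (1 + s)) := by
        rw [eq_div_iff (mul_ne_zero h2 h3)]
        linear_combination h
      rw [h4]
      field_simp
    · intro ε hε
      obtain ⟨h, hh, t₀, H⟩ := mertensF_slow ε hε
      refine ⟨h, hh, t₀, fun t ht s hs => ?_⟩
      rw [← ofReal_sub, Complex.norm_real]
      exact H t ht s hs
  have := (Complex.continuous_re.tendsto 0).comp hmain
  exact this

/-- `M(N) = o(N)`, in the form `|M N| ≤ ε N + C`. -/
theorem mertensM_littleO (ε : ℝ) (hε : 0 < ε) : ∃ C : ℝ, ∀ N : ℕ, |mertensM N| ≤ ε * N + C := by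
  have h := mertensF_tendsto.eventually (Metric.ball_mem_nhds 0 hε)
  obtain ⟨t₀, ht₀⟩ := eventually_atTop.mp h
  refine ⟨Real.exp (max t₀ 0), fun N => ?_⟩
  by_cases hN : (N : ℝ) ≤ Real.exp (max t₀ 0)
  · have := mertensM_abs N
    have h2 : 0 ≤ ε * N := by positivity
    linarith
  · push Not at hN
    have hNpos : (0:ℝ) < N := (Real.exp_pos _).trans hN
    have h1 : max t₀ 0 < Real.log N := (Real.lt_log_iff_exp_lt hNpos).mpr hN
    have h2 := ht₀ (Real.log N) ((le_max_left _ _).trans h1.le)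
    rw [Real.dist_0_eq_abs] at h2
    unfold mertensF at h2
    rw [if_pos ((le_max_right _ _).trans h1.le), Real.exp_neg, Real.exp_log hNpos,
      Nat.floor_natCast] at h2
    have h3 : |(N:ℝ)⁻¹ * mertensM N| < ε := h2
    rw [abs_mul, abs_of_pos (inv_pos.mpr hNpos), inv_mul_lt_iff₀ hNpos] at h3
    have := Real.exp_pos (max t₀ 0)
    nlinarith

end Mertens

section Axer
open Topology

/-- `f(N) = o(N)`, in the form `|f N| ≤ ε N + C`. -/
def IsSmall (f : ℕ → ℝ) : Prop := ∀ ε > 0, ∃ C : ℝ, 0 ≤ C ∧ ∀ N : ℕ, |f N| ≤ ε * N + C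

theorem IsSmall.of_bound {f : ℕ → ℝ}
    (h : ∀ ε > 0, ∃ C : ℝ, ∀ N : ℕ, |f N| ≤ ε * N + C) : IsSmall f := by
  intro ε hε
  obtain ⟨C, hC⟩ := h ε hε
  refine ⟨max C 0, le_max_right _ _, fun N => (hC N).trans ?_⟩
  linarith [le_max_left C 0]

theorem IsSmall.add {f g : ℕ → ℝ} (hf : IsSmall f) (hg : IsSmall g) :
    IsSmall (fun N => f N + g N) := by
  intro ε hε
  obtain ⟨C, hC0, hC⟩ := hf (ε / 2) (by positivity)
  obtain ⟨D, hD0, hD⟩ := hg (ε / 2) (by positivity)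
  refine ⟨C + D, by positivity, fun N => (abs_add_le _ _).trans ?_⟩
  linarith [hC N, hD N]

theorem IsSmall.const_mul {f : ℕ → ℝ} (hf : IsSmall f) (c : ℝ) :
    IsSmall (fun N => c * f N) := by
  intro ε hε
  obtain ⟨C, hC0, hC⟩ := hf (ε / (|c| + 1)) (by positivity)
  refine ⟨|c| * C, by positivity, fun N => ?_⟩
  rw [abs_mul]
  calc |c| * |f N| ≤ |c| * (ε / (|c| + 1) * N + C) := by gcongr; exact hC N
    _ = (|c| / (|c| + 1)) * (ε * N) + |c| * C := by ring
    _ ≤ 1 * (ε * N) + |c| * C := by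
        gcongr
        rw [div_le_one (by positivity)]; linarith
    _ = _ := by ring

theorem IsSmall.sub {f g : ℕ → ℝ} (hf : IsSmall f) (hg : IsSmall g) :
    IsSmall (fun N => f N - g N) := by
  have := hf.add (hg.const_mul (-1))
  refine fun ε hε => ?_
  obtain ⟨C, h0, h⟩ := this ε hε
  refine ⟨C, h0, fun N => ?_⟩
  have h1 := h N
  simp only [neg_one_mul, ← sub_eq_add_neg] at h1
  exact h1

theorem IsSmall.sum {ι : Type*} (s : Finset ι) {f : ι → ℕ → ℝ} (hf : ∀ i ∈ s, IsSmall (f i)) :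
    IsSmall (fun N => ∑ i ∈ s, f i N) := by
  induction s using Finset.induction_on with
  | empty => intro ε hε; exact ⟨0, le_rfl, fun N => by simp; positivity⟩
  | insert a s ha ih =>
    simp only [Finset.sum_insert ha]
    exact (hf a (by simp)).add (ih fun i hi => hf i (by simp [hi]))

theorem IsSmall.tendsto {f g : ℕ → ℝ} (hf : IsSmall f) (h : ∀ N : ℕ, N * g N = f N) :
    Tendsto g atTop (𝓝 0) := by
  rw [Metric.tendsto_atTop]
  intro ε hε
  obtain ⟨C, hC0, hC⟩ := hf (ε / 2) (by positivity)
  obtain ⟨N₀, hN₀⟩ := exists_nat_gt (2 * C / ε)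
  refine ⟨N₀ + 1, fun N hN => ?_⟩
  have hN1 : (N₀ : ℝ) + 1 ≤ N := by exact_mod_cast hN
  have hNpos : (0:ℝ) < N := by
    have : (0:ℝ) ≤ N₀ := by positivity
    linarith
  rw [Real.dist_0_eq_abs]
  have h1 := hC N
  rw [← h N, abs_mul, abs_of_pos hNpos] at h1
  rw [div_lt_iff₀ hε] at hN₀
  have h2 : C < ε / 2 * N := by nlinarith
  have h3 : (N:ℝ) * |g N| < N * ε := by linarith
  exact lt_of_mul_lt_mul_left h3 hNpos.le

theorem abel_ineq (F w : ℕ → ℝ) (a b : ℕ) (hab : a < b) (S : ℝ)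
    (hA : ∀ n ≤ b, |∑ k ∈ Finset.Icc 1 n, F k| ≤ S)
    (hw0 : ∀ n, a < n → 0 ≤ w n) (hw : ∀ n, a < n → w (n + 1) ≤ w n) :
    |∑ n ∈ Finset.Ioc a b, F n * w n| ≤ 2 * S * w (a + 1) := by
  have key : ∀ b, a + 1 ≤ b → (∀ n ≤ b, |∑ k ∈ Finset.Icc 1 n, F k| ≤ S) →
      |∑ n ∈ Finset.Ioc a b, F n * w n - (∑ k ∈ Finset.Icc 1 b, F k) * w b| ≤
        S * (2 * w (a + 1) - w b) := by
    intro b hb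
    induction b, hb using Nat.le_induction with
    | base =>
      intro hA
      rw [Finset.sum_Icc_succ_top (by omega)]
      simp only [Nat.Ioc_succ_singleton, Finset.sum_singleton]
      have h1 : F (a + 1) * w (a + 1) - (∑ k ∈ Finset.Icc 1 a, F k + F (a + 1)) * w (a + 1)
        = -((∑ k ∈ Finset.Icc 1 a, F k) * w (a + 1)) := by ring
      rw [h1, abs_neg, abs_mul, abs_of_nonneg (hw0 (a + 1) (by omega))]
      have := mul_le_mul_of_nonneg_right (hA a (by omega)) (hw0 (a + 1) (by omega))
      linarith
    | succ b hb ih =>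
      intro hA
      have ih := ih (fun n hn => hA n (by omega))
      rw [Finset.sum_Icc_succ_top (by omega), Finset.sum_Ioc_succ_top (by omega)]
      set A := ∑ k ∈ Finset.Icc 1 b, F k
      set Q := ∑ n ∈ Finset.Ioc a b, F n * w n
      have h1 : Q + F (b + 1) * w (b + 1) - (A + F (b + 1)) * w (b + 1) =
        (Q - A * w b) + A * (w b - w (b + 1)) := by ring
      rw [h1]
      refine (abs_add_le _ _).trans ?_
      have h2 := hw b (by omega)
      rw [abs_mul, abs_of_nonneg (by linarith : 0 ≤ w b - w (b + 1))]
      have := mul_le_mul_of_nonneg_right (hA b (by omega)) (by linarith : 0 ≤ w b - w (b + 1))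
      linarith
  have h1 := key b hab hA
  have h2 := hA b le_rfl
  have h3 := hw0 b hab
  have h4 : |(∑ k ∈ Finset.Icc 1 b, F k) * w b| ≤ S * w b := by
    rw [abs_mul, abs_of_nonneg h3]
    exact mul_le_mul_of_nonneg_right h2 h3
  rw [abs_le] at *
  constructor <;> nlinarith

theorem axer (F : ℕ → ℝ) (C : ℝ) (hF : ∀ n, |F n| ≤ C)
    (hA : IsSmall (fun N => ∑ n ∈ Finset.Icc 1 N, F n))
    (hB : IsSmall (fun N => ∑ n ∈ Finset.Icc 1 N, F n * ((N / n : ℕ) : ℝ))) :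
    Tendsto (fun N : ℕ => ∑ n ∈ Finset.Icc 1 N, F n / n) atTop (𝓝 0) := by
  have hC : 0 ≤ C := (abs_nonneg _).trans (hF 0)
  have hD : IsSmall (fun N => ∑ n ∈ Finset.Icc 1 N, F n * ((N : ℝ) / n - ((N / n : ℕ) : ℝ))) := by
    refine IsSmall.of_bound fun ε hε => ?_
    obtain ⟨K', hK'⟩ := exists_nat_gt (2 * C / ε)
    obtain ⟨K, hKdef⟩ : ∃ K : ℕ, K = K' + 2 := ⟨_, rfl⟩
    have hK2 : 2 ≤ K := by omega
    have hK : 2 * C / ε < K := by rw [hKdef]; push_cast; linarith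
    have hK0 : (0:ℝ) < K := lt_of_le_of_lt (by positivity) hK
    obtain ⟨D, hD0, hD⟩ := hA (ε / (8 * K)) (by positivity)
    refine ⟨4 * K * D, fun N => ?_⟩
    rcases Nat.eq_zero_or_pos N with rfl | hN
    · simp; positivity
    set a := N / K with ha
    have haN : a < N := Nat.div_lt_self hN hK2
    have hNR : (0:ℝ) < N := by exact_mod_cast hN
    have hsplit : ∑ n ∈ Finset.Icc 1 N, F n * ((N : ℝ) / n - ((N / n : ℕ) : ℝ)) =
        ∑ n ∈ Finset.Ioc 0 a, F n * ((N : ℝ) / n - ((N / n : ℕ) : ℝ)) +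
        (∑ n ∈ Finset.Ioc a N, F n * ((N : ℝ) / n) -
          ∑ n ∈ Finset.Ioc a N, F n * ((N / n : ℕ) : ℝ)) := by
      rw [← Finset.sum_sub_distrib]
      have : Finset.Icc 1 N = Finset.Ioc 0 N := by ext; simp; omega
      rw [this, ← Finset.sum_Ioc_consecutive _ (Nat.zero_le a) haN.le]
      congr 1
      refine Finset.sum_congr rfl fun n _ => by ring
    have hpart1 : |∑ n ∈ Finset.Ioc 0 a, F n * ((N : ℝ) / n - ((N / n : ℕ) : ℝ))| ≤ a * C := by
      calc |∑ n ∈ Finset.Ioc 0 a, F n * ((N : ℝ) / n - ((N / n : ℕ) : ℝ))|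
          ≤ ∑ n ∈ Finset.Ioc 0 a, C := by
            refine (Finset.abs_sum_le_sum_abs _ _).trans (Finset.sum_le_sum fun n hn => ?_)
            have hn1 : 1 ≤ n := (Finset.mem_Ioc.mp hn).1
            rw [abs_mul]
            have h1 : ((N / n : ℕ) : ℝ) ≤ (N : ℝ) / n := Nat.cast_div_le
            have h2 : (N : ℝ) / n < ((N / n : ℕ) : ℝ) + 1 := by
              rw [div_lt_iff₀ (by exact_mod_cast hn1)]
              have := Nat.lt_mul_div_succ N hn1
              rw [mul_comm] at this
              exact_mod_cast this
            have h3 : |(N : ℝ) / n - ((N / n : ℕ) : ℝ)| ≤ 1 := by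
              rw [abs_le]; constructor <;> linarith
            calc |F n| * |(N : ℝ) / n - ((N / n : ℕ) : ℝ)| ≤ C * 1 := by
                  gcongr; exact hF n
              _ = C := mul_one C
        _ = a * C := by simp
    set S := ε / (8 * K) * N + D with hS
    have hS0 : 0 ≤ S := by positivity
    have hAS : ∀ n ≤ N, |∑ k ∈ Finset.Icc 1 n, F k| ≤ S := by
      intro n hn
      refine (hD n).trans ?_
      rw [hS]
      gcongr
    have hwa : (N : ℝ) / ((a + 1 : ℕ) : ℝ) ≤ K := by
      rw [div_le_iff₀ (by positivity)]
      exact_mod_cast (Nat.lt_mul_div_succ N (by omega : 0 < K)).le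
    have h1 := abel_ineq F (fun n => (N : ℝ) / n) a N haN S hAS (fun n _ => by positivity)
      (fun n hn => by
        have : (0:ℝ) < n := by exact_mod_cast Nat.lt_of_le_of_lt (Nat.zero_le a) hn
        gcongr
        simp)
    have h2 := abel_ineq F (fun n => ((N / n : ℕ) : ℝ)) a N haN S hAS (fun n _ => by positivity)
      (fun n hn => by
        exact_mod_cast Nat.div_le_div_left (Nat.le_succ n) (Nat.lt_of_le_of_lt (Nat.zero_le a) hn))
    have hwb : ((N / (a + 1) : ℕ) : ℝ) ≤ K := Nat.cast_div_le.trans hwa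
    have h1' := h1.trans (mul_le_mul_of_nonneg_left hwa (by positivity))
    have h2' := h2.trans (mul_le_mul_of_nonneg_left hwb (by positivity))
    have haR : (a : ℝ) * C ≤ ε / 2 * N := by
      have h3 : (a : ℝ) ≤ N / K := Nat.cast_div_le
      have h4 : 2 * C < K * ε := by rwa [div_lt_iff₀ hε] at hK
      calc (a : ℝ) * C ≤ N / K * (K * ε / 2) := by gcongr; linarith
        _ = ε / 2 * N := by field_simp
    rw [hsplit]
    have hfin : 4 * S * K = ε / 2 * N + 4 * K * D := by rw [hS]; field_simp; ring
    refine (abs_add_le _ _).trans ?_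
    have h5 := abs_sub (∑ n ∈ Finset.Ioc a N, F n * ((N : ℝ) / n))
          (∑ n ∈ Finset.Ioc a N, F n * ((N / n : ℕ) : ℝ))
    linarith
  have hsum := hB.add hD
  refine hsum.tendsto fun N => ?_
  rw [Finset.mul_sum, ← Finset.sum_add_distrib]
  refine Finset.sum_congr rfl fun n hn => ?_
  ring

end Axer

section Rough
open Topology
open ArithmeticFunction (moebius)

/-- `n` has no prime factor below `k`. -/
def IsRough (k n : ℕ) : Prop := ∀ p : ℕ, p.Prime → p ∣ n → k ≤ p

theorem isRough_iff {k n : ℕ} (hn : 2 ≤ n) : IsRough k n ↔ k ≤ n.minFac := by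
  constructor
  · intro h
    exact h _ (Nat.minFac_prime (by omega)) (Nat.minFac_dvd n)
  · intro h p hp hpn
    exact h.trans (Nat.minFac_le_of_dvd hp.two_le hpn)

theorem isRough_one (k : ℕ) : IsRough k 1 := by
  intro p hp h
  exact absurd (Nat.dvd_one.mp h) hp.one_lt.ne'

noncomputable def roughM (k N : ℕ) : ℝ :=
  ∑ n ∈ Finset.Icc 1 N, if IsRough k n then (moebius n : ℝ) else 0

theorem roughM_abs (k N : ℕ) : |roughM k N| ≤ N := by
  unfold roughM
  calc _ ≤ ∑ n ∈ Finset.Icc 1 N, (1:ℝ) := by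
        refine (Finset.abs_sum_le_sum_abs _ _).trans (Finset.sum_le_sum fun n _ => ?_)
        split_ifs
        · exact moebius_abs_le n
        · simp
    _ = N := by simp

theorem roughM_succ_of_not_prime {k : ℕ} (hk : ¬ k.Prime) (N : ℕ) :
    roughM (k + 1) N = roughM k N := by
  have h : ∀ n, IsRough (k + 1) n ↔ IsRough k n := by
    intro n
    refine forall_congr' fun p => forall_congr' fun hp => forall_congr' fun _ => ?_
    have : k ≠ p := by rintro rfl; exact hk hp
    omega
  unfold roughM
  simp only [h]

theorem roughM_succ_of_prime {k : ℕ} (hk : k.Prime) (N : ℕ) :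
    roughM (k + 1) N = roughM k N + roughM (k + 1) (N / k) := by
  have hterm : ∀ n, (if IsRough k n then (moebius n : ℝ) else 0) =
      (if IsRough (k + 1) n then (moebius n : ℝ) else 0) +
      (if k ∣ n then (if IsRough k n then (moebius n : ℝ) else 0) else 0) := by
    intro n
    by_cases hd : k ∣ n
    · have : ¬ IsRough (k + 1) n := fun h => by have := h k hk hd; omega
      simp [hd, this]
    · have : IsRough (k + 1) n ↔ IsRough k n := by
        refine forall_congr' fun p => forall_congr' fun hp => forall_congr' fun hpn => ?_
        have : k ≠ p := by rintro rfl; exact hd hpn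
        omega
      simp [hd, this]
  have hsum : ∑ n ∈ Finset.Icc 1 N,
      (if k ∣ n then (if IsRough k n then (moebius n : ℝ) else 0) else 0) =
      - roughM (k + 1) (N / k) := by
    rw [← Finset.sum_filter]
    unfold roughM
    rw [← Finset.sum_neg_distrib]
    refine Finset.sum_nbij' (fun n => n / k) (fun m => k * m) ?_ ?_ ?_ ?_ ?_
    · intro n hn
      simp only [Finset.mem_filter, Finset.mem_Icc] at hn ⊢
      exact ⟨Nat.div_pos (Nat.le_of_dvd (by omega) hn.2) hk.pos, Nat.div_le_div_right hn.1.2⟩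
    · intro m hm
      simp only [Finset.mem_filter, Finset.mem_Icc] at hm ⊢
      refine ⟨⟨Nat.mul_pos hk.pos hm.1, ?_⟩, dvd_mul_right _ _⟩
      rw [mul_comm]
      exact (Nat.le_div_iff_mul_le hk.pos).mp hm.2
    · intro n hn
      simp only [Finset.mem_filter] at hn
      exact Nat.mul_div_cancel' hn.2
    · intro m _
      exact Nat.mul_div_cancel_left m hk.pos
    · intro n hn
      simp only [Finset.mem_filter] at hn
      obtain ⟨m, rfl⟩ := hn.2
      rw [Nat.mul_div_cancel_left m hk.pos]
      by_cases hd : k ∣ m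
      · have h1 : ¬ IsRough (k + 1) m := fun h => by have := h k hk hd; omega
        have h2 : moebius (k * m) = 0 := by
          apply ArithmeticFunction.moebius_eq_zero_of_not_squarefree
          intro h
          have := h k (mul_dvd_mul_left k hd)
          exact hk.one_lt.ne' (Nat.isUnit_iff.mp this)
        simp [h1, h2]
      · have hcop : Nat.Coprime k m := (Nat.Prime.coprime_iff_not_dvd hk).mpr hd
        have h2 : moebius (k * m) = - moebius m := by
          rw [ArithmeticFunction.isMultiplicative_moebius.map_mul_of_coprime hcop,
            ArithmeticFunction.moebius_apply_prime hk]
          ring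
        have h3 : IsRough k (k * m) ↔ IsRough (k + 1) m := by
          constructor
          · intro h p hp hpm
            have h4 := h p hp (hpm.mul_left k)
            have : k ≠ p := by rintro rfl; exact hd hpm
            omega
          · intro h p hp hpm
            rcases (Nat.Prime.dvd_mul hp).mp hpm with h5 | h5
            · exact ((Nat.prime_dvd_prime_iff_eq hp hk).mp h5).ge
            · have := h p hp h5; omega
        rw [h2]
        simp only [h3]
        split_ifs <;> simp
  have : roughM k N = roughM (k + 1) N + - roughM (k + 1) (N / k) := by
    rw [← hsum]
    unfold roughM
    rw [← Finset.sum_add_distrib]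
    exact Finset.sum_congr rfl fun n _ => hterm n
  linarith

theorem roughM_small (k : ℕ) : IsSmall (roughM k) := by
  induction k with
  | zero =>
    have : roughM 0 = mertensM := by
      funext N
      unfold roughM mertensM
      refine Finset.sum_congr rfl fun n _ => ?_
      rw [if_pos]
      intro p _ _
      exact Nat.zero_le p
    rw [this]
    exact IsSmall.of_bound mertensM_littleO
  | succ k ih =>
    by_cases hk : k.Prime
    · intro ε hε
      obtain ⟨C, hC0, hC⟩ := ih (ε / 4) (by positivity)
      refine ⟨C / (ε / 4), by positivity, fun N => ?_⟩
      induction N using Nat.strong_induction_on with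
      | _ N ihN =>
        by_cases hN : (N : ℝ) ≤ C / (ε / 4)
        · have := roughM_abs (k + 1) N
          have : 0 ≤ ε * N := by positivity
          linarith
        · push Not at hN
          have hNpos : (0:ℝ) < N := lt_of_le_of_lt (by positivity) hN
          have hN0 : 0 < N := by exact_mod_cast hNpos
          rw [roughM_succ_of_prime hk]
          have h1 := ihN (N / k) (Nat.div_lt_self hN0 hk.one_lt)
          have h2 := hC N
          have h3 : ((N / k : ℕ) : ℝ) ≤ N / 2 := by
            refine Nat.cast_div_le.trans ?_
            have : (2:ℝ) ≤ k := by exact_mod_cast hk.two_le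
            gcongr
          rw [div_lt_iff₀ (by positivity)] at hN
          refine (abs_add_le _ _).trans ?_
          have h4 : ε * ((N / k : ℕ) : ℝ) ≤ ε * (N / 2) := by gcongr
          linarith
    · have : roughM (k + 1) = roughM k := funext (roughM_succ_of_not_prime hk)
      rw [this]; exact ih

theorem rough_count (ε : ℝ) (hε : 0 < ε) : ∃ k : ℕ, ∃ C : ℝ, ∀ N : ℕ,
    (((Finset.Icc 1 N).filter (IsRough k)).card : ℝ) ≤ ε * N + C := by
  have hdiv : Tendsto (fun k : ℕ => ∑ n ∈ Finset.range k,
      Set.indicator {p : ℕ | p.Prime} (fun n : ℕ => (1:ℝ) / n) n) atTop atTop := by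
    refine (not_summable_iff_tendsto_nat_atTop_of_nonneg ?_).mp not_summable_one_div_on_primes
    intro n
    exact Set.indicator_nonneg (fun _ _ => by positivity) n
  obtain ⟨k, hk⟩ := (hdiv.eventually_ge_atTop (-Real.log ε)).exists
  set s := (Finset.range k).filter Nat.Prime with hs
  have hsp : ∀ p ∈ s, p.Prime := fun p hp => (Finset.mem_filter.mp hp).2
  have hsum : -Real.log ε ≤ ∑ p ∈ s, (1:ℝ) / p := by
    refine hk.trans (le_of_eq ?_)
    rw [hs, Finset.sum_filter]
    refine Finset.sum_congr rfl fun n _ => ?_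
    by_cases h : n.Prime <;> simp [h]
  set P := ∏ p ∈ s, p with hP
  have hP0 : P ≠ 0 := Finset.prod_ne_zero_iff.mpr fun p hp => (hsp p hp).ne_zero
  have htot : (Nat.totient P : ℝ) ≤ P * ε := by
    have h1 := Nat.totient_eq_mul_prod_factors P
    have h2 : P.primeFactors = s := Nat.primeFactors_prod hsp
    rw [h2] at h1
    have h3 : (Nat.totient P : ℝ) = P * ∏ p ∈ s, (1 - (p : ℝ)⁻¹) := by
      have h4 := congrArg (Rat.cast : ℚ → ℝ) h1
      push_cast at h4
      exact h4
    rw [h3]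
    gcongr
    calc ∏ p ∈ s, (1 - (p : ℝ)⁻¹) ≤ ∏ p ∈ s, Real.exp (-(1 / (p:ℝ))) := by
          refine Finset.prod_le_prod (fun p hp => ?_) fun p hp => ?_
          · have : (1:ℝ) ≤ p := by exact_mod_cast (hsp p hp).one_lt.le
            have := inv_le_one_of_one_le₀ this
            linarith
          · have := Real.add_one_le_exp (-(1 / (p:ℝ)))
            rw [one_div] at *
            linarith
      _ = Real.exp (-∑ p ∈ s, (1:ℝ) / p) := by rw [← Real.exp_sum, Finset.sum_neg_distrib]
      _ ≤ Real.exp (Real.log ε) := Real.exp_le_exp.mpr (by linarith)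
      _ = ε := Real.exp_log hε
  refine ⟨k, Nat.totient P, fun N => ?_⟩
  have hsub : (Finset.Icc 1 N).filter (IsRough k) ⊆
      (Finset.Ico 1 (1 + N)).filter (fun x => P.Coprime x) := by
    intro n hn
    simp only [Finset.mem_filter, Finset.mem_Icc, Finset.mem_Ico] at hn ⊢
    refine ⟨by omega, ?_⟩
    refine Nat.Coprime.prod_left fun p hp => ?_
    rw [Nat.Prime.coprime_iff_not_dvd (hsp p hp)]
    intro hpn
    have := hn.2 p (hsp p hp) hpn
    have := Finset.mem_range.mp (Finset.mem_filter.mp hp).1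
    omega
  have h1 := (Finset.card_le_card hsub).trans (Nat.Ico_filter_coprime_le 1 N hP0)
  have h2 : (((Finset.Icc 1 N).filter (IsRough k)).card : ℝ) ≤
      Nat.totient P * (((N / P : ℕ) : ℝ) + 1) := by exact_mod_cast h1
  refine h2.trans ?_
  have hPR : (0:ℝ) < P := by exact_mod_cast Nat.pos_of_ne_zero hP0
  have h3 : ((N / P : ℕ) : ℝ) ≤ N / P := Nat.cast_div_le
  rw [mul_add, mul_one]
  have h4 : (Nat.totient P : ℝ) * ((N / P : ℕ) : ℝ) ≤ P * ε * (N / P) := by gcongr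
  have h5 : (P : ℝ) * ε * (N / P) = ε * N := by field_simp
  linarith

/-- The function `μ(n) h(p_min(n))`, with value `0` at `n ≤ 1`. -/
noncomputable def muMin (h : ℕ → ℝ) (n : ℕ) : ℝ :=
  if 2 ≤ n then (moebius n : ℝ) * h n.minFac else 0

theorem muMin_abs (h : ℕ → ℝ) (C : ℝ) (hh : ∀ n, |h n| ≤ C) (n : ℕ) : |muMin h n| ≤ C := by
  have hC : 0 ≤ C := (abs_nonneg _).trans (hh 0)
  unfold muMin
  split_ifs
  · rw [abs_mul]
    calc _ ≤ 1 * C := by gcongr; exact moebius_abs_le n; exact hh _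
      _ = C := one_mul C
  · simpa using hC

theorem muMin_small (h : ℕ → ℝ) (C : ℝ) (hh : ∀ n, |h n| ≤ C) :
    IsSmall (fun N => ∑ n ∈ Finset.Icc 1 N, muMin h n) := by
  have hC : 0 ≤ C := (abs_nonneg _).trans (hh 0)
  refine IsSmall.of_bound fun ε hε => ?_
  obtain ⟨k, D, hD⟩ := rough_count (ε / (2 * (C + 1))) (by positivity)
  have hmain : IsSmall (fun N => ∑ p ∈ Finset.range k, h p * (roughM p N - roughM (p + 1) N)) :=
    IsSmall.sum _ fun p _ => ((roughM_small p).sub (roughM_small (p + 1))).const_mul (h p)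
  obtain ⟨E, hE0, hE⟩ := hmain (ε / 2) (by positivity)
  refine ⟨E + C * D, fun N => ?_⟩
  have hterm : ∀ n ∈ Finset.Icc 1 N, muMin h n =
      ∑ p ∈ Finset.range k, h p * ((if IsRough p n then (moebius n : ℝ) else 0) -
        (if IsRough (p + 1) n then (moebius n : ℝ) else 0)) +
      (if IsRough k n then muMin h n else 0) := by
    intro n hn
    rcases (Finset.mem_Icc.mp hn).1.eq_or_lt with h1 | h1
    · subst h1
      simp [isRough_one, muMin]
    · have hn2 : 2 ≤ n := h1
      simp only [isRough_iff hn2]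
      have e : ∀ p ∈ Finset.range k, h p * ((if p ≤ n.minFac then (moebius n : ℝ) else 0) -
        (if p + 1 ≤ n.minFac then (moebius n : ℝ) else 0)) =
          if p = n.minFac then muMin h n else 0 := by
        intro p _
        unfold muMin
        rw [if_pos hn2]
        rcases lt_trichotomy p n.minFac with h2 | h2 | h2
        · rw [if_pos h2.le, if_pos (by omega), if_neg h2.ne]; ring
        · rw [if_pos h2.le, if_neg (by omega), if_pos h2, h2]; ring
        · rw [if_neg (by omega), if_neg (by omega), if_neg h2.ne']; ring
      rw [Finset.sum_congr rfl e, Finset.sum_ite_eq']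
      by_cases h3 : k ≤ n.minFac
      · rw [if_neg (by simpa using h3), if_pos h3]; ring
      · rw [if_pos (by simpa using h3), if_neg h3]; ring
  rw [Finset.sum_congr rfl hterm, Finset.sum_add_distrib, Finset.sum_comm]
  have hA : ∑ p ∈ Finset.range k, ∑ n ∈ Finset.Icc 1 N,
      h p * ((if IsRough p n then (moebius n : ℝ) else 0) -
        (if IsRough (p + 1) n then (moebius n : ℝ) else 0)) =
      ∑ p ∈ Finset.range k, h p * (roughM p N - roughM (p + 1) N) := by
    refine Finset.sum_congr rfl fun p _ => ?_
    rw [← Finset.mul_sum, Finset.sum_sub_distrib]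
    rfl
  rw [hA]
  have hB : |∑ n ∈ Finset.Icc 1 N, (if IsRough k n then muMin h n else 0)| ≤
      C * ((Finset.Icc 1 N).filter (IsRough k)).card := by
    rw [← Finset.sum_filter]
    calc _ ≤ ∑ n ∈ (Finset.Icc 1 N).filter (IsRough k), C :=
          (Finset.abs_sum_le_sum_abs _ _).trans (Finset.sum_le_sum fun n _ => muMin_abs h C hh n)
      _ = _ := by rw [Finset.sum_const, nsmul_eq_mul, mul_comm]
  refine (abs_add_le _ _).trans ?_
  have h1 := hE N
  have h2 : C * ((Finset.Icc 1 N).filter (IsRough k)).card ≤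
      C * (ε / (2 * (C + 1)) * N + D) := by gcongr; exact hD N
  have h3 : C * (ε / (2 * (C + 1)) * N) ≤ ε / 2 * N := by
    have : C * (ε / (2 * (C + 1)) * N) = (C / (C + 1)) * (ε / 2 * N) := by field_simp
    rw [this]
    refine mul_le_of_le_one_left (by positivity) ?_
    rw [div_le_one (by positivity)]; linarith
  linarith

end Rough

section Duality
open Topology
open ArithmeticFunction (moebius)

/-- The largest prime factor of `n`. -/
noncomputable def pmax (n : ℕ) : ℕ := n.primeFactors.sup id

theorem le_pmax {n p : ℕ} (hn : n ≠ 0) (hp : p.Prime) (h : p ∣ n) : p ≤ pmax n :=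
  Finset.le_sup (f := id) (Nat.mem_primeFactors.mpr ⟨hp, h, hn⟩)

theorem pmax_mem {n : ℕ} (hn : 2 ≤ n) : pmax n ∈ n.primeFactors := by
  have hne : n.primeFactors.Nonempty := Nat.nonempty_primeFactors.mpr (by omega)
  obtain ⟨i, hi, h⟩ := Finset.exists_mem_eq_sup n.primeFactors hne id
  unfold pmax
  rw [h]; exact hi

theorem pmax_prime {n : ℕ} (hn : 2 ≤ n) : (pmax n).Prime :=
  Nat.prime_of_mem_primeFactors (pmax_mem hn)

theorem pmax_dvd {n : ℕ} (hn : 2 ≤ n) : pmax n ∣ n :=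
  Nat.dvd_of_mem_primeFactors (pmax_mem hn)

theorem pmax_one : pmax 1 = 0 := by simp [pmax]

theorem pmax_mul {m p : ℕ} (hm : m ≠ 0) (hp : p.Prime) (h : pmax m ≤ p) : pmax (m * p) = p := by
  unfold pmax at *
  rw [Nat.primeFactors_mul hm hp.ne_zero, Finset.sup_union, hp.primeFactors]
  simpa using h

theorem muMin_prime_mul (h : ℕ → ℝ) {n p d : ℕ} (hn : 2 ≤ n) (hp : p = pmax n) (hd : d ∣ n)
    (hpd : ¬ p ∣ d) (hd2 : 2 ≤ d) : muMin h (p * d) = - muMin h d := by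
  have hpp : p.Prime := hp ▸ pmax_prime hn
  have h2 : 2 ≤ p * d := le_trans hd2 (Nat.le_mul_of_pos_left _ hpp.pos)
  have hcop : Nat.Coprime p d := (Nat.Prime.coprime_iff_not_dvd hpp).mpr hpd
  have hmf : (p * d).minFac = d.minFac := by
    apply le_antisymm
    · exact Nat.minFac_le_of_dvd (Nat.minFac_prime (by omega)).two_le
        ((Nat.minFac_dvd d).trans (dvd_mul_left _ _))
    · have hq := Nat.minFac_prime (n := p * d) (by omega)
      rcases (Nat.Prime.dvd_mul hq).mp (Nat.minFac_dvd (p * d)) with h' | h'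
      · have : (p * d).minFac = p := (Nat.prime_dvd_prime_iff_eq hq hpp).mp h'
        rw [this, hp]
        exact le_pmax (by omega) (Nat.minFac_prime (by omega)) ((Nat.minFac_dvd d).trans hd)
      · exact Nat.minFac_le_of_dvd hq.two_le h'
  unfold muMin
  rw [if_pos h2, if_pos hd2, hmf,
    ArithmeticFunction.isMultiplicative_moebius.map_mul_of_coprime hcop,
    ArithmeticFunction.moebius_apply_prime hpp]
  push_cast; ring

theorem sum_divisors_muMin (h : ℕ → ℝ) {n : ℕ} (hn : 2 ≤ n) :
    ∑ d ∈ n.divisors, muMin h d = - h (pmax n) := by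
  set p := pmax n with hp
  have hpp : p.Prime := pmax_prime hn
  have hpn : p ∣ n := pmax_dvd hn
  have hn0 : n ≠ 0 := by omega
  rw [← Finset.sum_filter_add_sum_filter_not n.divisors (fun d => p ∣ d)]
  have key : ∑ d ∈ n.divisors with p ∣ d, muMin h d =
      ∑ d ∈ n.divisors with ¬ p ∣ d, muMin h (p * d) := by
    rw [← Finset.sum_image (f := muMin h) (g := fun d => p * d)
      (s := n.divisors.filter (fun d => ¬ p ∣ d))]
    · symm
      apply Finset.sum_subset
      · intro e he
        simp only [Finset.mem_image, Finset.mem_filter, Nat.mem_divisors] at he ⊢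
        obtain ⟨d, ⟨⟨hd, _⟩, hpd⟩, rfl⟩ := he
        exact ⟨⟨Nat.Coprime.mul_dvd_of_dvd_of_dvd
          ((Nat.Prime.coprime_iff_not_dvd hpp).mpr hpd) hpn hd, hn0⟩, dvd_mul_right _ _⟩
      · intro e he hne
        simp only [Finset.mem_image, Finset.mem_filter, Nat.mem_divisors] at he hne
        obtain ⟨⟨hen, _⟩, d, rfl⟩ := he
        have hpd : p ∣ d := by
          by_contra hpd
          exact hne ⟨d, ⟨⟨(dvd_mul_left _ _).trans hen, hn0⟩, hpd⟩, rfl⟩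
        have : moebius (p * d) = 0 := by
          apply ArithmeticFunction.moebius_eq_zero_of_not_squarefree
          intro hsq
          have := hsq p (Nat.mul_dvd_mul_left p hpd)
          exact hpp.one_lt.ne' (Nat.isUnit_iff.mp this)
        unfold muMin
        rw [this]; simp
    · intro a _ b _ hab
      exact Nat.eq_of_mul_eq_mul_left hpp.pos hab
  rw [key, ← Finset.sum_add_distrib, Finset.sum_eq_single 1]
  · simp only [mul_one, muMin]
    rw [if_pos hpp.two_le, if_neg (by omega), hpp.minFac_eq,
      ArithmeticFunction.moebius_apply_prime hpp]
    push_cast; ring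
  · intro d hd hd1
    simp only [Finset.mem_filter, Nat.mem_divisors] at hd
    have hd0 : d ≠ 0 := by rintro rfl; exact hd.2 (dvd_zero _)
    rw [muMin_prime_mul h hn hp hd.1.1 hd.2 (by omega)]
    ring
  · intro h1
    exfalso; apply h1
    simp only [Finset.mem_filter, Nat.mem_divisors]
    exact ⟨⟨one_dvd _, hn0⟩, fun h' => hpp.one_lt.ne' (Nat.dvd_one.mp h')⟩

theorem muMin_floor_sum (h : ℕ → ℝ) (N : ℕ) :
    ∑ n ∈ Finset.Icc 1 N, muMin h n * ((N / n : ℕ) : ℝ) = - ∑ n ∈ Finset.Icc 2 N, h (pmax n) := by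
  let f : ArithmeticFunction ℝ := ⟨muMin h, by simp [muMin]⟩
  have h1 := ArithmeticFunction.sum_Ioc_mul_zeta_eq_sum f N
  have hI : Finset.Ioc 0 N = Finset.Icc 1 N := by ext; simp; omega
  rw [hI] at h1
  change _ = ∑ n ∈ Finset.Icc 1 N, muMin h n * ((N / n : ℕ) : ℝ) at h1
  rw [← h1, ← Finset.sum_neg_distrib]
  symm
  rw [← Finset.sum_subset (s₁ := Finset.Icc 2 N) (s₂ := Finset.Icc 1 N)]
  · refine Finset.sum_congr rfl fun n hn => ?_
    rw [ArithmeticFunction.coe_mul_zeta_apply]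
    exact (sum_divisors_muMin h (Finset.mem_Icc.mp hn).1).symm
  · intro n hn; simp at *; omega
  · intro n hn hn2
    have : n = 1 := by simp at *; omega
    subst this
    rw [ArithmeticFunction.coe_mul_zeta_apply]
    simp [f, muMin]

theorem moebius_floor_sum {N : ℕ} (hN : 1 ≤ N) :
    ∑ n ∈ Finset.Icc 1 N, (moebius n : ℝ) * ((N / n : ℕ) : ℝ) = 1 := by
  have h1 := ArithmeticFunction.sum_Ioc_mul_zeta_eq_sum (moebius : ArithmeticFunction ℤ) N
  have hI : Finset.Ioc 0 N = Finset.Icc 1 N := by ext; simp; omega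
  rw [hI, ArithmeticFunction.moebius_mul_coe_zeta] at h1
  have h2 : ∑ n ∈ Finset.Icc 1 N, (1 : ArithmeticFunction ℤ) n = 1 := by
    rw [Finset.sum_eq_single 1]
    · simp
    · intro b _ hb; exact ArithmeticFunction.one_apply_ne hb
    · intro h; simp at h; omega
  rw [h2] at h1
  have := congrArg (Int.cast : ℤ → ℝ) h1
  push_cast at this
  exact this.symm

/-- Decomposition `n = m p` with `p` the largest prime factor. -/
theorem sum_pmax (h : ℕ → ℝ) (N : ℕ) :
    ∑ n ∈ Finset.Icc 2 N, h (pmax n) =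
      ∑ m ∈ Finset.Icc 1 N, ∑ p ∈ (Finset.Icc 1 (N / m)).filter
        (fun p => p.Prime ∧ pmax m ≤ p), h p := by
  rw [Finset.sum_sigma']
  refine Finset.sum_bij' (fun n _ => (⟨n / pmax n, pmax n⟩ : (_ : ℕ) × ℕ))
    (fun x _ => x.1 * x.2) ?_ ?_ ?_ ?_ ?_
  · intro n hn
    rw [Finset.mem_Icc] at hn
    have hpp := pmax_prime hn.1
    have hpn := pmax_dvd hn.1
    have h1 : n / pmax n * pmax n = n := Nat.div_mul_cancel hpn
    have hpos : 0 < n / pmax n := Nat.div_pos (Nat.le_of_dvd (by omega) hpn) hpp.pos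
    simp only [Finset.mem_sigma, Finset.mem_Icc, Finset.mem_filter]
    refine ⟨⟨hpos, (Nat.div_le_self _ _).trans hn.2⟩, ⟨hpp.one_le, ?_⟩, hpp, ?_⟩
    · rw [Nat.le_div_iff_mul_le hpos, mul_comm, h1]; exact hn.2
    · unfold pmax
      exact Finset.sup_mono (Nat.primeFactors_mono (Nat.div_dvd_of_dvd hpn) (by omega))
  · rintro ⟨m, p⟩ hx
    simp only [Finset.mem_sigma, Finset.mem_Icc, Finset.mem_filter] at hx ⊢
    obtain ⟨⟨hm1, hm2⟩, ⟨hp1, hp2⟩, hpp, hle⟩ := hx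
    rw [Nat.le_div_iff_mul_le (by omega), mul_comm] at hp2
    exact ⟨le_trans hpp.two_le (Nat.le_mul_of_pos_left _ (by omega)), hp2⟩
  · intro n hn
    rw [Finset.mem_Icc] at hn
    exact Nat.div_mul_cancel (pmax_dvd hn.1)
  · rintro ⟨m, p⟩ hx
    simp only [Finset.mem_sigma, Finset.mem_Icc, Finset.mem_filter] at hx ⊢
    obtain ⟨⟨hm1, hm2⟩, ⟨hp1, hp2⟩, hpp, hle⟩ := hx
    rw [pmax_mul (by omega) hpp hle, Nat.mul_div_cancel _ hpp.pos]
  · intro n hn; rfl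

end Duality

section Smooth
open Topology

theorem log_factorial_ge_sum (y : ℕ) :
    ∑ p ∈ Nat.primesLE y, ((y / p : ℕ) : ℝ) * Real.log p ≤ Real.log (y.factorial : ℝ) := by
  rw [Real.log_nat_eq_sum_factorization, Finsupp.sum]
  have hsub : Nat.primesLE y ⊆ y.factorial.factorization.support := by
    intro p hp
    rw [Nat.mem_primesLE] at hp
    rw [Nat.support_factorization, Nat.mem_primeFactors]
    exact ⟨hp.2, (Nat.Prime.dvd_factorial hp.2).mpr hp.1, Nat.factorial_ne_zero _⟩
  refine le_trans (Finset.sum_le_sum fun p hp => ?_)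
    (Finset.sum_le_sum_of_subset_of_nonneg hsub fun p _ _ => by positivity)
  rw [Nat.mem_primesLE] at hp
  have hlog : 0 ≤ Real.log (p : ℝ) := Real.log_natCast_nonneg p
  refine mul_le_mul_of_nonneg_right ?_ hlog
  rw [Nat.factorization_factorial hp.2 (b := Nat.log p y + 2) (by omega)]
  have : y / p ^ 1 ≤ ∑ i ∈ Finset.Ico 1 (Nat.log p y + 2), y / p ^ i :=
    Finset.single_le_sum (f := fun i => y / p ^ i) (fun _ _ => Nat.zero_le _) (by simp)
  rw [pow_one] at this
  exact_mod_cast this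

theorem sum_log_div_le (y : ℕ) :
    ∑ p ∈ Nat.primesLE y, Real.log p / p ≤ 2 * Real.log y := by
  rcases Nat.eq_zero_or_pos y with rfl | hy
  · simp [Nat.primesLE]
  have hy' : (0:ℝ) < y := by exact_mod_cast hy
  have h1 := log_factorial_ge_sum y
  have h2 : Real.log (y.factorial : ℝ) ≤ y * Real.log y := by
    rw [← Real.log_pow]
    apply Real.log_le_log
    · exact_mod_cast Nat.factorial_pos y
    · exact_mod_cast Nat.factorial_le_pow y
  have h3 : ∑ p ∈ Nat.primesLE y, (y / 2 : ℝ) * (Real.log p / p) ≤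
      ∑ p ∈ Nat.primesLE y, ((y / p : ℕ) : ℝ) * Real.log p := by
    refine Finset.sum_le_sum fun p hp => ?_
    rw [Nat.mem_primesLE] at hp
    have hp0 : (0:ℝ) < p := by exact_mod_cast hp.2.pos
    have hlog : 0 ≤ Real.log (p : ℝ) := Real.log_natCast_nonneg p
    have hq1 : 1 ≤ y / p := Nat.div_pos hp.1 hp.2.pos
    have hmod := Nat.div_add_mod y p
    have hlt := Nat.mod_lt y hp.2.pos
    have hle : y ≤ 2 * (p * (y / p)) := by nlinarith
    have hle' : (y : ℝ) ≤ 2 * (p * ((y / p : ℕ) : ℝ)) := by exact_mod_cast hle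
    have : (y / 2 : ℝ) / p ≤ ((y / p : ℕ) : ℝ) := by
      rw [div_le_iff₀ hp0]; linarith
    calc (y / 2 : ℝ) * (Real.log p / p) = (y / 2 : ℝ) / p * Real.log p := by ring
      _ ≤ _ := mul_le_mul_of_nonneg_right this hlog
  rw [← Finset.mul_sum] at h3
  have h4 := h3.trans (h1.trans h2)
  have : (y:ℝ) * (∑ p ∈ Nat.primesLE y, Real.log p / p) ≤ y * (2 * Real.log y) := by linarith
  exact le_of_mul_le_mul_left this hy'

theorem sum_factorization (p N : ℕ) :
    ∑ n ∈ Finset.Icc 1 N, n.factorization p = N.factorial.factorization p := by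
  induction N with
  | zero => simp
  | succ N ih =>
    rw [Finset.sum_Icc_succ_top (by omega), ih, Nat.factorial_succ,
      Nat.factorization_mul (by omega) (Nat.factorial_ne_zero N)]
    simp [add_comm]

theorem smooth_log_sum (N y : ℕ) :
    ∑ n ∈ (Finset.Icc 2 N).filter (fun n => pmax n ≤ y), Real.log n ≤ 4 * N * Real.log y := by
  have h1 : ∀ n ∈ (Finset.Icc 2 N).filter (fun n => pmax n ≤ y), Real.log n ≤
      ∑ p ∈ Nat.primesLE y, (n.factorization p : ℝ) * Real.log p := by
    intro n hn
    rw [Finset.mem_filter, Finset.mem_Icc] at hn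
    rw [Real.log_nat_eq_sum_factorization, Finsupp.sum]
    refine Finset.sum_le_sum_of_subset_of_nonneg ?_ fun p _ _ => by positivity
    intro p hp
    rw [Nat.support_factorization, Nat.mem_primeFactors] at hp
    rw [Nat.mem_primesLE]
    exact ⟨(le_pmax hp.2.2 hp.1 hp.2.1).trans hn.2, hp.1⟩
  calc _ ≤ ∑ n ∈ (Finset.Icc 2 N).filter (fun n => pmax n ≤ y),
        ∑ p ∈ Nat.primesLE y, (n.factorization p : ℝ) * Real.log p := Finset.sum_le_sum h1
    _ ≤ ∑ n ∈ Finset.Icc 1 N, ∑ p ∈ Nat.primesLE y, (n.factorization p : ℝ) * Real.log p := by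
        refine Finset.sum_le_sum_of_subset_of_nonneg ?_ fun n _ _ => by positivity
        intro n hn
        rw [Finset.mem_filter, Finset.mem_Icc] at hn
        rw [Finset.mem_Icc]; omega
    _ = ∑ p ∈ Nat.primesLE y, (N.factorial.factorization p : ℝ) * Real.log p := by
        rw [Finset.sum_comm]
        refine Finset.sum_congr rfl fun p _ => ?_
        rw [← Finset.sum_mul, ← sum_factorization]
        push_cast; rfl
    _ ≤ ∑ p ∈ Nat.primesLE y, (2 * N : ℝ) * (Real.log p / p) := by
        refine Finset.sum_le_sum fun p hp => ?_
        rw [Nat.mem_primesLE] at hp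
        have hp0 : (0:ℝ) < p := by exact_mod_cast hp.2.pos
        have hlog : 0 ≤ Real.log (p : ℝ) := Real.log_natCast_nonneg p
        have h2 := Nat.factorization_factorial_le_div_pred hp.2 N
        have hp2 := hp.2.two_le
        have h3 : N / (p - 1) * (p - 1) ≤ N := Nat.div_mul_le_self _ _
        have h4 : N.factorial.factorization p * p ≤ 2 * N := by
          have : p ≤ 2 * (p - 1) := by omega
          calc N.factorial.factorization p * p ≤ (N / (p - 1)) * (2 * (p - 1)) :=
                Nat.mul_le_mul h2 this
            _ = 2 * (N / (p - 1) * (p - 1)) := by ring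
            _ ≤ _ := by omega
        have h5 : (N.factorial.factorization p : ℝ) ≤ 2 * N / p := by
          rw [le_div_iff₀ hp0]; exact_mod_cast h4
        calc _ ≤ (2 * N / p : ℝ) * Real.log p := mul_le_mul_of_nonneg_right h5 hlog
          _ = _ := by ring
    _ = (2 * N : ℝ) * ∑ p ∈ Nat.primesLE y, Real.log p / p := by rw [Finset.mul_sum]
    _ ≤ (2 * N : ℝ) * (2 * Real.log y) :=
        mul_le_mul_of_nonneg_left (sum_log_div_le y) (by positivity)
    _ = _ := by ring

theorem smooth_card (N y : ℕ) (hN : 2 ≤ N) :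
    (((Finset.Icc 2 N).filter (fun n => pmax n ≤ y)).card : ℝ) ≤
      √N + 8 * N * Real.log y / Real.log N := by
  have hlogN : 0 < Real.log (N : ℝ) := Real.log_pos (by exact_mod_cast hN)
  set A := (Finset.Icc 2 N).filter (fun n => pmax n ≤ y) with hA
  have h1 : ∀ n ∈ A, Real.log N / 2 ≤ Real.log n + if n ≤ Nat.sqrt N then Real.log N / 2 else 0 := by
    intro n hn
    rw [hA, Finset.mem_filter, Finset.mem_Icc] at hn
    split_ifs with h
    · have := Real.log_natCast_nonneg n
      linarith
    · push Not at h
      rw [← Real.log_sqrt (by positivity), add_zero]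
      apply Real.log_le_log (Real.sqrt_pos.mpr (by positivity))
      rw [Real.sqrt_le_left (by positivity)]
      have := Nat.sqrt_lt'.mp h
      exact_mod_cast this.le
  have h2 := Finset.sum_le_sum h1
  rw [Finset.sum_const, nsmul_eq_mul, Finset.sum_add_distrib, ← Finset.sum_filter,
    Finset.sum_const, nsmul_eq_mul] at h2
  have h3 : ((A.filter (fun n => n ≤ Nat.sqrt N)).card : ℝ) ≤ √N := by
    have : (A.filter (fun n => n ≤ Nat.sqrt N)).card ≤ (Finset.Icc 1 (Nat.sqrt N)).card := by
      apply Finset.card_le_card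
      intro n hn
      rw [Finset.mem_filter, hA, Finset.mem_filter, Finset.mem_Icc] at hn
      rw [Finset.mem_Icc]; omega
    rw [Nat.card_Icc, Nat.add_sub_cancel] at this
    exact le_trans (by exact_mod_cast this) Real.nat_sqrt_le_real_sqrt
  have h4 := smooth_log_sum N y
  rw [← hA] at h4
  have h5 : (A.card : ℝ) * (Real.log N / 2) ≤
      4 * N * Real.log y + √N * (Real.log N / 2) :=
    h2.trans (add_le_add h4 (mul_le_mul_of_nonneg_right h3 (by positivity)))
  have h6 : (√N + 8 * N * Real.log y / Real.log N) * (Real.log N / 2) =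
      4 * N * Real.log y + √N * (Real.log N / 2) := by
    field_simp; ring
  rw [← h6] at h5
  exact le_of_mul_le_mul_right h5 (by positivity)

theorem pi_le_six {T : ℕ} (hT : 2 ≤ T) : (Nat.primeCounting T : ℝ) ≤ 6 * T / Real.log T := by
  have hT1 : (1:ℝ) < T := by exact_mod_cast hT
  have hlog : 0 < Real.log (T:ℝ) := Real.log_pos hT1
  have h := Chebyshev.pi_le_log4_mul_div hT1
  rw [Nat.floor_natCast, Real.log_sqrt (by positivity)] at h
  have hs : 0 < √(T:ℝ) := Real.sqrt_pos.mpr (by positivity)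
  have h1 : Real.log T / 2 ≤ √(T:ℝ) - 1 := by
    rw [← Real.log_sqrt (by positivity)]
    exact Real.log_le_sub_one_of_pos hs
  have hss : √(T:ℝ) * √(T:ℝ) = T := Real.mul_self_sqrt (by positivity)
  have h4 : Real.log 4 ≤ 2 := by
    rw [show (4:ℝ) = 2 ^ 2 by norm_num, Real.log_pow]
    have := Real.log_two_lt_d9
    push_cast; linarith
  refine h.trans ?_
  rw [le_div_iff₀ hlog, add_mul]
  have e1 : Real.log 4 * T / (Real.log T / 2) * Real.log T = 2 * Real.log 4 * T := by
    field_simp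
  rw [e1]
  have e2 : √(T:ℝ) * Real.log T ≤ 2 * T := by nlinarith
  nlinarith

theorem inner_bound (h : ℕ → ℝ) (η C : ℝ) (hη : 0 ≤ η) (hC : 0 ≤ C)
    (hH : ∀ t : ℕ, |∑ p ∈ (Finset.Icc 1 t).filter Nat.Prime, h p| ≤ η * Nat.primeCounting t + C)
    (a T : ℕ) :
    |∑ p ∈ (Finset.Icc 1 T).filter (fun p => p.Prime ∧ a ≤ p), h p| ≤
      2 * (η * Nat.primeCounting T + C) := by
  have hnn : 0 ≤ η * Nat.primeCounting T + C := by positivity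
  by_cases haT : a ≤ T
  · have hsplit : ∑ p ∈ (Finset.Icc 1 T).filter Nat.Prime, h p =
        ∑ p ∈ (Finset.Icc 1 (a - 1)).filter Nat.Prime, h p +
        ∑ p ∈ (Finset.Icc 1 T).filter (fun p => p.Prime ∧ a ≤ p), h p := by
      rw [← Finset.sum_union]
      · congr 1
        ext p
        simp only [Finset.mem_union, Finset.mem_filter, Finset.mem_Icc]
        constructor
        · rintro ⟨⟨h1, h2⟩, h3⟩
          by_cases h4 : a ≤ p
          · exact Or.inr ⟨⟨h1, h2⟩, h3, h4⟩
          · exact Or.inl ⟨⟨h1, by omega⟩, h3⟩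
        · rintro (⟨⟨h1, h2⟩, h3⟩ | ⟨⟨h1, h2⟩, h3, h4⟩)
          · exact ⟨⟨h1, by omega⟩, h3⟩
          · exact ⟨⟨h1, h2⟩, h3⟩
      · rw [Finset.disjoint_left]
        intro p hp hp'
        simp only [Finset.mem_filter, Finset.mem_Icc] at hp hp'
        omega
    have e : ∑ p ∈ (Finset.Icc 1 T).filter (fun p => p.Prime ∧ a ≤ p), h p =
        ∑ p ∈ (Finset.Icc 1 T).filter Nat.Prime, h p -
        ∑ p ∈ (Finset.Icc 1 (a - 1)).filter Nat.Prime, h p := by rw [hsplit]; ring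
    rw [e]
    have hmono : (Nat.primeCounting (a - 1) : ℝ) ≤ Nat.primeCounting T := by
      exact_mod_cast Nat.monotone_primeCounting (by omega)
    have := mul_le_mul_of_nonneg_left hmono hη
    refine (abs_sub _ _).trans ?_
    linarith [hH T, hH (a - 1)]
  · rw [Finset.filter_false_of_mem]
    · simp; linarith
    · intro p hp
      rw [Finset.mem_Icc] at hp
      omega

theorem pmax_core (h : ℕ → ℝ) (Ch : ℝ) (hh : ∀ n, |h n| ≤ Ch) (η C : ℝ) (hη : 0 ≤ η) (hC : 0 ≤ C)
    (hH : ∀ t : ℕ, |∑ p ∈ (Finset.Icc 1 t).filter Nat.Prime, h p| ≤ η * Nat.primeCounting t + C)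
    (N y : ℕ) (hN : 2 ≤ N) (hy : 2 ≤ y) :
    |∑ n ∈ Finset.Icc 2 N, h (pmax n)| ≤
      12 * η * N * (1 + Real.log N) / Real.log y + 2 * C * N / y +
      Ch * (√N + 8 * N * Real.log y / Real.log N) := by
  have hCh : 0 ≤ Ch := (abs_nonneg _).trans (hh 0)
  have hlogy : 0 < Real.log (y:ℝ) := Real.log_pos (by exact_mod_cast hy)
  have hy0 : (0:ℝ) < y := by positivity
  rw [sum_pmax, ← Finset.sum_filter_add_sum_filter_not (Finset.Icc 1 N) (fun m => y ≤ N / m)]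
  refine (abs_add_le _ _).trans (add_le_add ?_ ?_)
  · refine (Finset.abs_sum_le_sum_abs _ _).trans ?_
    have h1 : ∀ m ∈ (Finset.Icc 1 N).filter (fun m => y ≤ N / m),
        |∑ p ∈ (Finset.Icc 1 (N / m)).filter (fun p => p.Prime ∧ pmax m ≤ p), h p| ≤
        12 * η * N / Real.log y * (m:ℝ)⁻¹ + 2 * C := by
      intro m hm
      rw [Finset.mem_filter, Finset.mem_Icc] at hm
      refine (inner_bound h η C hη hC hH _ _).trans ?_
      have hm0 : (0:ℝ) < m := by exact_mod_cast hm.1.1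
      have hpi := pi_le_six (T := N / m) (by omega)
      have hl : Real.log y ≤ Real.log ((N / m : ℕ) : ℝ) :=
        Real.log_le_log hy0 (by exact_mod_cast hm.2)
      have hd : ((N / m : ℕ) : ℝ) ≤ N / m := Nat.cast_div_le
      have h2 : (Nat.primeCounting (N / m) : ℝ) ≤ 6 * (N / m) / Real.log y := by
        refine hpi.trans ?_
        gcongr
      have := mul_le_mul_of_nonneg_left h2 hη
      have e : 12 * η * N / Real.log y * (m:ℝ)⁻¹ = 2 * (η * (6 * (N / m) / Real.log y)) := by
        field_simp; ring
      rw [e]; linarith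
    refine (Finset.sum_le_sum h1).trans ?_
    rw [Finset.sum_add_distrib, ← Finset.mul_sum, Finset.sum_const, nsmul_eq_mul]
    refine add_le_add ?_ ?_
    · have h3 : ∑ m ∈ (Finset.Icc 1 N).filter (fun m => y ≤ N / m), (m:ℝ)⁻¹ ≤ 1 + Real.log N := by
        refine le_trans (Finset.sum_le_sum_of_subset_of_nonneg (Finset.filter_subset _ _)
          fun m _ _ => by positivity) ?_
        have := harmonic_le_one_add_log N
        rw [harmonic_eq_sum_Icc] at this
        push_cast at this
        exact this
      calc _ ≤ 12 * η * N / Real.log y * (1 + Real.log N) :=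
            mul_le_mul_of_nonneg_left h3 (by positivity)
        _ = _ := by ring
    · have h4 : ((Finset.Icc 1 N).filter (fun m => y ≤ N / m)).card ≤ N / y := by
        have : (Finset.Icc 1 N).filter (fun m => y ≤ N / m) ⊆ Finset.Icc 1 (N / y) := by
          intro m hm
          rw [Finset.mem_filter, Finset.mem_Icc] at hm
          rw [Finset.mem_Icc]
          refine ⟨hm.1.1, ?_⟩
          rw [Nat.le_div_iff_mul_le (by omega), mul_comm]
          exact (Nat.le_div_iff_mul_le (by omega)).mp hm.2
        have := Finset.card_le_card this
        simpa using this
      have h5 : (((Finset.Icc 1 N).filter (fun m => y ≤ N / m)).card : ℝ) ≤ N / y :=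
        le_trans (by exact_mod_cast h4) (Nat.cast_div_le (m := N) (n := y))
      calc _ ≤ (N / y : ℝ) * (2 * C) := mul_le_mul_of_nonneg_right h5 (by positivity)
        _ = _ := by ring
  · have hcard := smooth_card N y hN
    refine le_trans ?_ (mul_le_mul_of_nonneg_left hcard hCh)
    have e : (((Finset.Icc 2 N).filter (fun n => pmax n ≤ y)).card : ℝ) =
        ∑ n ∈ Finset.Icc 2 N, (fun q : ℕ => if q ≤ y then (1:ℝ) else 0) (pmax n) := by
      simp
    rw [e, sum_pmax (fun q : ℕ => if q ≤ y then (1:ℝ) else 0) N, Finset.mul_sum]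
    refine (Finset.abs_sum_le_sum_abs _ _).trans ?_
    refine le_trans (Finset.sum_le_sum fun m hm => ?_)
      (Finset.sum_le_sum_of_subset_of_nonneg (Finset.filter_subset _ _) fun m _ _ => ?_)
    · rw [Finset.mul_sum]
      refine (Finset.abs_sum_le_sum_abs _ _).trans (Finset.sum_le_sum fun p hp => ?_)
      rw [Finset.mem_filter] at hm hp
      rw [Finset.mem_Icc] at hp
      have : p ≤ y := by omega
      simp only [this, if_true, mul_one]
      exact hh p
    · refine mul_nonneg hCh (Finset.sum_nonneg fun p _ => ?_)
      split_ifs <;> norm_num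

end Smooth

section Final
open Topology
open ArithmeticFunction (moebius)

theorem IsSmall.of_eventually {f : ℕ → ℝ}
    (hf : ∀ ε > 0, ∀ᶠ N : ℕ in atTop, |f N| ≤ ε * N) : IsSmall f := by
  refine IsSmall.of_bound fun ε hε => ?_
  obtain ⟨M, hM⟩ := eventually_atTop.mp (hf ε hε)
  refine ⟨∑ n ∈ Finset.range M, |f n|, fun N => ?_⟩
  have hnn : 0 ≤ ∑ n ∈ Finset.range M, |f n| := Finset.sum_nonneg fun _ _ => abs_nonneg _
  by_cases h : M ≤ N
  · linarith [hM N h]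
  · have := Finset.single_le_sum (f := fun n => |f n|) (s := Finset.range M) (a := N)
      (fun _ _ => abs_nonneg _) (by simpa using h)
    have h2 : 0 ≤ ε * N := by positivity
    linarith

theorem pmax_small (h : ℕ → ℝ) (Ch : ℝ) (hh : ∀ n, |h n| ≤ Ch)
    (hH : ∀ η > 0, ∃ C, 0 ≤ C ∧ ∀ t : ℕ,
      |∑ p ∈ (Finset.Icc 1 t).filter Nat.Prime, h p| ≤ η * Nat.primeCounting t + C) :
    IsSmall (fun N => ∑ n ∈ Finset.Icc 2 N, h (pmax n)) := by
  have hCh : 0 ≤ Ch := (abs_nonneg _).trans (hh 0)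
  refine IsSmall.of_eventually fun ε hε => ?_
  obtain ⟨k, hk⟩ := exists_nat_gt (32 * Ch / ε)
  have hk0 : (0:ℝ) < k := lt_of_le_of_lt (by positivity) hk
  obtain ⟨C, hC, hHC⟩ := hH (ε / (192 * k)) (by positivity)
  have ht1 : Tendsto (fun N : ℕ => Real.log (N:ℝ)) atTop atTop :=
    Real.tendsto_log_atTop.comp tendsto_natCast_atTop_atTop
  have ht2 : Tendsto (fun N : ℕ => √(N:ℝ)) atTop atTop :=
    Real.tendsto_sqrt_atTop.comp tendsto_natCast_atTop_atTop
  have ht3 : Tendsto (fun N : ℕ => (N:ℝ) ^ (1 / (k:ℝ))) atTop atTop :=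
    (tendsto_rpow_atTop (by positivity)).comp tendsto_natCast_atTop_atTop
  filter_upwards [ht1.eventually_ge_atTop 1, ht2.eventually_ge_atTop (4 * Ch / ε),
    ht3.eventually_ge_atTop 4, ht3.eventually_ge_atTop (16 * C / ε),
    eventually_ge_atTop 2] with N hN1 hN2 hN3 hN4 hN
  have hN0 : (0:ℝ) < N := by positivity
  set x : ℝ := (N:ℝ) ^ (1 / (k:ℝ)) with hx
  have hlogx : Real.log x = Real.log N / k := by
    rw [hx, Real.log_rpow hN0]; ring
  set y : ℕ := ⌊x⌋₊ with hy
  have hyx : (y:ℝ) ≤ x := Nat.floor_le (by linarith)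
  have hxy : x < y + 1 := Nat.lt_floor_add_one x
  have hy2 : 2 ≤ y := by
    have : (2:ℝ) < y := by linarith
    exact_mod_cast this.le
  have hyh : x / 2 ≤ y := by linarith
  have hy0 : (0:ℝ) < y := by linarith
  have hs : √x ≤ y := by
    rw [Real.sqrt_le_left hy0.le]
    nlinarith
  have hl1 : Real.log y ≤ Real.log N / k := hlogx ▸ Real.log_le_log hy0 hyx
  have hl2 : Real.log N / (2 * k) ≤ Real.log y := by
    have := Real.log_le_log (Real.sqrt_pos.mpr (by linarith)) hs
    rw [Real.log_sqrt (by linarith), hlogx] at this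
    calc _ = Real.log N / k / 2 := by field_simp
      _ ≤ _ := this
  have hL0 : 0 < Real.log (N:ℝ) := by linarith
  have hly0 : 0 < Real.log (y:ℝ) := lt_of_lt_of_le (by positivity) hl2
  refine (pmax_core h Ch hh _ C (by positivity) hC hHC N y hN hy2).trans ?_
  have b1 : 12 * (ε / (192 * k)) * N * (1 + Real.log N) / Real.log y ≤ ε / 4 * N := by
    rw [div_le_iff₀ hly0]
    have h1 : ε / 4 * N * (Real.log N / (2 * k)) ≤ ε / 4 * N * Real.log y :=
      mul_le_mul_of_nonneg_left hl2 (by positivity)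
    refine le_trans ?_ h1
    have e1 : 12 * (ε / (192 * k)) * N * (1 + Real.log N) =
        (ε * N / (16 * k)) * (1 + Real.log N) := by field_simp; ring
    have e2 : ε / 4 * N * (Real.log N / (2 * k)) = (ε * N / (16 * k)) * (2 * Real.log N) := by
      field_simp; ring
    rw [e1, e2]
    exact mul_le_mul_of_nonneg_left (by linarith) (by positivity)
  have b2 : 2 * C * N / y ≤ ε / 4 * N := by
    rw [div_le_iff₀ hy0]
    rw [div_le_iff₀ hε] at hN4
    have : 2 * C ≤ ε / 4 * y := by nlinarith
    nlinarith
  have b3 : Ch * √N ≤ ε / 4 * N := by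
    rw [div_le_iff₀ hε] at hN2
    have hss : √(N:ℝ) * √(N:ℝ) = N := Real.mul_self_sqrt hN0.le
    have hs0 : 0 ≤ √(N:ℝ) := Real.sqrt_nonneg _
    calc Ch * √N ≤ (√N * ε / 4) * √N := mul_le_mul_of_nonneg_right (by linarith) hs0
      _ = ε / 4 * (√N * √N) := by ring
      _ = _ := by rw [hss]
  have b4 : Ch * (8 * N * Real.log y / Real.log N) ≤ ε / 4 * N := by
    have h1 : 8 * N * Real.log y / Real.log N ≤ 8 * N / k := by
      rw [div_le_iff₀ hL0]
      calc 8 * N * Real.log y ≤ 8 * N * (Real.log N / k) :=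
            mul_le_mul_of_nonneg_left hl1 (by positivity)
        _ = _ := by ring
    refine (mul_le_mul_of_nonneg_left h1 hCh).trans ?_
    rw [div_lt_iff₀ hε] at hk
    rw [← mul_div_assoc, div_le_iff₀ hk0]
    nlinarith
  rw [mul_add Ch]
  linarith

theorem sum_moebius_div_tendsto :
    Tendsto (fun N : ℕ => ∑ n ∈ Finset.Icc 1 N, (moebius n : ℝ) / n) atTop (𝓝 0) := by
  refine axer (fun n => (moebius n : ℝ)) 1 moebius_abs_le ?_ ?_
  · exact IsSmall.of_bound fun ε hε => mertensM_littleO ε hε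
  · refine IsSmall.of_bound fun ε hε => ⟨1, fun N => ?_⟩
    have : 0 ≤ ε * N := by positivity
    rcases Nat.eq_zero_or_pos N with rfl | hN
    · simp
    · rw [moebius_floor_sum hN]
      simp; linarith

theorem sum_muMin_div_tendsto (h : ℕ → ℝ) (Ch : ℝ) (hh : ∀ n, |h n| ≤ Ch)
    (hH : ∀ η > 0, ∃ C, 0 ≤ C ∧ ∀ t : ℕ,
      |∑ p ∈ (Finset.Icc 1 t).filter Nat.Prime, h p| ≤ η * Nat.primeCounting t + C) :
    Tendsto (fun N : ℕ => ∑ n ∈ Finset.Icc 1 N, muMin h n / n) atTop (𝓝 0) := by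
  refine axer (muMin h) Ch (muMin_abs h Ch hh) (muMin_small h Ch hh) ?_
  have := (pmax_small h Ch hh hH).const_mul (-1)
  convert this using 2 with N
  rw [muMin_floor_sum]; ring

theorem density_small (S : Set ℕ) (hS : ∀ p ∈ S, Nat.Prime p) (δ : ℝ)
    (hdens : Tendsto
      (fun x : ℕ => (((Finset.range (x + 1)).filter (fun p => p ∈ S)).card : ℝ) /
        (Nat.primeCounting x : ℝ)) atTop (nhds δ)) (η : ℝ) (hη : 0 < η) :
    ∃ C, 0 ≤ C ∧ ∀ t : ℕ,
      |∑ p ∈ (Finset.Icc 1 t).filter Nat.Prime, ((if p ∈ S then (1:ℝ) else 0) - δ)| ≤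
        η * Nat.primeCounting t + C := by
  set H : ℕ → ℝ := fun t =>
    ∑ p ∈ (Finset.Icc 1 t).filter Nat.Prime, ((if p ∈ S then (1:ℝ) else 0) - δ) with hHdef
  have hHeq : ∀ t, H t = (((Finset.range (t + 1)).filter (fun p => p ∈ S)).card : ℝ) -
      δ * Nat.primeCounting t := by
    intro t
    rw [hHdef]
    dsimp only
    rw [Finset.sum_sub_distrib, Finset.sum_const, nsmul_eq_mul, mul_comm]
    congr 1
    · rw [Finset.sum_boole, Finset.filter_filter]
      congr 2
      ext p
      simp only [Finset.mem_filter, Finset.mem_Icc, Finset.mem_range]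
      constructor
      · rintro ⟨h1, h2, h3⟩; exact ⟨by omega, h3⟩
      · rintro ⟨h1, h2⟩
        have := (hS p h2).one_le
        exact ⟨by omega, hS p h2, h2⟩
    · rw [← Nat.primesLE_card_eq_primeCounting]
      congr 3
      ext p
      simp only [Finset.mem_filter, Finset.mem_Icc, Nat.mem_primesLE]
      constructor
      · rintro ⟨h1, h2⟩; exact ⟨h1.2, h2⟩
      · rintro ⟨h1, h2⟩; exact ⟨⟨h2.one_le, h1⟩, h2⟩
  have hev : ∀ᶠ t : ℕ in atTop, |H t| ≤ η * Nat.primeCounting t := by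
    have := (Metric.tendsto_nhds.mp hdens) η hη
    filter_upwards [this, eventually_ge_atTop 2] with t ht ht2
    have hpi : (0:ℝ) < Nat.primeCounting t := by
      have h2 : Nat.primeCounting 2 ≤ Nat.primeCounting t := Nat.monotone_primeCounting ht2
      have h1 : 0 < Nat.primeCounting 2 := by
        rw [← Nat.primesLE_card_eq_primeCounting, Finset.card_pos]
        exact ⟨2, Nat.mem_primesLE.mpr ⟨le_refl _, Nat.prime_two⟩⟩
      exact_mod_cast h1.trans_le h2
    rw [Real.dist_eq] at ht
    have e : H t = ((((Finset.range (t + 1)).filter (fun p => p ∈ S)).card : ℝ) /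
        (Nat.primeCounting t : ℝ) - δ) * Nat.primeCounting t := by
      rw [hHeq]; field_simp
    rw [e, abs_mul, abs_of_pos hpi]
    exact mul_le_mul_of_nonneg_right ht.le hpi.le
  obtain ⟨M, hM⟩ := eventually_atTop.mp hev
  have hnn : 0 ≤ ∑ n ∈ Finset.range M, |H n| := Finset.sum_nonneg fun _ _ => abs_nonneg _
  refine ⟨∑ n ∈ Finset.range M, |H n|, hnn, fun t => ?_⟩
  change |H t| ≤ _
  by_cases h : M ≤ t
  · linarith [hM t h]
  · have := Finset.single_le_sum (f := fun n => |H n|) (s := Finset.range M) (a := t)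
      (fun _ _ => abs_nonneg _) (by simpa using h)
    have h2 : 0 ≤ η * Nat.primeCounting t := by positivity
    linarith

end Final

/-- Alladi's formula in natural-density form over ℚ: if `S` is a set of primes with
natural density `δ`, then `−∑_{2 ≤ n ≤ x, p_min(n) ∈ S} μ(n)/n → δ` as `x → ∞`. -/
theorem alladi_density (S : Set ℕ) (hS : ∀ p ∈ S, Nat.Prime p) (δ : ℝ)
    (hdens : Tendsto
      (fun x : ℕ => (((Finset.range (x + 1)).filter (fun p => p ∈ S)).card : ℝ) /
        (Nat.primeCounting x : ℝ)) atTop (nhds δ)) :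
    Tendsto
      (fun x : ℕ =>
        -∑ n ∈ Finset.Icc 2 x,
          (if n.minFac ∈ S then (ArithmeticFunction.moebius n : ℝ) / n else 0))
      atTop (nhds δ) := by
  set h : ℕ → ℝ := fun p => (if p ∈ S then (1:ℝ) else 0) - δ with hh
  have hb : ∀ n, |h n| ≤ 1 + |δ| := by
    intro n
    refine (abs_sub _ _).trans (add_le_add ?_ le_rfl)
    split_ifs <;> norm_num
  have h1 := sum_muMin_div_tendsto h (1 + |δ|) hb
    (fun η hη => density_small S hS δ hdens η hη)
  have h2 := sum_moebius_div_tendsto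
  have h3 := (h1.add (h2.const_mul δ)).const_sub δ
  rw [mul_zero, add_zero, sub_zero] at h3
  refine h3.congr' ?_
  filter_upwards [eventually_ge_atTop 1] with N hN
  have hI : Finset.Icc 1 N = insert 1 (Finset.Icc 2 N) := by
    ext n; simp only [Finset.mem_insert, Finset.mem_Icc]; omega
  have hnot : 1 ∉ Finset.Icc 2 N := by simp
  rw [hI, Finset.sum_insert hnot, Finset.sum_insert hnot]
  have e : ∑ n ∈ Finset.Icc 2 N, muMin h n / n =
      ∑ n ∈ Finset.Icc 2 N,
        (if n.minFac ∈ S then (ArithmeticFunction.moebius n : ℝ) / n else 0) -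
      δ * ∑ n ∈ Finset.Icc 2 N, (ArithmeticFunction.moebius n : ℝ) / n := by
    rw [Finset.mul_sum, ← Finset.sum_sub_distrib]
    refine Finset.sum_congr rfl fun n hn => ?_
    rw [Finset.mem_Icc] at hn
    unfold muMin
    rw [if_pos hn.1, hh]
    dsimp only
    split_ifs <;> ring
  rw [e]
  simp only [muMin]
  norm_num
  ring
end

section
/- Let k be a positive integer and ℓ an integer with gcd(ℓ, k) = 1. Then −∑_{n ≥ 2, p_min(n) ≡ ℓ (mod k)} μ(n)/n = 1/φ(k), where the sum is interpreted as the limit of partial sums over n ≤ x as x → ∞. -/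
open scoped Classical
open Finset Filter

namespace AlladiAux

/-- triangle weight -/
noncomputable def triW (t : ℝ) : ℝ := max (1 - |t|) 0

/-- Fejer kernel -/
noncomputable def fej (u : ℝ) : ℝ := Real.sinc (u / 2) ^ 2

lemma triW_cont : Continuous triW := by
  unfold triW; fun_prop

lemma triW_nonneg (t : ℝ) : 0 ≤ triW t := le_max_right _ _

lemma triW_le_one (t : ℝ) : triW t ≤ 1 := by
  unfold triW
  exact max_le (by linarith [abs_nonneg t]) zero_le_one

lemma triW_zero {t : ℝ} (h : t ∉ Set.Icc (-1 : ℝ) 1) : triW t = 0 := by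
  unfold triW
  apply max_eq_right
  rw [Set.mem_Icc, ← abs_le] at h
  linarith [not_le.mp h]

lemma triW_integrable : MeasureTheory.Integrable triW := by
  apply triW_cont.integrable_of_hasCompactSupport
  exact HasCompactSupport.intro isCompact_Icc (fun x hx => triW_zero hx)

lemma fej_cont : Continuous fej := by
  unfold fej
  have := Real.continuous_sinc
  fun_prop

lemma fej_nonneg (u : ℝ) : 0 ≤ fej u := sq_nonneg _

lemma fej_le (u : ℝ) : fej u ≤ 5 * (1 + u ^ 2)⁻¹ := by
  have h1 : fej u ≤ 1 := by
    unfold fej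
    rw [sq_le_one_iff_abs_le_one]
    exact Real.abs_sinc_le_one _
  rw [← div_eq_mul_inv, le_div_iff₀ (by positivity)]
  have h2 : fej u * u ^ 2 ≤ 4 := by
    by_cases hu : u = 0
    · simp [hu]
    · unfold fej
      rw [Real.sinc_of_ne_zero (by simpa using hu)]
      have := Real.sin_sq_le_one (u / 2)
      field_simp
      nlinarith
  nlinarith

lemma fej_integrable : MeasureTheory.Integrable fej := by
  refine MeasureTheory.Integrable.mono' (integrable_inv_one_add_sq.const_mul 5)
    fej_cont.aestronglyMeasurable ?_
  filter_upwards with u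
  rw [Real.norm_of_nonneg (fej_nonneg u)]
  exact fej_le u

lemma fej_integral_pos : 0 < ∫ u, fej u := by
  apply MeasureTheory.integral_pos_of_integrable_nonneg_nonzero fej_cont fej_integrable
    (fun u => fej_nonneg u) (x := 0)
  simp [fej]

lemma fourier_triW (u : ℝ) :
    ∫ t, (triW t : ℂ) * Complex.exp (-(Complex.I * t * u)) = fej u := by
  have h0 : ∫ t, (triW t : ℂ) * Complex.exp (-(Complex.I * t * u)) =
      ∫ t in (-1:ℝ)..1, (triW t : ℂ) * Complex.exp (-(Complex.I * t * u)) := by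
    rw [intervalIntegral.integral_of_le (by norm_num), ← MeasureTheory.integral_Icc_eq_integral_Ioc]
    symm
    apply MeasureTheory.setIntegral_eq_integral_of_forall_compl_eq_zero
    intro x hx
    simp [triW_zero hx]
  have hcont : Continuous (fun t : ℝ => (triW t : ℂ) * Complex.exp (-(Complex.I * t * u))) := by
    have := triW_cont
    fun_prop
  rw [h0, ← intervalIntegral.integral_add_adjacent_intervals (b := 0)
    (hcont.intervalIntegrable _ _) (hcont.intervalIntegrable _ _)]
  have e1 : ∫ t in (-1:ℝ)..0, (triW t : ℂ) * Complex.exp (-(Complex.I * t * u)) =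
      ∫ t in (-1:ℝ)..0, (1 + t : ℂ) * Complex.exp (-(Complex.I * u) * t) := by
    apply intervalIntegral.integral_congr
    intro t ht
    rw [Set.uIcc_of_le (by norm_num)] at ht
    have : triW t = 1 + t := by
      unfold triW
      rw [abs_of_nonpos ht.2, max_eq_left] <;> linarith [ht.1, ht.2]
    simp only [this]
    push_cast
    ring_nf
  have e2 : ∫ t in (0:ℝ)..1, (triW t : ℂ) * Complex.exp (-(Complex.I * t * u)) =
      ∫ t in (0:ℝ)..1, (1 - t : ℂ) * Complex.exp (-(Complex.I * u) * t) := by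
    apply intervalIntegral.integral_congr
    intro t ht
    rw [Set.uIcc_of_le (by norm_num)] at ht
    have : triW t = 1 - t := by
      unfold triW
      rw [abs_of_nonneg ht.1, max_eq_left] ; linarith [ht.1, ht.2]
    simp only [this]
    push_cast
    ring_nf
  rw [e1, e2]
  by_cases hu : u = 0
  · subst hu
    have e3 : ∫ t in (-1:ℝ)..0, (1 + t : ℂ) * Complex.exp (-(Complex.I * (0:ℝ)) * t) =
        ((∫ t in (-1:ℝ)..0, (1 + t : ℝ) : ℝ) : ℂ) := by
      rw [← intervalIntegral.integral_ofReal]; simp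
    have e4 : ∫ t in (0:ℝ)..1, (1 - t : ℂ) * Complex.exp (-(Complex.I * (0:ℝ)) * t) =
        ((∫ t in (0:ℝ)..1, (1 - t : ℝ) : ℝ) : ℂ) := by
      rw [← intervalIntegral.integral_ofReal]; simp
    rw [e3, e4]
    rw [intervalIntegral.integral_add (by simp) (by simp),
      intervalIntegral.integral_sub (by simp) (by simp)]
    simp [fej]
    norm_num
  · set c : ℂ := -(Complex.I * u) with hc
    have hc0 : c ≠ 0 := by simp [hc, hu]
    have d0 (t : ℝ) : HasDerivAt (fun t : ℝ => Complex.exp (c * t)) (Complex.exp (c * t) * c) t := by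
      have := ((Complex.ofRealCLM.hasDerivAt (x := t)).const_mul c).cexp
      simpa using this
    have dt (t : ℝ) : HasDerivAt (fun t : ℝ => (t : ℂ)) 1 t := by
      exact (hasDerivAt_id t).ofReal_comp
    have i1 : ∫ t in (-1:ℝ)..0, (1 + t : ℂ) * Complex.exp (c * t) =
        ((1 + (0:ℝ)) * Complex.exp (c * (0:ℝ)) / c - Complex.exp (c * (0:ℝ)) / c ^ 2) -
        ((1 + (-1:ℝ)) * Complex.exp (c * (-1:ℝ)) / c - Complex.exp (c * (-1:ℝ)) / c ^ 2) := by
      refine intervalIntegral.integral_eq_sub_of_hasDerivAt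
        (f := fun t : ℝ => (1 + t) * Complex.exp (c * t) / c - Complex.exp (c * t) / c ^ 2)
        (fun t _ => ?_) ?_
      · have := ((((dt t).const_add 1).mul (d0 t)).div_const c).sub ((d0 t).div_const (c ^ 2))
        refine this.congr_deriv ?_
        field_simp
        ring
      · apply Continuous.intervalIntegrable; fun_prop
    have i2 : ∫ t in (0:ℝ)..1, (1 - t : ℂ) * Complex.exp (c * t) =
        ((1 - (1:ℝ)) * Complex.exp (c * (1:ℝ)) / c + Complex.exp (c * (1:ℝ)) / c ^ 2) -
        ((1 - (0:ℝ)) * Complex.exp (c * (0:ℝ)) / c + Complex.exp (c * (0:ℝ)) / c ^ 2) := by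
      refine intervalIntegral.integral_eq_sub_of_hasDerivAt
        (f := fun t : ℝ => (1 - t) * Complex.exp (c * t) / c + Complex.exp (c * t) / c ^ 2)
        (fun t _ => ?_) ?_
      · have := ((((dt t).const_sub 1).mul (d0 t)).div_const c).add ((d0 t).div_const (c ^ 2))
        refine this.congr_deriv ?_
        field_simp
        ring
      · apply Continuous.intervalIntegrable; fun_prop
    rw [i1, i2]
    have hf : fej u = 2 * (1 - Real.cos u) / u ^ 2 := by
      unfold fej
      rw [Real.sinc_of_ne_zero (by simpa using hu)]
      have : Real.cos u = 1 - 2 * Real.sin (u / 2) ^ 2 := by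
        have h := Real.cos_two_mul (u / 2)
        have h' := Real.sin_sq_add_cos_sq (u / 2)
        rw [show 2 * (u / 2) = u by ring] at h
        rw [h]; linarith
      rw [this]
      field_simp
      ring
    have hcos : Complex.exp c + Complex.exp (-c) = 2 * Complex.cos u := by
      rw [Complex.cos, hc]
      ring_nf
    have hc2 : c ^ 2 = -(u : ℂ) ^ 2 := by
      rw [hc, neg_sq, mul_pow, Complex.I_sq]; ring
    have : (u : ℂ) ≠ 0 := by exact_mod_cast hu
    rw [hf]
    push_cast
    have key : (1 + (0:ℂ)) * Complex.exp (c * 0) / c - Complex.exp (c * 0) / c ^ 2 -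
          ((1 + -1) * Complex.exp (c * -1) / c - Complex.exp (c * -1) / c ^ 2) +
        ((1 - 1) * Complex.exp (c * 1) / c + Complex.exp (c * 1) / c ^ 2 -
          ((1 - 0) * Complex.exp (c * 0) / c + Complex.exp (c * 0) / c ^ 2)) =
        ((Complex.exp c + Complex.exp (-c)) - 2) / c ^ 2 := by
      simp
      ring
    rw [key, hcos, hc2]
    field_simp
    ring

end AlladiAux

namespace AlladiAux

open MeasureTheory in
lemma lap_id (B : ℝ → ℝ) (C : ℝ) (hB : Measurable B) (hC : ∀ u, |B u| ≤ C) (H : ℂ → ℂ)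
    (hL : ∀ s : ℂ, 0 < s.re → ∫ u in Set.Ioi (0:ℝ), (B u : ℂ) * Complex.exp (-s * u) = H s)
    (lam y ε : ℝ) (hε : 0 < ε) :
    ∫ u in Set.Ioi (0:ℝ), (B u : ℂ) * Complex.exp (-ε * u) * (fej (lam * (u - y)) : ℂ) =
    ∫ t, (triW t : ℂ) * Complex.exp (Complex.I * t * (lam * y)) * H (ε + Complex.I * (lam * t)) := by
  have h1 : ∀ u : ℝ, (B u : ℂ) * Complex.exp (-ε * u) * (fej (lam * (u - y)) : ℂ) =
      ∫ t : ℝ, ((B u : ℂ) * Complex.exp (-ε * u)) *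
        ((triW t : ℂ) * Complex.exp (-(Complex.I * t * ((lam * (u - y) : ℝ) : ℂ)))) := by
    intro u
    rw [integral_const_mul, fourier_triW]
  simp_rw [h1]
  rw [integral_integral_swap]
  · congr 1
    ext t
    rw [← hL _ (by simpa using hε), ← integral_const_mul]
    congr 1
    ext u
    have : Complex.exp (-ε * u) * Complex.exp (-(Complex.I * t * ((lam * (u - y) : ℝ) : ℂ))) =
      Complex.exp (Complex.I * t * (lam * y)) *
        Complex.exp (-(ε + Complex.I * (lam * t)) * u) := by
      rw [← Complex.exp_add, ← Complex.exp_add]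
      congr 1
      push_cast
      ring
    linear_combination (B u : ℂ) * triW t * this
  · have hBint : Integrable (fun u : ℝ => (B u : ℂ) * Complex.exp (-ε * u))
        (volume.restrict (Set.Ioi (0:ℝ))) := by
      have he : IntegrableOn (fun u : ℝ => Real.exp (-ε * u)) (Set.Ioi 0) :=
        integrableOn_exp_mul_Ioi (by linarith) 0
      have he' : Integrable (fun u : ℝ => Complex.exp (-ε * u))
        (volume.restrict (Set.Ioi (0:ℝ))) := by
        have := he.ofReal (𝕜 := ℂ)
        simpa using this
      exact he'.bdd_mul (c := C) (by fun_prop) (by filter_upwards with u; simpa using hC u)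
    have hp := hBint.mul_prod (triW_integrable.ofReal (𝕜 := ℂ))
    have hm : AEStronglyMeasurable (fun z : ℝ × ℝ =>
        Complex.exp (-(Complex.I * z.2 * ((lam * (z.1 - y) : ℝ) : ℂ))))
        ((volume.restrict (Set.Ioi (0:ℝ))).prod volume) := by
      apply Continuous.aestronglyMeasurable
      fun_prop
    have := hp.mul_bdd (c := 1) hm (by
      filter_upwards with z
      rw [Complex.norm_exp]
      simp)
    refine this.congr ?_
    filter_upwards with z
    simp only [Function.uncurry, RCLike.ofReal_eq_complex_ofReal]
    ring

open MeasureTheory in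
lemma fej_conv_tendsto (B : ℝ → ℝ) (C : ℝ) (hB : Measurable B) (hC : ∀ u, |B u| ≤ C) (H : ℂ → ℂ)
    (hH : ContinuousOn H {s | 0 ≤ s.re})
    (hL : ∀ s : ℂ, 0 < s.re → ∫ u in Set.Ioi (0:ℝ), (B u : ℂ) * Complex.exp (-s * u) = H s)
    (lam : ℝ) (hlam : 0 < lam) :
    Tendsto (fun y : ℝ => ∫ u in Set.Ioi (0:ℝ), B u * fej (lam * (u - y))) atTop (nhds 0) := by
  have hC0 : 0 ≤ C := (abs_nonneg _).trans (hC 0)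
  have hcont : ∀ ε : ℝ, 0 ≤ ε → Continuous (fun t : ℝ => H (ε + Complex.I * (lam * t))) := by
    intro ε hε
    refine hH.comp_continuous (by fun_prop) ?_
    intro t
    simpa using hε
  have hfi (y : ℝ) : Integrable (fun u => fej (lam * (u - y))) :=
    (fej_integrable.comp_mul_left' hlam.ne').comp_sub_right y
  -- epsilon to zero
  have key : ∀ y : ℝ, ∫ u in Set.Ioi (0:ℝ), (B u : ℂ) * (fej (lam * (u - y)) : ℂ) =
      ∫ t, (triW t : ℂ) * Complex.exp (Complex.I * t * (lam * y)) * H (Complex.I * (lam * t)) := by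
    intro y
    have l1 : Tendsto (fun n : ℕ => ∫ u in Set.Ioi (0:ℝ), (B u : ℂ) *
        Complex.exp (-((1 / ((n:ℝ) + 1) : ℝ)) * u) * (fej (lam * (u - y)) : ℂ)) atTop
        (nhds (∫ u in Set.Ioi (0:ℝ), (B u : ℂ) * (fej (lam * (u - y)) : ℂ))) := by
      apply tendsto_integral_filter_of_dominated_convergence
        (bound := fun u => C * fej (lam * (u - y)))
      · filter_upwards with n
        have := fej_cont
        apply AEStronglyMeasurable.mul
        · exact (by fun_prop : Measurable _).aestronglyMeasurable
        · exact (by fun_prop : Continuous _).aestronglyMeasurable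
      · filter_upwards with n
        filter_upwards [ae_restrict_mem measurableSet_Ioi] with u hu
        rw [norm_mul, norm_mul]
        have h2 : ‖Complex.exp (-((1 / ((n:ℝ) + 1) : ℝ)) * u)‖ ≤ 1 := by
          rw [← Complex.ofReal_neg, ← Complex.ofReal_mul, ← Complex.ofReal_exp,
            Complex.norm_of_nonneg (Real.exp_pos _).le]
          rw [Real.exp_le_one_iff]
          have : 0 < 1 / ((n:ℝ) + 1) := by positivity
          have hu' : 0 < u := hu
          nlinarith [mul_pos this hu']
        rw [Complex.norm_of_nonneg (fej_nonneg _)]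
        apply mul_le_mul_of_nonneg_right _ (fej_nonneg _)
        have h3 : ‖(B u : ℂ)‖ ≤ C := by simpa using hC u
        calc _ ≤ C * 1 := mul_le_mul h3 h2 (norm_nonneg _) hC0
          _ = C := mul_one C
      · exact ((hfi y).const_mul C).integrableOn
      · filter_upwards with u
        have : Tendsto (fun n : ℕ => (B u : ℂ) *
          Complex.exp (-((1 / ((n:ℝ) + 1) : ℝ)) * u) * (fej (lam * (u - y)) : ℂ)) atTop
          (nhds ((B u : ℂ) * Complex.exp (-((0:ℝ) : ℂ) * u) * (fej (lam * (u - y)) : ℂ))) := by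
          refine ((Tendsto.cexp ?_).const_mul _).mul_const _
          refine Tendsto.mul_const _ (Tendsto.neg ?_)
          exact (Complex.continuous_ofReal.tendsto _).comp tendsto_one_div_add_atTop_nhds_zero_nat
        simpa using this
    have hK : ∃ K, ∀ ε ∈ Set.Icc (0:ℝ) 1, ∀ t ∈ Set.Icc (-1:ℝ) 1,
        ‖H (ε + Complex.I * (lam * t))‖ ≤ K := by
      have hc : ContinuousOn (fun z : ℝ × ℝ => H (z.1 + Complex.I * (lam * z.2)))
          (Set.Icc (0:ℝ) 1 ×ˢ Set.Icc (-1:ℝ) 1) := by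
        refine hH.comp (by fun_prop) ?_
        intro z hz
        simpa using hz.1.1
      obtain ⟨K, hK⟩ := (isCompact_Icc.prod isCompact_Icc).exists_bound_of_continuousOn hc
      exact ⟨K, fun ε hε t ht => hK (ε, t) ⟨hε, ht⟩⟩
    obtain ⟨K, hK⟩ := hK
    have l2 : Tendsto (fun n : ℕ => ∫ t, (triW t : ℂ) * Complex.exp (Complex.I * t * (lam * y)) *
        H ((1 / ((n:ℝ) + 1) : ℝ) + Complex.I * (lam * t))) atTop
        (nhds (∫ t, (triW t : ℂ) * Complex.exp (Complex.I * t * (lam * y)) *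
          H (Complex.I * (lam * t)))) := by
      apply tendsto_integral_filter_of_dominated_convergence
        (bound := fun t => triW t * K)
      · filter_upwards with n
        have := hcont (1 / ((n:ℝ) + 1)) (by positivity)
        have h5 := triW_cont
        exact (Continuous.mul (by fun_prop) this).aestronglyMeasurable
      · filter_upwards with n
        filter_upwards with t
        by_cases ht : t ∈ Set.Icc (-1:ℝ) 1
        · rw [norm_mul, norm_mul, Complex.norm_of_nonneg (triW_nonneg _)]
          have : ‖Complex.exp (Complex.I * t * (lam * y))‖ = 1 := by
            rw [Complex.norm_exp]; simp
          rw [this, mul_one]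
          apply mul_le_mul_of_nonneg_left _ (triW_nonneg _)
          refine hK _ ⟨by positivity, ?_⟩ t ht
          rw [div_le_one (by positivity)]
          have : (0:ℝ) ≤ n := by positivity
          linarith
        · simp [triW_zero ht]
      · exact triW_integrable.mul_const K
      · filter_upwards with t
        refine Tendsto.const_mul _ ?_
        have hz : Complex.I * (lam * t) = ((0:ℝ):ℂ) + Complex.I * (lam * t) := by simp
        have hw : ContinuousWithinAt H {s | 0 ≤ s.re} (Complex.I * (lam * t)) :=
          hH _ (by simp)
        refine hw.tendsto.comp (tendsto_nhdsWithin_iff.mpr ⟨?_, ?_⟩)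
        · nth_rw 2 [hz]
          refine Tendsto.add_const _ ?_
          exact (Complex.continuous_ofReal.tendsto _).comp tendsto_one_div_add_atTop_nhds_zero_nat
        · filter_upwards with n
          have h6 : (0:ℝ) ≤ 1 / ((n:ℝ) + 1) := by positivity
          rw [Complex.add_re, Complex.ofReal_re]
          simpa using h6
    refine tendsto_nhds_unique l1 (l2.congr ?_)
    intro n
    rw [← lap_id B C hB hC H hL lam y _ (by positivity)]
  -- Riemann Lebesgue
  have rl := Real.tendsto_integral_exp_smul_cocompact
    (fun t : ℝ => (triW t : ℂ) * H (Complex.I * (lam * t)))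
  have hy : Tendsto (fun y : ℝ => -(lam * y) / (2 * Real.pi)) atTop (cocompact ℝ) := by
    refine Tendsto.mono_right ?_ atBot_le_cocompact
    apply Tendsto.atBot_div_const (by positivity)
    apply tendsto_neg_atTop_atBot.comp
    exact tendsto_id.const_mul_atTop hlam
  have l3 := rl.comp hy
  have l4 : Tendsto (fun y : ℝ => ((∫ u in Set.Ioi (0:ℝ), B u * fej (lam * (u - y)) : ℝ) : ℂ))
      atTop (nhds 0) := by
    refine l3.congr ?_
    intro y
    rw [← integral_complex_ofReal]
    push_cast
    rw [key y]
    simp only [Function.comp]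
    congr 1
    ext t
    rw [Circle.smul_def, Real.fourierChar_apply]
    have : ((2 * Real.pi * -(t * (-(lam * y) / (2 * Real.pi))) : ℝ) : ℂ) * Complex.I =
        Complex.I * t * (lam * y) := by
      have : 2 * Real.pi * -(t * (-(lam * y) / (2 * Real.pi))) = t * (lam * y) := by
        have := Real.pi_pos
        field_simp
      rw [this]; push_cast; ring
    rw [this, smul_eq_mul]
    ring
  have := (Complex.continuous_re.tendsto _).comp l4
  simpa [Function.comp_def] using this

end AlladiAux

namespace AlladiAux

open MeasureTheory in
lemma fej_lower (B : ℝ → ℝ) (C : ℝ) (hB : Measurable B) (hC : ∀ u, |B u| ≤ C)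
    (b c h lam : ℝ) (hlam : 0 < lam) (hc : 0 < c - h)
    (hb : ∀ u ∈ Set.Icc (c - h) (c + h), b ≤ B u) :
    b * (∫ v, fej v) - (C + |b|) * (∫ v in (Set.Icc (-(lam * h)) (lam * h))ᶜ, fej v) ≤
      lam * ∫ u in Set.Ioi (0:ℝ), B u * fej (lam * (u - c)) := by
  have hC0 : 0 ≤ C := (abs_nonneg _).trans (hC 0)
  set S := (Set.Icc (-(lam * h)) (lam * h))ᶜ with hS
  have hSm : MeasurableSet S := measurableSet_Icc.compl
  set G : ℝ → ℝ := fun v => b * fej v - (C + |b|) * S.indicator fej v with hG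
  have hGi : Integrable G :=
    (fej_integrable.const_mul b).sub ((fej_integrable.indicator hSm).const_mul _)
  have hGint : ∫ v, G v = b * (∫ v, fej v) - (C + |b|) * (∫ v in S, fej v) := by
    rw [hG, integral_sub (fej_integrable.const_mul b)
      ((fej_integrable.indicator hSm).const_mul _), integral_const_mul, integral_const_mul,
      integral_indicator hSm]
  have hsub : ∀ g : ℝ → ℝ, lam * ∫ u, g (lam * (u - c)) = ∫ v, g v := by
    intro g
    rw [integral_sub_right_eq_self (fun u => g (lam * u)) c, Measure.integral_comp_mul_left,
      abs_of_pos (by positivity), smul_eq_mul]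
    field_simp
  rw [← hGint, ← hsub G]
  apply mul_le_mul_of_nonneg_left _ hlam.le
  rw [← integral_indicator measurableSet_Ioi]
  have hfi : Integrable (fun u => fej (lam * (u - c))) :=
    (fej_integrable.comp_mul_left' hlam.ne').comp_sub_right c
  apply integral_mono
  · exact (hGi.comp_mul_left' hlam.ne').comp_sub_right c
  · apply Integrable.indicator _ measurableSet_Ioi
    exact hfi.bdd_mul (c := C) hB.aestronglyMeasurable (by filter_upwards with u; simpa using hC u)
  · intro u
    simp only [hG]
    have hf := fej_nonneg (lam * (u - c))
    have hb1 := abs_nonneg b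
    have hb2 := le_abs_self b
    by_cases hu : u ∈ Set.Icc (c - h) (c + h)
    · have hu0 : u ∈ Set.Ioi (0:ℝ) := lt_of_lt_of_le hc hu.1
      rw [Set.indicator_of_mem hu0]
      have hn : lam * (u - c) ∉ S := by
        simp only [hS, Set.notMem_compl_iff, Set.mem_Icc]
        constructor <;> nlinarith [hu.1, hu.2]
      rw [Set.indicator_of_notMem hn]
      nlinarith [mul_le_mul_of_nonneg_right (hb u hu) hf]
    · have hn : lam * (u - c) ∈ S := by
        simp only [hS, Set.mem_compl_iff, Set.mem_Icc]
        intro hh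
        apply hu
        constructor
        · have : lam * (-h) ≤ lam * (u - c) := by linarith [hh.1]
          linarith [le_of_mul_le_mul_left this hlam]
        · linarith [le_of_mul_le_mul_left hh.2 hlam]
      rw [Set.indicator_of_mem hn]
      by_cases hu0 : u ∈ Set.Ioi (0:ℝ)
      · rw [Set.indicator_of_mem hu0]
        have := (abs_le.mp (hC u)).1
        nlinarith [mul_le_mul_of_nonneg_right this hf, mul_le_mul_of_nonneg_right hb2 hf]
      · rw [Set.indicator_of_notMem hu0]
        nlinarith [mul_le_mul_of_nonneg_right hb2 hf, mul_nonneg hC0 hf]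

open MeasureTheory in
lemma fej_tail (η : ℝ) (hη : 0 < η) (h : ℝ) (hh : 0 < h) :
    ∃ lam > 0, ∫ v in (Set.Icc (-(lam * h)) (lam * h))ᶜ, fej v ≤ η := by
  have hm : ∀ n : ℕ, MeasurableSet (Set.Icc (-(n * h) : ℝ) (n * h))ᶜ :=
    fun n => measurableSet_Icc.compl
  have : Tendsto (fun n : ℕ => ∫ v in (Set.Icc (-(n * h) : ℝ) (n * h))ᶜ, fej v) atTop (nhds 0) := by
    have h0 : (0:ℝ) = ∫ v : ℝ, (0:ℝ) := by simp
    rw [h0]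
    simp_rw [fun n : ℕ => (integral_indicator (f := fej) (μ := volume) (hm n)).symm]
    apply tendsto_integral_filter_of_dominated_convergence (bound := fej)
    · filter_upwards with n
      exact (fej_integrable.indicator (hm n)).aestronglyMeasurable
    · filter_upwards with n
      filter_upwards with v
      refine (norm_indicator_le_norm_self _ _).trans ?_
      rw [Real.norm_of_nonneg (fej_nonneg v)]
    · exact fej_integrable
    · filter_upwards with v
      apply tendsto_const_nhds.congr'
      obtain ⟨N, hN⟩ := exists_nat_gt (|v| / h)
      filter_upwards [eventually_ge_atTop N] with n hn
      rw [Set.indicator_of_notMem]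
      rw [Set.notMem_compl_iff, Set.mem_Icc, ← abs_le]
      rw [div_lt_iff₀ hh] at hN
      have : (N : ℝ) ≤ n := by exact_mod_cast hn
      nlinarith
  have h2 := (this.eventually (gt_mem_nhds hη)).and (eventually_gt_atTop 0)
  obtain ⟨n, hn, hn0⟩ := h2.exists
  exact ⟨n, by exact_mod_cast hn0, hn.le⟩

theorem laplace_tauber (B : ℝ → ℝ) (C : ℝ) (hB : Measurable B) (hC : ∀ u, |B u| ≤ C) (H : ℂ → ℂ)
    (hH : ContinuousOn H {s | 0 ≤ s.re})
    (hL : ∀ s : ℂ, 0 < s.re →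
      ∫ u in Set.Ioi (0:ℝ), (B u : ℂ) * Complex.exp (-s * u) = H s)
    (hslow : ∀ y u, 0 ≤ y → y ≤ u → B y - (C + 1) * (u - y) - Real.exp (-y) ≤ B u) :
    Tendsto B atTop (nhds 0) := by
  have hC0 : 0 ≤ C := (abs_nonneg _).trans (hC 0)
  have hJ := fej_integral_pos
  set J := ∫ u, fej u with hJd
  rw [Metric.tendsto_atTop]
  intro δ hδ
  -- choose eta
  obtain ⟨η, hη, hη1, hηδ⟩ : ∃ η : ℝ, 0 < η ∧ η ≤ 1 ∧ (5 * C + 5) * η ≤ δ / 4 := by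
    refine ⟨min 1 (δ / 4 / (5 * C + 5)), by positivity, min_le_left _ _, ?_⟩
    calc (5 * C + 5) * min 1 (δ / 4 / (5 * C + 5)) ≤ (5 * C + 5) * (δ / 4 / (5 * C + 5)) := by
          gcongr; exact min_le_right _ _
      _ = δ / 4 := by field_simp
  obtain ⟨lam, hlam, htail⟩ := fej_tail (η * J) (by positivity) (η / 2) (by positivity)
  set τ := ∫ v in (Set.Icc (-(lam * (η / 2))) (lam * (η / 2)))ᶜ, fej v with hτ
  have hτ0 : 0 ≤ τ := MeasureTheory.integral_nonneg (fun v => fej_nonneg v)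
  have hconv := fej_conv_tendsto B C hB hC H hH hL lam hlam
  rw [Metric.tendsto_atTop] at hconv
  obtain ⟨Y, hY⟩ := hconv (δ / 4 * J / lam) (by positivity)
  have hexp : Tendsto (fun y : ℝ => Real.exp (-y)) atTop (nhds 0) :=
    Real.tendsto_exp_neg_atTop_nhds_zero
  rw [Metric.tendsto_atTop] at hexp
  obtain ⟨Y2, hY2⟩ := hexp (min 1 (δ / 4)) (by positivity)
  have hexp' : ∀ y, Y2 ≤ y → Real.exp (-y) < 1 ∧ Real.exp (-y) < δ / 4 := by
    intro y hy
    have := hY2 y hy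
    rw [Real.dist_eq, sub_zero, abs_of_pos (Real.exp_pos _)] at this
    exact ⟨this.trans_le (min_le_left _ _), this.trans_le (min_le_right _ _)⟩
  have hI : ∀ c, Y ≤ c → |lam * ∫ u in Set.Ioi (0:ℝ), B u * fej (lam * (u - c))| < δ / 4 * J := by
    intro c hc
    have := hY c hc
    rw [Real.dist_eq, sub_zero, lt_div_iff₀ hlam] at this
    rw [abs_mul, abs_of_pos hlam, mul_comm]
    exact this
  refine ⟨max (max Y Y2) 0 + 2, fun y hy => ?_⟩
  have hy1 : Y + 2 ≤ y := by linarith [le_max_left (max Y Y2) 0, le_max_left Y Y2]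
  have hy2 : Y2 + 2 ≤ y := by linarith [le_max_left (max Y Y2) 0, le_max_right Y Y2]
  have hy3 : 2 ≤ y := by linarith [le_max_right (max Y Y2) 0]
  have hBy := abs_le.mp (hC y)
  rw [Real.dist_eq, sub_zero, abs_lt]
  constructor
  · -- lower bound, apply fej_lower to -B
    obtain ⟨hq1, hq2⟩ := hexp' (y - η) (by linarith)
    set q := Real.exp (-(y - η)) with hq
    have hq0 : 0 < q := Real.exp_pos _
    set b := -B y - (C + 1) * η - q with hb
    have hbabs : |b| ≤ 2 * C + 2 := by
      rw [abs_le]; constructor <;> nlinarith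
    have key := fej_lower (fun u => -B u) C hB.neg (fun u => by simpa using hC u) b
      (y - η / 2) (η / 2) lam hlam (by linarith) (by
        intro u hu
        have h1 := hslow u y (by linarith [hu.1]) (by linarith [hu.2])
        have h2 : Real.exp (-u) ≤ q := by
          rw [hq]; apply Real.exp_le_exp.mpr; linarith [hu.1]
        have h3 : (C + 1) * (y - u) ≤ (C + 1) * η := by
          apply mul_le_mul_of_nonneg_left _ (by linarith); linarith [hu.1]
        simp only [hb]
        linarith)
    simp only [neg_mul, MeasureTheory.integral_neg] at key
    have h4 := (abs_lt.mp (hI (y - η / 2) (by linarith))).1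
    rw [← hJd, ← hτ] at key
    have h5 : (C + |b|) * τ ≤ (3 * C + 2) * (η * J) :=
      mul_le_mul (by linarith) htail hτ0 (by linarith)
    have h6 : b * J < (δ / 4 + (3 * C + 2) * η) * J := by nlinarith
    have h7 := lt_of_mul_lt_mul_right h6 hJ.le
    simp only [hb] at h7
    nlinarith
  · obtain ⟨hq1, hq2⟩ := hexp' y (by linarith)
    set q := Real.exp (-y) with hq
    have hq0 : 0 < q := Real.exp_pos _
    set b := B y - (C + 1) * η - q with hb
    have hbabs : |b| ≤ 2 * C + 2 := by
      rw [abs_le]; constructor <;> nlinarith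
    have key := fej_lower B C hB hC b
      (y + η / 2) (η / 2) lam hlam (by linarith) (by
        intro u hu
        have h1 := hslow y u (by linarith [hu.1]) (by linarith [hu.1])
        have h3 : (C + 1) * (u - y) ≤ (C + 1) * η := by
          apply mul_le_mul_of_nonneg_left _ (by linarith); linarith [hu.2]
        simp only [hb]
        linarith)
    have h4 := (abs_lt.mp (hI (y + η / 2) (by linarith))).2
    rw [← hJd, ← hτ] at key
    have h5 : (C + |b|) * τ ≤ (3 * C + 2) * (η * J) :=
      mul_le_mul (by linarith) htail hτ0 (by linarith)
    have h6 : b * J < (δ / 4 + (3 * C + 2) * η) * J := by nlinarith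
    have h7 := lt_of_mul_lt_mul_right h6 hJ.le
    simp only [hb] at h7
    nlinarith

end AlladiAux

namespace AlladiAux

theorem wiener_ikehara (b : ℕ → ℝ) (C : ℝ) (hC : ∀ n : ℕ, ∑ k ∈ Icc 1 n, |b k| ≤ C * n)
    (hb : ∀ n, -1 ≤ b n) (G : ℂ → ℂ) (hG : ContinuousOn G {s | 1 ≤ s.re})
    (hGL : ∀ s : ℂ, 1 < s.re → LSeries (fun n => (b n : ℂ)) s = G s) :
    Tendsto (fun n : ℕ => (∑ k ∈ Icc 1 n, b k) / n) atTop (nhds 0) := by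
  set S : ℕ → ℝ := fun n => ∑ k ∈ Icc 1 n, b k with hS
  have hC0 : 0 ≤ C := by
    have := (abs_nonneg (b 1)).trans (by simpa using hC 1)
    exact this
  have hSC : ∀ n : ℕ, |S n| ≤ C * n := fun n => (abs_sum_le_sum_abs _ _).trans (hC n)
  set B : ℝ → ℝ := fun u => Real.exp (-u) * S ⌊Real.exp u⌋₊ with hB
  have hBm : Measurable B := by
    apply Measurable.mul (by fun_prop)
    exact (measurable_from_top (f := S)).comp (Nat.measurable_floor.comp Real.measurable_exp)
  have hBC : ∀ u, |B u| ≤ C := by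
    intro u
    rw [hB]
    simp only [abs_mul, abs_of_pos (Real.exp_pos _)]
    have h1 := hSC ⌊Real.exp u⌋₊
    have h2 := Nat.floor_le (Real.exp_pos u).le
    have h3 : |S ⌊Real.exp u⌋₊| ≤ C * Real.exp u := h1.trans (by gcongr)
    calc Real.exp (-u) * |S ⌊Real.exp u⌋₊| ≤ Real.exp (-u) * (C * Real.exp u) := by gcongr
      _ = C * (Real.exp (-u) * Real.exp u) := by ring
      _ = C := by rw [← Real.exp_add]; simp
  have hO : (fun n ↦ ∑ k ∈ Icc 1 n, ‖(b k : ℂ)‖) =O[atTop] fun n : ℕ ↦ (n : ℝ) ^ (1:ℝ) := by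
    refine Asymptotics.IsBigO.of_bound C ?_
    filter_upwards with n
    rw [Real.rpow_one, Real.norm_of_nonneg (Finset.sum_nonneg (fun _ _ => norm_nonneg _)),
      Real.norm_of_nonneg (Nat.cast_nonneg n)]
    simpa using hC n
  have hlim := laplace_tauber B C hBm hBC (fun s => G (1 + s) / (1 + s)) ?_ ?_ ?_
  · have h1 : Tendsto (fun n : ℕ => Real.log n) atTop atTop :=
      Real.tendsto_log_atTop.comp tendsto_natCast_atTop_atTop
    refine (hlim.comp h1).congr' ?_
    filter_upwards [eventually_gt_atTop 0] with n hn
    have : (0:ℝ) < n := by exact_mod_cast hn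
    simp only [Function.comp, hB, Real.exp_neg, Real.exp_log this, Nat.floor_natCast]
    rw [div_eq_inv_mul]
  · apply ContinuousOn.div
    · refine hG.comp (by fun_prop) ?_
      intro s hs
      have hs' : 0 ≤ s.re := hs
      show 1 ≤ (1 + s).re
      simpa using hs'
    · fun_prop
    · intro s hs h0
      have hs' : 0 ≤ s.re := hs
      have := congrArg Complex.re h0
      simp at this
      linarith
  · intro s hs
    have hs1 : 1 < (1 + s).re := by simpa using hs
    have h0 : (1 + s) ≠ 0 := by
      intro h
      rw [h] at hs1; simp at hs1; linarith
    rw [← hGL _ hs1, LSeries_eq_mul_integral' _ zero_le_one hs1 hO, mul_div_cancel_left₀ _ h0]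
    have h2 := MeasureTheory.integral_comp_exp_Ioi
      (fun t : ℝ => (∑ k ∈ Icc 1 ⌊t⌋₊, (b k : ℂ)) * (t : ℂ) ^ (-(1 + s + 1))) 0
    rw [Real.exp_zero] at h2
    rw [← h2]
    congr 1
    ext u
    have h3 : ((Real.exp u : ℝ) : ℂ) ^ (-(1 + s + 1)) = Complex.exp (u * (-(1 + s + 1))) := by
      rw [Complex.cpow_def_of_ne_zero (by exact_mod_cast (Real.exp_pos u).ne'),
        ← Complex.ofReal_log (Real.exp_pos u).le, Real.log_exp]
    rw [h3]
    simp only [hB, hS, Complex.real_smul]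
    push_cast
    have h4 : Complex.exp (-u) * Complex.exp (-s * u) =
        Complex.exp u * Complex.exp (u * (-(1 + s + 1))) := by
      rw [← Complex.exp_add, ← Complex.exp_add]; ring_nf
    linear_combination (∑ k ∈ Icc 1 ⌊Real.exp u⌋₊, (b k : ℂ)) * h4
  · intro y u hy hyu
    have hle : ⌊Real.exp y⌋₊ ≤ ⌊Real.exp u⌋₊ := Nat.floor_mono (Real.exp_le_exp.mpr hyu)
    have hdiff : S ⌊Real.exp y⌋₊ - ((⌊Real.exp u⌋₊ : ℝ) - ⌊Real.exp y⌋₊) ≤ S ⌊Real.exp u⌋₊ := by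
      have : ∀ m n : ℕ, m ≤ n → S m - ((n : ℝ) - m) ≤ S n := by
        intro m n hmn
        induction n, hmn using Nat.le_induction with
        | base => simp
        | succ n hmn ih =>
          have : S (n + 1) = S n + b (n + 1) := by
            simp only [hS]
            rw [Finset.sum_Icc_succ_top (by omega)]
          rw [this]
          push_cast
          linarith [hb (n + 1)]
      exact this _ _ hle
    have h1 := Nat.floor_le (Real.exp_pos u).le
    have h2 := Nat.lt_floor_add_one (Real.exp y)
    have h3 : S ⌊Real.exp y⌋₊ - (Real.exp u - Real.exp y + 1) ≤ S ⌊Real.exp u⌋₊ := by linarith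
    have h4 : Real.exp (-u) * (S ⌊Real.exp y⌋₊ - (Real.exp u - Real.exp y + 1)) ≤ B u :=
      mul_le_mul_of_nonneg_left h3 (Real.exp_pos _).le
    set r := Real.exp (y - u) with hr
    have hr0 : 0 < r := Real.exp_pos _
    have hr1 : r ≤ 1 := Real.exp_le_one_iff.mpr (by linarith)
    have hr2 : 1 - r ≤ u - y := by
      have := Real.add_one_le_exp (y - u)
      linarith
    have e1 : Real.exp (-u) * S ⌊Real.exp y⌋₊ = r * B y := by
      simp only [hB, hr]
      rw [← mul_assoc, ← Real.exp_add]; ring_nf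
    have e2 : Real.exp (-u) * Real.exp u = 1 := by rw [← Real.exp_add]; simp
    have e3 : Real.exp (-u) * Real.exp y = r := by rw [← Real.exp_add, hr]; ring_nf
    have e4 : Real.exp (-u) ≤ Real.exp (-y) := Real.exp_le_exp.mpr (by linarith)
    have e5 : r * B y - 1 + r - Real.exp (-u) ≤ B u := by
      have : Real.exp (-u) * (S ⌊Real.exp y⌋₊ - (Real.exp u - Real.exp y + 1)) =
        r * B y - 1 + r - Real.exp (-u) := by linear_combination e1 - e2 + e3
      linarith
    have hBy := (abs_le.mp (hBC y)).2
    nlinarith [mul_le_mul_of_nonneg_left hBy (by linarith : 0 ≤ 1 - r),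
      mul_le_mul_of_nonneg_right hr2 (by linarith : 0 ≤ C + 1)]

end AlladiAux

namespace AlladiAux

open ArithmeticFunction in
theorem mobius_coprime (N : ℕ) (hN : N ≠ 0) :
    Tendsto (fun n : ℕ => (∑ k ∈ Icc 1 n, if k.Coprime N then (moebius k : ℝ) else 0) / n)
      atTop (nhds 0) := by
  haveI : NeZero N := ⟨hN⟩
  have habs : ∀ k : ℕ, |if k.Coprime N then (moebius k : ℝ) else 0| ≤ 1 := by
    intro k
    split_ifs
    · exact_mod_cast abs_moebius_le_one
    · simp
  apply wiener_ikehara (fun k => if k.Coprime N then (moebius k : ℝ) else 0) 1 _ _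
    (fun s => (s - 1) / DirichletCharacter.LFunctionTrivChar₁ N s)
  · apply ContinuousOn.div
    · fun_prop
    · exact (DirichletCharacter.differentiable_LFunctionTrivChar₁ N).continuous.continuousOn
    · intro s hs
      by_cases h1 : s = 1
      · rw [h1]; exact DirichletCharacter.LFunctionTrivChar₁_apply_one_ne_zero N
      · rw [DirichletCharacter.LFunctionTrivChar₁, Function.update_of_ne h1]
        exact mul_ne_zero (sub_ne_zero.mpr h1)
          (DirichletCharacter.LFunction_ne_zero_of_one_le_re _ (.inr h1) hs)
  · intro s hs
    have h1 : s ≠ 1 := by rintro rfl; simp at hs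
    have h2 := DirichletCharacter.LSeries.mul_mu_eq_one (1 : DirichletCharacter ℂ N) hs
    rw [← DirichletCharacter.LFunction_eq_LSeries _ hs] at h2
    rw [DirichletCharacter.LFunctionTrivChar₁, Function.update_of_ne h1,
      DirichletCharacter.LFunctionTrivChar]
    have h3 : DirichletCharacter.LFunction (1 : DirichletCharacter ℂ N) s ≠ 0 :=
      DirichletCharacter.LFunction_ne_zero_of_one_le_re _ (.inr h1) hs.le
    have h4 := sub_ne_zero.mpr h1
    have e : LSeries (fun n => (((if n.Coprime N then (moebius n : ℝ) else 0 : ℝ)) : ℂ)) s =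
        LSeries ((fun n : ℕ => (1 : DirichletCharacter ℂ N) n) * (fun n : ℕ => ((moebius n : ℤ) : ℂ))) s := by
      congr 1
      ext n
      simp only [Pi.mul_apply]
      by_cases hn : n.Coprime N
      · rw [if_pos hn, MulChar.one_apply ((ZMod.isUnit_iff_coprime n N).mpr hn)]
        simp
      · rw [if_neg hn, MulChar.map_nonunit _ (fun h => hn ((ZMod.isUnit_iff_coprime n N).mp h))]
        simp
    rw [e]
    rw [eq_div_iff (mul_ne_zero h4 h3)]
    linear_combination (s - 1) * h2
  · intro n
    calc _ ≤ ∑ k ∈ Icc 1 n, (1:ℝ) := Finset.sum_le_sum (fun k _ => habs k)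
      _ = 1 * n := by simp
  · intro n
    exact (abs_le.mp (habs n)).1

open ArithmeticFunction in
theorem psi_ap (q : ℕ) [NeZero q] (a : ZMod q) (ha : IsUnit a) :
    Tendsto (fun n : ℕ => (∑ k ∈ Icc 1 n, (vonMangoldt.residueClass a k - (q.totient : ℝ)⁻¹)) / n)
      atTop (nhds 0) := by
  have hφ : (1:ℝ) ≤ q.totient := by
    exact_mod_cast Nat.totient_pos.mpr (Nat.pos_of_ne_zero (NeZero.ne q))
  have hφ1 : (q.totient : ℝ)⁻¹ ≤ 1 := inv_le_one_of_one_le₀ hφ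
  have hφ0 : 0 ≤ (q.totient : ℝ)⁻¹ := by positivity
  set Z : ℂ → ℂ := Function.update (fun s => riemannZeta s - 1 / (s - 1)) 1
    (Real.eulerMascheroniConstant) with hZ
  have hZc : Continuous Z := by
    rw [continuous_iff_continuousAt]
    intro s
    by_cases h1 : s = 1
    · rw [h1, hZ, continuousAt_update_same]
      exact tendsto_riemannZeta_sub_one_div
    · rw [hZ, continuousAt_update_of_ne h1]
      have := (differentiableAt_riemannZeta h1).continuousAt
      have h2 := sub_ne_zero.mpr h1
      fun_prop (disch := assumption)
  apply wiener_ikehara (fun k => vonMangoldt.residueClass a k - (q.totient : ℝ)⁻¹)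
    (Real.log 4 + 4 + 1) _ _
    (fun s => vonMangoldt.LFunctionResidueClassAux a s - (q.totient : ℂ)⁻¹ * Z s)
  · exact (vonMangoldt.continuousOn_LFunctionResidueClassAux a).sub
      (continuous_const.mul hZc).continuousOn
  · intro s hs
    have h1 : s ≠ 1 := by rintro rfl; simp at hs
    have h2 := sub_ne_zero.mpr h1
    rw [vonMangoldt.eqOn_LFunctionResidueClassAux ha hs, hZ, Function.update_of_ne h1,
      ← LSeries_one_eq_riemannZeta hs]
    have e : (fun n => ((vonMangoldt.residueClass a n - (q.totient : ℝ)⁻¹ : ℝ) : ℂ)) =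
      (fun n => ((vonMangoldt.residueClass a n : ℝ) : ℂ)) - (q.totient : ℂ)⁻¹ • (1 : ℕ → ℂ) := by
      ext n; simp
    rw [e, LSeries_sub, LSeries_smul]
    · field_simp
      ring
    · exact LSeriesSummable_of_abscissaOfAbsConv_lt_re
        ((vonMangoldt.abscissaOfAbsConv_residueClass_le_one a).trans_lt (by exact_mod_cast hs))
    · exact (LSeriesSummable_one_iff.mpr hs).smul _
  · intro n
    have h1 : ∑ k ∈ Icc 1 n, vonMangoldt k ≤ (Real.log 4 + 4) * n := by
      have := Chebyshev.psi_le_const_mul_self (x := n) (by positivity)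
      rw [Chebyshev.psi, Nat.floor_natCast] at this
      exact this
    calc _ ≤ ∑ k ∈ Icc 1 n, (vonMangoldt k + 1) := by
          apply Finset.sum_le_sum
          intro k _
          have h2 := vonMangoldt.residueClass_nonneg a k
          have h3 := vonMangoldt.residueClass_le a k
          rw [abs_le]; constructor <;> linarith
      _ = ∑ k ∈ Icc 1 n, vonMangoldt k + n := by rw [Finset.sum_add_distrib]; simp
      _ ≤ _ := by linarith
  · intro n
    have h2 := vonMangoldt.residueClass_nonneg a n
    linarith

/-- coefficients for primes in AP -/
noncomputable def cc (k ℓ : ℕ) (p : ℕ) : ℝ :=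
  (if p ≡ ℓ [MOD k] then 1 else 0) - (k.totient : ℝ)⁻¹

lemma cc_abs (k ℓ p : ℕ) (hk : 0 < k) : |cc k ℓ p| ≤ 1 := by
  have hφ : (1:ℝ) ≤ k.totient := by
    exact_mod_cast Nat.totient_pos.mpr hk
  have hφ1 : (k.totient : ℝ)⁻¹ ≤ 1 := inv_le_one_of_one_le₀ hφ
  have hφ0 : 0 ≤ (k.totient : ℝ)⁻¹ := by positivity
  unfold cc
  rw [abs_le]
  split_ifs <;> constructor <;> linarith

open ArithmeticFunction in
theorem theta_ap (k ℓ : ℕ) (hk : 0 < k) (hl : Nat.gcd ℓ k = 1) :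
    Tendsto (fun n : ℕ => (∑ p ∈ Icc 1 n, if p.Prime then Real.log p * cc k ℓ p else 0) / n)
      atTop (nhds 0) := by
  haveI : NeZero k := ⟨hk.ne'⟩
  have h1 := psi_ap k (ℓ : ZMod k) ((ZMod.isUnit_iff_coprime ℓ k).mpr hl)
  have h2 := psi_ap 1 (1 : ZMod 1) isUnit_one
  have h3 := h1.sub (h2.const_mul (k.totient : ℝ)⁻¹)
  obtain ⟨C, hC⟩ := Chebyshev.psi_sub_theta_le_mul_sqrt
  have h4 : Tendsto (fun n : ℕ => C / Real.sqrt n) atTop (nhds 0) :=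
    (Real.tendsto_sqrt_atTop.comp tendsto_natCast_atTop_atTop).const_div_atTop C
  -- difference between psi and theta versions
  have h5 : ∀ n : ℕ, |(∑ j ∈ Icc 1 n, vonMangoldt j * cc k ℓ j) -
      (∑ p ∈ Icc 1 n, if p.Prime then Real.log p * cc k ℓ p else 0)| ≤ C * Real.sqrt n := by
    intro n
    have := hC n
    rw [Chebyshev.psi_sub_theta_eq_sum_not_prime, Nat.floor_natCast, Finset.sum_filter] at this
    rw [← Finset.sum_sub_distrib]
    refine (abs_sum_le_sum_abs _ _).trans (le_trans ?_ this)
    apply Finset.sum_le_sum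
    intro p _
    by_cases hp : p.Prime
    · simp [hp, vonMangoldt_apply_prime hp]
    · simp only [hp, if_false, sub_zero, not_false_eq_true, if_true]
      rw [abs_mul, abs_of_nonneg vonMangoldt_nonneg]
      exact mul_le_of_le_one_right vonMangoldt_nonneg (cc_abs k ℓ p hk)
  have h6 : Tendsto (fun n : ℕ => (∑ j ∈ Icc 1 n, vonMangoldt j * cc k ℓ j) / n)
      atTop (nhds 0) := by
    have h0 : (0:ℝ) - (k.totient : ℝ)⁻¹ * 0 = 0 := by simp
    rw [h0] at h3
    refine h3.congr ?_
    intro n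
    rw [← mul_div_assoc, ← sub_div, Finset.mul_sum, ← Finset.sum_sub_distrib]
    congr 1
    apply Finset.sum_congr rfl
    intro j _
    have e1 : vonMangoldt.residueClass (1 : ZMod 1) j = vonMangoldt j := by
      simp [vonMangoldt.residueClass, Set.indicator_apply, Subsingleton.elim _ (1 : ZMod 1)]
    have e2 : vonMangoldt.residueClass (ℓ : ZMod k) j =
        vonMangoldt j * (if j ≡ ℓ [MOD k] then 1 else 0) := by
      have : j ∈ {n : ℕ | (n : ZMod k) = ℓ} ↔ j ≡ ℓ [MOD k] := by
        rw [Set.mem_ofPred_eq, ZMod.natCast_eq_natCast_iff]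
      simp [vonMangoldt.residueClass, Set.indicator_apply, ZMod.natCast_eq_natCast_iff]
    rw [e1, e2, cc]
    by_cases hj : j ≡ ℓ [MOD k] <;> simp [hj] <;> ring
  have h7 : Tendsto (fun n : ℕ => (∑ j ∈ Icc 1 n, vonMangoldt j * cc k ℓ j) / n -
      (∑ p ∈ Icc 1 n, if p.Prime then Real.log p * cc k ℓ p else 0) / n) atTop (nhds 0) := by
    apply squeeze_zero_norm' _ h4
    filter_upwards [eventually_gt_atTop 0] with n hn
    have hn' : (0:ℝ) < n := by exact_mod_cast hn
    rw [← sub_div, Real.norm_eq_abs, abs_div, abs_of_pos hn', div_le_iff₀ hn']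
    refine (h5 n).trans (le_of_eq ?_)
    have := Real.sqrt_pos.mpr hn'
    field_simp
    rw [Real.sq_sqrt hn'.le]
  have h8 := h6.sub h7
  simpa using h8

end AlladiAux

namespace AlladiAux

theorem abel_bound (c g : ℕ → ℝ) (z : ℕ) (K : ℝ) (hg : ∀ n, z < n → g (n + 1) ≤ g n)
    (hg0 : ∀ n, z < n → 0 ≤ g n) (N : ℕ) (hK1 : 0 ≤ K)
    (hK : ∀ m, z ≤ m → m ≤ N → |∑ i ∈ Ioc z m, c i| ≤ K) :
    |∑ n ∈ Ioc z N, g n * c n| ≤ K * g (z + 1) := by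

  rcases Nat.lt_or_ge z N with h | h
  swap
  · rw [Finset.Ioc_eq_empty_of_le h]
    simp only [sum_empty, abs_zero]
    exact mul_nonneg hK1 (hg0 _ (by omega))
  have key : ∀ M, z + 1 ≤ M → M ≤ N →
      |∑ n ∈ Ioc z M, g n * c n - g M * ∑ i ∈ Ioc z M, c i| ≤ K * (g (z + 1) - g M) := by
    intro M hM
    induction M, hM using Nat.le_induction with
    | base => intro _; simp
    | succ M hM ih =>
      intro hMN
      have ih := ih (by omega)
      rw [Finset.sum_Ioc_succ_top (by omega), Finset.sum_Ioc_succ_top (by omega)]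
      have h1 : ∑ n ∈ Ioc z M, g n * c n + g (M + 1) * c (M + 1)
          - g (M + 1) * (∑ i ∈ Ioc z M, c i + c (M + 1)) =
          (∑ n ∈ Ioc z M, g n * c n - g M * ∑ i ∈ Ioc z M, c i)
            + (g M - g (M + 1)) * ∑ i ∈ Ioc z M, c i := by ring
      rw [h1]
      refine (abs_add_le _ _).trans ?_
      rw [abs_mul, abs_of_nonneg (sub_nonneg.mpr (hg M (by omega)))]
      have h2 := mul_le_mul_of_nonneg_left (hK M (by omega) (by omega))
        (sub_nonneg.mpr (hg M (by omega)))
      nlinarith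
  have h1 := key N h le_rfl
  have h2 : |g N * ∑ i ∈ Ioc z N, c i| ≤ g N * K := by
    rw [abs_mul, abs_of_nonneg (hg0 N h)]
    exact mul_le_mul_of_nonneg_left (hK N h.le le_rfl) (hg0 N h)
  have h3 := abs_add_le (∑ n ∈ Ioc z N, g n * c n - g N * ∑ i ∈ Ioc z N, c i)
    (g N * ∑ i ∈ Ioc z N, c i)
  rw [sub_add_cancel] at h3
  nlinarith

end AlladiAux

namespace AlladiAux

/-- maximal partial sums -/
theorem small_partial (A : ℕ → ℝ) (hA : Tendsto (fun n : ℕ => A n / n) atTop (nhds 0))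
    (δ : ℝ) (hδ : 0 < δ) : ∀ᶠ N : ℕ in atTop, ∀ m ≤ N, |A m| ≤ δ * N := by
  have h1 := (Metric.tendsto_atTop.mp hA) δ hδ
  obtain ⟨M, hM⟩ := h1
  obtain ⟨B, hB⟩ : ∃ B : ℝ, ∀ m ≤ M, |A m| ≤ B :=
    ⟨∑ i ∈ Finset.range (M+1), |A i|, fun m hm => Finset.single_le_sum (f := fun i => |A i|)
      (fun i _ => abs_nonneg _) (Finset.mem_range.mpr (by omega))⟩
  have h2 : Tendsto (fun N : ℕ => δ * (N:ℝ)) atTop atTop :=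
    tendsto_natCast_atTop_atTop.const_mul_atTop hδ
  filter_upwards [h2.eventually_ge_atTop B] with N hN m hm
  rcases le_or_gt m M with h | h
  · exact (hB m h).trans hN
  · have h3 := hM m h.le
    have hm0 : (0:ℝ) < m := by exact_mod_cast (by omega : 0 < m)
    rw [Real.dist_eq, sub_zero, abs_div, abs_of_pos hm0, div_lt_iff₀ hm0] at h3
    have : (m:ℝ) ≤ N := by exact_mod_cast hm
    nlinarith

theorem axer (a : ℕ → ℝ) (ha : ∀ n, |a n| ≤ 1)
    (hA : Tendsto (fun n : ℕ => (∑ i ∈ Ioc 0 n, a i) / n) atTop (nhds 0)) :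
    Tendsto (fun N : ℕ => (∑ n ∈ Ioc 0 N, a n * ((N:ℝ) / n - (N / n : ℕ))) / N) atTop (nhds 0) := by
  rw [Metric.tendsto_atTop']
  intro ε hε
  obtain ⟨K, hK⟩ := exists_nat_gt (2 / ε)
  have hKp : (0:ℝ) < K := lt_trans (by positivity) hK
  have hKp' : 0 < K := by exact_mod_cast hKp
  have hδ : 0 < ε / (16 * K) := by positivity
  obtain ⟨N0, hN0⟩ := eventually_atTop.mp (small_partial _ hA _ hδ)
  refine ⟨N0, fun N hN => ?_⟩
  have hP := hN0 N hN.le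
  have hNp' : 0 < N := by omega
  have hNp : (0:ℝ) < N := by exact_mod_cast hNp'
  set δ := ε / (16 * K) with hδd
  rw [Real.dist_eq, sub_zero, abs_div, abs_of_pos hNp, div_lt_iff₀ hNp]
  set z := N / K with hz
  have hzN : z ≤ N := Nat.div_le_self _ _
  have hfr : ∀ n : ℕ, 0 ≤ (N:ℝ) / n - (N / n : ℕ) ∧ (N:ℝ) / n - (N / n : ℕ) ≤ 1 := by
    intro n
    rw [← Nat.floor_div_eq_div (K := ℝ)]
    have h1 := Nat.floor_le (show (0:ℝ) ≤ (N:ℝ) / n by positivity)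
    have h2 := Nat.lt_floor_add_one ((N:ℝ) / n)
    constructor <;> linarith
  rw [← Finset.sum_Ioc_consecutive _ (Nat.zero_le z) hzN]
  have b1 : |∑ n ∈ Ioc 0 z, a n * ((N:ℝ) / n - (N / n : ℕ))| ≤ N / K := by
    refine (abs_sum_le_sum_abs _ _).trans ?_
    calc _ ≤ ∑ n ∈ Ioc 0 z, (1:ℝ) := by
          apply Finset.sum_le_sum
          intro n _
          rw [abs_mul, abs_of_nonneg (hfr n).1]
          exact mul_le_one₀ (ha n) (hfr n).1 (hfr n).2
      _ = z := by simp
      _ ≤ N / K := Nat.cast_div_le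
  have hz1 : (N:ℝ) / ((z + 1 : ℕ):ℝ) ≤ K := by
    rw [div_le_iff₀ (by positivity)]
    have : N < K * (z + 1) := by
      rw [hz]; exact Nat.lt_mul_div_succ N hKp'
    exact_mod_cast this.le
  have hpart : ∀ m, z ≤ m → m ≤ N → |∑ i ∈ Ioc z m, a i| ≤ 2 * (δ * N) := by
    intro m h1 h2
    have h3 := Finset.sum_Ioc_consecutive a (Nat.zero_le z) h1
    have h4 := hP m h2
    have h5 := hP z hzN
    rw [abs_le] at *
    constructor <;> linarith [h4.1, h4.2, h5.1, h5.2]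
  have b2 := abel_bound a (fun n => (N:ℝ) / n) z (2 * (δ * N))
    (fun n hn => by
      have : (0:ℝ) < n := by exact_mod_cast (lt_of_le_of_lt (Nat.zero_le z) hn)
      apply div_le_div_of_nonneg_left hNp.le this
      push_cast; linarith) (fun n _ => by positivity) N (by positivity) hpart
  have b3 := abel_bound a (fun n => ((N / n : ℕ) : ℝ)) z (2 * (δ * N))
    (fun n hn => by
      have := Nat.div_le_div_left (a := N) (Nat.le_succ n) (lt_of_le_of_lt (Nat.zero_le z) hn)
      exact_mod_cast this) (fun n _ => by positivity) N (by positivity) hpart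
  have e : ∑ n ∈ Ioc z N, a n * ((N:ℝ) / n - (N / n : ℕ)) =
      ∑ n ∈ Ioc z N, (N:ℝ) / n * a n - ∑ n ∈ Ioc z N, ((N / n : ℕ) : ℝ) * a n := by
    rw [← Finset.sum_sub_distrib]
    apply Finset.sum_congr rfl
    intro n _; ring
  rw [e]
  have b2' : |∑ n ∈ Ioc z N, (N:ℝ) / n * a n| ≤ 2 * (δ * N) * K :=
    b2.trans (mul_le_mul_of_nonneg_left hz1 (by positivity))
  have b3' : |∑ n ∈ Ioc z N, ((N / n : ℕ) : ℝ) * a n| ≤ 2 * (δ * N) * K :=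
    b3.trans (mul_le_mul_of_nonneg_left (Nat.cast_div_le.trans hz1) (by positivity))
  have e1 : 2 * (δ * N) * K = ε / 8 * N := by rw [hδd]; field_simp; norm_num
  have e2 : (N:ℝ) / K < ε / 2 * N := by
    rw [div_lt_iff₀ hKp]
    have : 1 < ε / 2 * K := by
      rw [div_lt_iff₀ hε] at hK; linarith
    nlinarith
  rw [e1] at b2' b3'
  rw [abs_le] at b1 b2' b3'
  have : 0 < ε * N := by positivity
  rw [abs_lt]
  constructor <;> linarith [b1.1, b1.2, b2'.1, b2'.2, b3'.1, b3'.2]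

end AlladiAux

namespace AlladiAux

theorem rough_density (ε : ℝ) (hε : 0 < ε) : ∃ Y : ℕ, ((Y.factorial).totient : ℝ) ≤ ε * Y.factorial := by
  have h1 := (not_summable_iff_tendsto_nat_atTop_of_nonneg (fun n => by
    apply Set.indicator_nonneg; intro x _; positivity)).mp not_summable_one_div_on_primes
  obtain ⟨Y, hY⟩ := (h1.eventually_ge_atTop (-Real.log ε)).exists
  refine ⟨Y, ?_⟩
  have h2 := Nat.totient_eq_mul_prod_factors Y.factorial
  have h3 : ((Y.factorial).totient : ℝ) = Y.factorial * ∏ p ∈ Y.factorial.primeFactors, (1 - (p:ℝ)⁻¹) := by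
    have h4 := congrArg (Rat.cast : ℚ → ℝ) h2
    push_cast at h4
    exact h4
  rw [h3, mul_comm]
  gcongr
  calc ∏ p ∈ Y.factorial.primeFactors, (1 - (p:ℝ)⁻¹)
      ≤ ∏ p ∈ Y.factorial.primeFactors, Real.exp (-(p:ℝ)⁻¹) := by
        apply Finset.prod_le_prod
        · intro p hp
          have : (1:ℝ) ≤ p := by exact_mod_cast (Nat.prime_of_mem_primeFactors hp).one_le
          have := inv_le_one_of_one_le₀ this
          linarith
        · intro p _
          have := Real.add_one_le_exp (-(p:ℝ)⁻¹)
          linarith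
    _ = Real.exp (-∑ p ∈ Y.factorial.primeFactors, (p:ℝ)⁻¹) := by
        rw [← Real.exp_sum, Finset.sum_neg_distrib]
    _ ≤ Real.exp (Real.log ε) := by
        apply Real.exp_le_exp.mpr
        have : ∑ i ∈ Finset.range Y, Set.indicator {p | Nat.Prime p} (fun n : ℕ ↦ (1 : ℝ) / n) i
            ≤ ∑ p ∈ Y.factorial.primeFactors, (p:ℝ)⁻¹ := by
          rw [Finset.sum_indicator_eq_sum_filter]
          simp only [one_div]
          apply Finset.sum_le_sum_of_subset_of_nonneg
          · intro p hp
            rw [Finset.mem_filter, Finset.mem_range] at hp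
            obtain ⟨h1, h2⟩ := hp
            have h2 : p.Prime := h2
            exact Nat.mem_primeFactors.mpr ⟨h2, h2.dvd_factorial.mpr h1.le, Nat.factorial_ne_zero _⟩
          · intro _ _ _; positivity
        linarith
    _ = ε := Real.exp_log hε

/-- the sequence attached to f -/
noncomputable def aa (f : ℕ → ℝ) (n : ℕ) : ℝ :=
  if 2 ≤ n then (ArithmeticFunction.moebius n : ℝ) * f n.minFac else 0

theorem mu_abs (n : ℕ) : |(ArithmeticFunction.moebius n : ℝ)| ≤ 1 := by
  exact_mod_cast ArithmeticFunction.abs_moebius_le_one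

theorem aa_abs (f : ℕ → ℝ) (hf : ∀ n, |f n| ≤ 1) (n : ℕ) : |aa f n| ≤ 1 := by
  unfold aa
  split_ifs
  · rw [abs_mul]
    exact mul_le_one₀ (mu_abs n) (abs_nonneg _) (hf _)
  · simp

noncomputable def tt (j n : ℕ) : ℝ :=
  (if n.Coprime (j - 1).factorial then 1 else 0) - (if n.Coprime j.factorial then 1 else 0)

theorem tt_eq (j n : ℕ) (hj : 0 < j) (hn : 2 ≤ n) : tt j n = if j = n.minFac then 1 else 0 := by
  unfold tt
  have h1 : n ≠ 1 := by omega
  simp only [Nat.coprime_factorial_iff h1]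
  split_ifs <;> first | omega | simp

theorem tt_one (j : ℕ) : tt j 1 = 0 := by simp [tt]

theorem aa_split (f : ℕ → ℝ) (hf : ∀ n, |f n| ≤ 1) (Y n : ℕ) (hn : 0 < n) :
    |aa f n - ∑ j ∈ Ioc 0 Y, f j * (tt j n * (ArithmeticFunction.moebius n : ℝ))| ≤
      if Y.factorial.Coprime n then 1 else 0 := by
  rcases Nat.lt_or_ge n 2 with h | h
  · have : n = 1 := by omega
    subst this
    simp [aa, tt_one]
  · have e : ∑ j ∈ Ioc 0 Y, f j * (tt j n * (ArithmeticFunction.moebius n : ℝ)) =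
        ∑ j ∈ Ioc 0 Y, if j = n.minFac then f j * (ArithmeticFunction.moebius n : ℝ) else 0 := by
      apply Finset.sum_congr rfl
      intro j hj
      rw [tt_eq j n (Finset.mem_Ioc.mp hj).1 h]
      split_ifs <;> simp
    have h1 : n ≠ 1 := by omega
    rw [e, Finset.sum_ite_eq']
    simp only [Nat.coprime_comm (n := Y.factorial), Nat.coprime_factorial_iff h1]
    have := Nat.minFac_pos n
    by_cases hY : Y < n.minFac
    · rw [if_pos hY, if_neg (by simp; omega), sub_zero]
      exact aa_abs f hf n
    · rw [if_neg hY, if_pos (by simp; omega), aa, if_pos h, mul_comm, sub_self, abs_zero]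

theorem aa_mean (f : ℕ → ℝ) (hf : ∀ n, |f n| ≤ 1) :
    Tendsto (fun N : ℕ => (∑ n ∈ Ioc 0 N, aa f n) / N) atTop (nhds 0) := by
  rw [Metric.tendsto_atTop]
  intro ε hε
  obtain ⟨Y, hY⟩ := rough_density (ε / 4) (by positivity)
  have h1 : Tendsto (fun N : ℕ => ∑ j ∈ Ioc 0 Y, f j *
      (((∑ k ∈ Icc 1 N, if k.Coprime (j-1).factorial then (ArithmeticFunction.moebius k : ℝ) else 0) / N)
      - ((∑ k ∈ Icc 1 N, if k.Coprime j.factorial then (ArithmeticFunction.moebius k : ℝ) else 0) / N)))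
      atTop (nhds (∑ j ∈ Ioc 0 Y, f j * (0 - 0))) := by
    apply tendsto_finsetSum
    intro j _
    exact ((mobius_coprime _ (Nat.factorial_ne_zero _)).sub
      (mobius_coprime _ (Nat.factorial_ne_zero _))).const_mul _
  simp only [sub_self, mul_zero, Finset.sum_const_zero] at h1
  have h2 : Tendsto (fun N : ℕ => ((Y.factorial).totient : ℝ) / N) atTop (nhds 0) :=
    tendsto_natCast_atTop_atTop.const_div_atTop _
  obtain ⟨N1, hN1⟩ := (Metric.tendsto_atTop.mp h1) (ε / 4) (by positivity)
  obtain ⟨N2, hN2⟩ := (Metric.tendsto_atTop.mp h2) (ε / 4) (by positivity)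
  refine ⟨max (max N1 N2) 1, fun N hN => ?_⟩
  have hNp : (0:ℝ) < N := by exact_mod_cast (by omega : 0 < N)
  have b1 := hN1 N (by omega)
  have b2 := hN2 N (by omega)
  rw [Real.dist_eq, sub_zero] at b1 b2 ⊢
  have e : ∑ j ∈ Ioc 0 Y, f j *
      (((∑ k ∈ Icc 1 N, if k.Coprime (j-1).factorial then (ArithmeticFunction.moebius k : ℝ) else 0) / N)
      - ((∑ k ∈ Icc 1 N, if k.Coprime j.factorial then (ArithmeticFunction.moebius k : ℝ) else 0) / N))
      = (∑ n ∈ Ioc 0 N, ∑ j ∈ Ioc 0 Y, f j * (tt j n * (ArithmeticFunction.moebius n : ℝ))) / N := by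
    rw [Finset.sum_comm, Finset.sum_div]
    apply Finset.sum_congr rfl
    intro j _
    rw [← sub_div, ← Finset.mul_sum, mul_div_assoc, ← Finset.sum_sub_distrib]
    congr 2
    apply Finset.sum_congr rfl
    intro n _
    simp only [tt, sub_mul, ite_mul, one_mul, zero_mul]
  rw [e] at b1
  have b3 : |∑ n ∈ Ioc 0 N, aa f n - ∑ n ∈ Ioc 0 N, ∑ j ∈ Ioc 0 Y, f j * (tt j n * (ArithmeticFunction.moebius n : ℝ))|
      ≤ (Y.factorial).totient + ε / 4 * N := by
    rw [← Finset.sum_sub_distrib]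
    refine (abs_sum_le_sum_abs _ _).trans ?_
    calc _ ≤ ∑ n ∈ Ioc 0 N, if Y.factorial.Coprime n then (1:ℝ) else 0 :=
          Finset.sum_le_sum fun n hn => aa_split f hf Y n (Finset.mem_Ioc.mp hn).1
      _ = ((#{x ∈ Ico 1 (1 + N) | Y.factorial.Coprime x} : ℕ) : ℝ) := by
          rw [Finset.sum_boole]
          congr 2
          ext x
          simp
          omega
      _ ≤ ((Y.factorial.totient * (N / Y.factorial + 1) : ℕ) : ℝ) := by
          exact_mod_cast Nat.Ico_filter_coprime_le 1 N (Nat.factorial_ne_zero _)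
      _ ≤ (Y.factorial).totient + ε / 4 * N := by
          push_cast
          have h5 : ((N / Y.factorial : ℕ) : ℝ) ≤ N / Y.factorial := Nat.cast_div_le
          have h6 : (0:ℝ) < Y.factorial := by exact_mod_cast Nat.factorial_pos _
          have h7 : (Y.factorial.totient : ℝ) * ((N / Y.factorial : ℕ) : ℝ) ≤ ε / 4 * N := by
            calc _ ≤ (ε / 4 * Y.factorial) * ((N:ℝ) / Y.factorial) :=
                mul_le_mul hY h5 (by positivity) (by positivity)
              _ = ε / 4 * N := by field_simp
          linarith
  rw [abs_div, abs_of_pos hNp, div_lt_iff₀ hNp] at b1 b2 ⊢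
  have b2 := (abs_lt.mp b2).2
  have b1 := abs_lt.mp b1
  have b3 := abs_le.mp b3
  have : 0 < ε * N := by positivity
  rw [abs_lt]
  constructor <;> linarith [b1.1, b1.2, b3.1, b3.2]

end AlladiAux

namespace AlladiAux

/-- largest prime factor -/
def PP (m : ℕ) : ℕ := m.primeFactors.sup id

theorem PP_le_iff (m j : ℕ) : PP m ≤ j ↔ ∀ p ∈ m.primeFactors, p ≤ j := by
  simp [PP, Finset.sup_le_iff]

theorem PP_le_self (m : ℕ) : PP m ≤ m := by
  rw [PP_le_iff]
  intro p hp
  exact Nat.le_of_mem_primeFactors hp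

theorem PP_mem (m : ℕ) (hm : 2 ≤ m) : PP m ∈ m.primeFactors := by
  have h : m.primeFactors.Nonempty := Nat.nonempty_primeFactors.mpr (by omega)
  obtain ⟨p, hp, h2⟩ := Finset.exists_mem_eq_sup m.primeFactors h id
  unfold PP
  rw [h2]
  exact hp

theorem PP_one : PP 1 = 0 := by simp [PP]

open ArithmeticFunction in
theorem div_sum (m j : ℕ) (hm : 0 < m) :
    ∑ d ∈ m.divisors, (if d.Coprime j.factorial then (moebius d : ℝ) else 0) =
      if PP m ≤ j then 1 else 0 := by
  split_ifs with h
  · rw [PP_le_iff] at h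
    rw [Finset.sum_eq_single 1]
    · simp
    · intro d hd hd1
      rw [if_neg]
      rw [Nat.coprime_factorial_iff hd1, not_lt]
      apply h
      exact Nat.mem_primeFactors.mpr ⟨Nat.minFac_prime hd1,
        (Nat.minFac_dvd d).trans (Nat.dvd_of_mem_divisors hd), by omega⟩
    · intro h; simp at h; omega
  · rw [PP_le_iff] at h
    push Not at h
    obtain ⟨q, hq, hqj⟩ := h
    have hqp := Nat.prime_of_mem_primeFactors hq
    have hqm := Nat.dvd_of_mem_primeFactors hq
    have hqc : q.Coprime j.factorial := hqp.coprime_factorial_of_lt hqj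
    have hs : ∑ d ∈ m.divisors, (if d.Coprime j.factorial then (moebius d : ℝ) else 0) =
      ∑ d ∈ m.divisors.filter Squarefree, (if d.Coprime j.factorial then (moebius d : ℝ) else 0) := by
      rw [Finset.sum_filter]
      apply Finset.sum_congr rfl
      intro d _
      by_cases hd : Squarefree d
      · simp [hd]
      · simp [hd, moebius_eq_zero_of_not_squarefree hd]
    rw [hs]
    have key : ∀ e : ℕ, ¬ q ∣ e → (if e.Coprime j.factorial then (moebius e : ℝ) else 0) +
        (if (q * e).Coprime j.factorial then (moebius (q * e) : ℝ) else 0) = 0 := by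
      intro e he
      have h1 : q.Coprime e := hqp.coprime_iff_not_dvd.mpr he
      have h2 : (q * e).Coprime j.factorial ↔ e.Coprime j.factorial := by
        rw [Nat.coprime_mul_iff_left]
        exact ⟨fun h => h.2, fun h => ⟨hqc, h⟩⟩
      simp only [h2, isMultiplicative_moebius.map_mul_of_coprime h1, moebius_apply_prime hqp]
      split_ifs <;> simp
    have sqf : ∀ e : ℕ, Squarefree (q * e) → ¬ q ∣ e := by
      intro e he hd
      have := (Nat.squarefree_mul_iff.mp he).1
      exact (hqp.coprime_iff_not_dvd.mp this) hd
    apply Finset.sum_involution (fun d _ => if q ∣ d then d / q else q * d)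
    · intro d hd
      rw [Finset.mem_filter] at hd
      by_cases h : q ∣ d
      · obtain ⟨e, rfl⟩ := h
        simp only [dvd_mul_right, if_true, Nat.mul_div_cancel_left _ hqp.pos]
        rw [add_comm]
        exact key e (sqf e hd.2)
      · rw [if_neg h]; exact key d h
    · intro d hd hd0
      rw [Finset.mem_filter] at hd
      have hdpos := Nat.pos_of_mem_divisors hd.1
      by_cases h : q ∣ d
      · rw [if_pos h]
        exact (Nat.div_lt_self hdpos hqp.one_lt).ne
      · rw [if_neg h]
        have := hqp.two_le
        nlinarith
    · intro d hd
      rw [Finset.mem_filter, Nat.mem_divisors] at hd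
      rw [Finset.mem_filter, Nat.mem_divisors]
      by_cases h : q ∣ d
      · rw [if_pos h]
        refine ⟨⟨(Nat.div_dvd_of_dvd h).trans hd.1.1, hd.1.2⟩, ?_⟩
        exact hd.2.squarefree_of_dvd (Nat.div_dvd_of_dvd h)
      · rw [if_neg h]
        have h1 : q.Coprime d := hqp.coprime_iff_not_dvd.mpr h
        exact ⟨⟨h1.mul_dvd_of_dvd_of_dvd hqm hd.1.1, hd.1.2⟩,
          Nat.squarefree_mul_iff.mpr ⟨h1, hqp.prime.squarefree, hd.2⟩⟩
    · intro d hd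
      rw [Finset.mem_filter] at hd
      by_cases h : q ∣ d
      · obtain ⟨e, rfl⟩ := h
        simp only [dvd_mul_right, if_true, Nat.mul_div_cancel_left _ hqp.pos]
        rw [if_neg (sqf e hd.2)]
      · simp [h, Nat.mul_div_cancel_left _ hqp.pos]

noncomputable def bb (f : ℕ → ℝ) (m : ℕ) : ℝ := if 2 ≤ m then f (PP m) else 0

open ArithmeticFunction in
theorem duality (f : ℕ → ℝ) (m : ℕ) (hm : 0 < m) : ∑ d ∈ m.divisors, aa f d = - bb f m := by
  have h1 : ∀ d ∈ m.divisors, aa f d = ∑ j ∈ Ioc 0 m, f j * (tt j d * (moebius d : ℝ)) := by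
    intro d hd
    have hd0 := Nat.pos_of_mem_divisors hd
    have hdm := Nat.divisor_le hd
    rcases Nat.lt_or_ge d 2 with h | h
    · have : d = 1 := by omega
      subst this
      simp [aa, tt_one]
    · have e : ∑ j ∈ Ioc 0 m, f j * (tt j d * (moebius d : ℝ)) =
          ∑ j ∈ Ioc 0 m, if j = d.minFac then f j * (moebius d : ℝ) else 0 := by
        apply Finset.sum_congr rfl
        intro j hj
        rw [tt_eq j d (Finset.mem_Ioc.mp hj).1 h]
        split_ifs <;> simp
      have h1 := Nat.minFac_pos d
      have h2 := Nat.minFac_le hd0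
      rw [e, Finset.sum_ite_eq', if_pos (by simp; omega), aa, if_pos h, mul_comm]
  rw [Finset.sum_congr rfl h1, Finset.sum_comm]
  have h2 : ∀ j ∈ Ioc 0 m, ∑ d ∈ m.divisors, f j * (tt j d * (moebius d : ℝ)) =
      if j = PP m then - f j else 0 := by
    intro j hj
    have hj := (Finset.mem_Ioc.mp hj).1
    rw [← Finset.mul_sum]
    simp only [tt, sub_mul, ite_mul, one_mul, zero_mul]
    rw [Finset.sum_sub_distrib, div_sum m _ hm, div_sum m _ hm]
    split_ifs <;> first | omega | simp
  rw [Finset.sum_congr rfl h2, Finset.sum_ite_eq', bb]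
  have h3 := PP_le_self m
  rcases Nat.lt_or_ge m 2 with h | h
  · have : m = 1 := by omega
    subst this
    simp [PP_one]
  · have h4 := (Nat.prime_of_mem_primeFactors (PP_mem m h)).pos
    rw [if_pos h, if_pos (by simp; omega)]

open ArithmeticFunction in
theorem sum_bb (f : ℕ → ℝ) (N : ℕ) :
    ∑ n ∈ Ioc 0 N, aa f n * ((N / n : ℕ) : ℝ) = - ∑ m ∈ Ioc 0 N, bb f m := by
  let F : ArithmeticFunction ℝ := ⟨aa f, by simp [aa]⟩
  have h := sum_Ioc_mul_zeta_eq_sum F N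
  have h2 : ∀ n, F n = aa f n := fun n => rfl
  simp only [h2] at h
  rw [← h, ← Finset.sum_neg_distrib]
  apply Finset.sum_congr rfl
  intro m hm
  rw [← duality f m (Finset.mem_Ioc.mp hm).1, coe_mul_zeta_apply]
  rfl

theorem alladi_dual (f : ℕ → ℝ) (hf : ∀ n, |f n| ≤ 1) :
    Tendsto (fun N : ℕ => ∑ n ∈ Ioc 0 N, aa f n / n + (∑ m ∈ Ioc 0 N, bb f m) / N)
      atTop (nhds 0) := by
  refine (axer (aa f) (aa_abs f hf) (aa_mean f hf)).congr' ?_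
  filter_upwards [eventually_gt_atTop 0] with N hN
  have hNp : (N:ℝ) ≠ 0 := by exact_mod_cast hN.ne'
  simp only [mul_sub]
  rw [Finset.sum_sub_distrib, sum_bb, sub_neg_eq_add, add_div, Finset.sum_div]
  congr 1
  apply Finset.sum_congr rfl
  intro n _
  field_simp

end AlladiAux

namespace AlladiAux

open ArithmeticFunction in
theorem mertens_upper (z : ℕ) (hz : 0 < z) :
    ∑ d ∈ Ioc 0 z, vonMangoldt d / d ≤ Real.log z + (Real.log 4 + 4) := by
  have hzp : (0:ℝ) < z := by exact_mod_cast hz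
  have h1 := sum_Ioc_mul_zeta_eq_sum vonMangoldt z
  rw [vonMangoldt_mul_zeta] at h1
  have h2 : ∑ n ∈ Ioc 0 z, (ArithmeticFunction.log n) ≤ z * Real.log z := by
    calc ∑ n ∈ Ioc 0 z, (ArithmeticFunction.log n) ≤ ∑ n ∈ Ioc 0 z, Real.log z := by
          apply Finset.sum_le_sum
          intro n hn
          rw [Finset.mem_Ioc] at hn
          rw [ArithmeticFunction.log_apply]
          exact Real.log_le_log (by exact_mod_cast hn.1) (by exact_mod_cast hn.2)
      _ = z * Real.log z := by simp
  have h3 := Chebyshev.psi_le_const_mul_self hzp.le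
  rw [Chebyshev.psi, Nat.floor_natCast] at h3
  have h4 : ∑ d ∈ Ioc 0 z, vonMangoldt d * ((z:ℝ) / d) ≤
      ∑ d ∈ Ioc 0 z, (vonMangoldt d * ((z / d : ℕ) : ℝ) + vonMangoldt d) := by
    apply Finset.sum_le_sum
    intro d _
    rw [← mul_add_one]
    apply mul_le_mul_of_nonneg_left _ vonMangoldt_nonneg
    rw [← Nat.floor_div_eq_div (K := ℝ)]
    exact (Nat.lt_floor_add_one _).le
  rw [Finset.sum_add_distrib, ← h1] at h4
  have h5 : ∑ d ∈ Ioc 0 z, vonMangoldt d * ((z:ℝ) / d) = z * ∑ d ∈ Ioc 0 z, vonMangoldt d / d := by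
    rw [Finset.mul_sum]
    apply Finset.sum_congr rfl
    intro d _; ring
  rw [h5] at h4
  have h6 : (z:ℝ) * ∑ d ∈ Ioc 0 z, vonMangoldt d / d ≤ z * (Real.log z + (Real.log 4 + 4)) := by
    linarith
  exact le_of_mul_le_mul_left h6 hzp

open ArithmeticFunction in
theorem mertens_prime (z : ℕ) (hz : 0 < z) :
    ∑ p ∈ (Ioc 0 z).filter Nat.Prime, Real.log p / ((p:ℝ) - 1) ≤
      2 * (Real.log z + (Real.log 4 + 4)) := by
  calc ∑ p ∈ (Ioc 0 z).filter Nat.Prime, Real.log p / ((p:ℝ) - 1)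
      ≤ ∑ p ∈ (Ioc 0 z).filter Nat.Prime, 2 * (vonMangoldt p / p) := by
        apply Finset.sum_le_sum
        intro p hp
        have hp := (Finset.mem_filter.mp hp).2
        rw [vonMangoldt_apply_prime hp]
        have h2 : (2:ℝ) ≤ p := by exact_mod_cast hp.two_le
        have h3 : 0 ≤ Real.log p := Real.log_nonneg (by linarith)
        rw [← mul_div_assoc, div_le_div_iff₀ (by linarith) (by linarith)]
        nlinarith
    _ ≤ ∑ p ∈ Ioc 0 z, 2 * (vonMangoldt p / p) := by
        apply Finset.sum_le_sum_of_subset_of_nonneg (Finset.filter_subset _ _)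
        intro d _ _
        have := vonMangoldt_nonneg (n := d)
        positivity
    _ ≤ _ := by
        rw [← Finset.mul_sum]
        exact mul_le_mul_of_nonneg_left (mertens_upper z hz) (by norm_num)

theorem fact_val (p N : ℕ) : ∑ n ∈ Ioc 0 N, n.factorization p = N.factorial.factorization p := by
  induction N with
  | zero => simp
  | succ N ih =>
    rw [Finset.sum_Ioc_succ_top (by omega), ih, Nat.factorial_succ,
      Nat.factorization_mul (by omega) (Nat.factorial_ne_zero _)]
    simp [add_comm]

theorem fact_val_le (p N : ℕ) (hp : p.Prime) :
    (N.factorial.factorization p : ℝ) ≤ N / ((p:ℝ) - 1) := by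
  have := Fact.mk hp
  have h := sub_one_mul_padicValNat_factorial (p := p) N
  have h1 : (p - 1) * N.factorial.factorization p ≤ N := by
    rw [Nat.factorization_def _ hp, h]
    omega
  have h2 : (2:ℝ) ≤ p := by exact_mod_cast hp.two_le
  rw [le_div_iff₀ (by linarith)]
  have h3 : (((p - 1) * N.factorial.factorization p : ℕ) : ℝ) ≤ N := by exact_mod_cast h1
  rw [Nat.cast_mul, Nat.cast_sub hp.one_le, Nat.cast_one] at h3
  linarith

theorem smooth_log (N z : ℕ) (hz : 0 < z) :
    ∑ n ∈ (Ioc 0 N).filter (fun n => PP n ≤ z), Real.log n ≤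
      2 * N * (Real.log z + (Real.log 4 + 4)) := by
  calc ∑ n ∈ (Ioc 0 N).filter (fun n => PP n ≤ z), Real.log n
      = ∑ n ∈ (Ioc 0 N).filter (fun n => PP n ≤ z),
          ∑ p ∈ (Ioc 0 z).filter Nat.Prime, (n.factorization p : ℝ) * Real.log p := by
        apply Finset.sum_congr rfl
        intro n hn
        rw [Finset.mem_filter, PP_le_iff] at hn
        rw [Real.log_nat_eq_sum_factorization]
        apply Finsupp.sum_of_support_subset
        · intro p hp
          rw [Nat.support_factorization] at hp
          have hpp := Nat.prime_of_mem_primeFactors hp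
          rw [Finset.mem_filter, Finset.mem_Ioc]
          exact ⟨⟨hpp.pos, hn.2 p hp⟩, hpp⟩
        · intro p _; simp
    _ ≤ ∑ n ∈ Ioc 0 N,
          ∑ p ∈ (Ioc 0 z).filter Nat.Prime, (n.factorization p : ℝ) * Real.log p := by
        apply Finset.sum_le_sum_of_subset_of_nonneg (Finset.filter_subset _ _)
        intro n _ _
        apply Finset.sum_nonneg
        intro p _
        exact mul_nonneg (by positivity) (Real.log_natCast_nonneg p)
    _ = ∑ p ∈ (Ioc 0 z).filter Nat.Prime, (N.factorial.factorization p : ℝ) * Real.log p := by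
        rw [Finset.sum_comm]
        apply Finset.sum_congr rfl
        intro p _
        rw [← Finset.sum_mul, ← fact_val]
        push_cast
        rfl
    _ ≤ ∑ p ∈ (Ioc 0 z).filter Nat.Prime, N * (Real.log p / ((p:ℝ) - 1)) := by
        apply Finset.sum_le_sum
        intro p hp
        have := mul_le_mul_of_nonneg_right (fact_val_le p N (Finset.mem_filter.mp hp).2)
          (Real.log_natCast_nonneg p)
        refine this.trans (le_of_eq ?_)
        ring
    _ ≤ _ := by
        rw [← Finset.mul_sum]
        have := mul_le_mul_of_nonneg_left (mertens_prime z hz) (Nat.cast_nonneg (α := ℝ) N)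
        linarith

theorem smooth_count (N z : ℕ) (hN : 2 ≤ N) (hz : 0 < z) :
    (#{n ∈ Ioc 0 N | PP n ≤ z} : ℝ) ≤
      Real.sqrt N + 4 * N * (Real.log z + (Real.log 4 + 4)) / Real.log N := by
  have hN' : (2:ℝ) ≤ N := by exact_mod_cast hN
  have hlog : 0 < Real.log N := Real.log_pos (by linarith)
  have h1 : (#{n ∈ Ioc 0 N | PP n ≤ z} : ℝ) ≤ ∑ n ∈ (Ioc 0 N).filter (fun n => PP n ≤ z),
      ((if n ≤ Nat.sqrt N then (1:ℝ) else 0) + 2 * Real.log n / Real.log N) := by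
    rw [Finset.card_eq_sum_ones, Nat.cast_sum]
    apply Finset.sum_le_sum
    intro n hn
    rw [Finset.mem_filter, Finset.mem_Ioc] at hn
    have h0 := Real.log_natCast_nonneg n
    split_ifs with h
    · have : 0 ≤ 2 * Real.log n / Real.log N := by positivity
      push_cast; linarith
    · rw [not_le, Nat.sqrt_lt] at h
      have : Real.log N ≤ Real.log ((n:ℝ) * n) :=
        Real.log_le_log (by linarith) (by exact_mod_cast h.le)
      have hn0 : (n:ℝ) ≠ 0 := by exact_mod_cast hn.1.1.ne'
      rw [Real.log_mul hn0 hn0] at this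
      rw [zero_add, le_div_iff₀ hlog]
      push_cast; linarith
  rw [Finset.sum_add_distrib, ← Finset.sum_div, ← Finset.mul_sum] at h1
  have h2 : ∑ n ∈ (Ioc 0 N).filter (fun n => PP n ≤ z), (if n ≤ Nat.sqrt N then (1:ℝ) else 0) ≤ Real.sqrt N := by
    rw [Finset.sum_boole]
    refine le_trans ?_ (Real.nat_sqrt_le_real_sqrt (a := N))
    have : #{n ∈ (Ioc 0 N).filter (fun n => PP n ≤ z) | n ≤ Nat.sqrt N} ≤ #(Ioc 0 (Nat.sqrt N)) := by
      apply Finset.card_le_card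
      intro n hn
      simp only [Finset.mem_filter, Finset.mem_Ioc] at hn ⊢
      exact ⟨hn.1.1.1, hn.2⟩
    rw [Nat.card_Ioc, Nat.sub_zero] at this
    exact_mod_cast this
  have h3 := smooth_log N z hz
  have h4 : 2 * ∑ n ∈ (Ioc 0 N).filter (fun n => PP n ≤ z), Real.log n / 1 ≤
      4 * N * (Real.log z + (Real.log 4 + 4)) := by
    simp only [div_one]; linarith
  simp only [div_one] at h4
  have h5 := div_le_div_of_nonneg_right h4 hlog.le
  linarith

end AlladiAux

namespace AlladiAux

theorem PP_mul (m p : ℕ) (hm : 0 < m) (hp : p.Prime) (h : PP m ≤ p) : PP (m * p) = p := by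
  apply le_antisymm
  · rw [PP_le_iff] at h ⊢
    intro q hq
    rw [Nat.primeFactors_mul hm.ne' hp.ne_zero, Finset.mem_union, hp.primeFactors,
      Finset.mem_singleton] at hq
    rcases hq with hq | hq
    · exact h q hq
    · exact hq.le
  · apply (PP_le_iff (m * p) _).mp le_rfl
    rw [Nat.primeFactors_mul hm.ne' hp.ne_zero, hp.primeFactors]
    simp

theorem PP_mono (m n : ℕ) (h : m ∣ n) (hn : n ≠ 0) : PP m ≤ PP n :=
  Finset.sup_mono (Nat.primeFactors_mono h hn)

theorem big_part (c : ℕ → ℝ) (N z : ℕ) :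
    ∑ n ∈ (Ioc 0 N).filter (fun n => ¬ PP n ≤ z), bb c n =
      ∑ m ∈ Ioc 0 N, ∑ p ∈ Ioc (max z (PP m - 1)) (N / m), if p.Prime then c p else 0 := by
  simp only [← Finset.sum_filter]
  rw [Finset.sum_sigma']
  have two_le : ∀ n, 0 < n → ¬ PP n ≤ z → 2 ≤ n := by
    intro n h1 h2
    by_contra h
    have : n = 1 := by omega
    subst this
    rw [PP_one] at h2
    omega
  apply Finset.sum_bij' (fun n _ => (⟨n / PP n, PP n⟩ : (_ : ℕ) × ℕ)) (fun x _ => x.1 * x.2)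
  · intro n hn
    rw [Finset.mem_filter, Finset.mem_Ioc] at hn
    have h2 := two_le n hn.1.1 hn.2
    have hmem := PP_mem n h2
    have hp := Nat.prime_of_mem_primeFactors hmem
    have hd := Nat.dvd_of_mem_primeFactors hmem
    have h3 := PP_mono (n / PP n) n (Nat.div_dvd_of_dvd hd) (by omega)
    have h4 := PP_le_self n
    have h5 : 0 < n / PP n := Nat.div_pos h4 hp.pos
    have h6 : n / PP n ≤ n := Nat.div_le_self _ _
    have h7 : PP n * (n / PP n) = n := Nat.mul_div_cancel' hd
    have h8 : PP n ≤ N / (n / PP n) := by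
      rw [Nat.le_div_iff_mul_le h5, h7]; exact hn.1.2
    have h9 := hp.pos
    have h10 := hn.2
    have h11 := hn.1.2
    simp only [Finset.mem_sigma, Finset.mem_filter, Finset.mem_Ioc, max_lt_iff]
    refine ⟨⟨h5, ?_⟩, ⟨⟨?_, ?_⟩, h8⟩, hp⟩
    · exact h6.trans h11
    · exact not_le.mp h10
    · omega
  · rintro ⟨m, p⟩ hx
    simp only [Finset.mem_sigma, Finset.mem_filter, Finset.mem_Ioc, max_lt_iff] at hx ⊢
    obtain ⟨⟨h1, h2⟩, ⟨⟨h3, h4⟩, h5⟩, h6⟩ := hx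
    rw [PP_mul m p h1 h6 (by omega)]
    rw [Nat.le_div_iff_mul_le h1] at h5
    refine ⟨⟨Nat.mul_pos h1 h6.pos, ?_⟩, not_le.mpr h3⟩
    rw [mul_comm]; exact h5
  · intro n hn
    rw [Finset.mem_filter, Finset.mem_Ioc] at hn
    have h2 := two_le n hn.1.1 hn.2
    exact Nat.div_mul_cancel (Nat.dvd_of_mem_primeFactors (PP_mem n h2))
  · rintro ⟨m, p⟩ hx
    simp only [Finset.mem_sigma, Finset.mem_filter, Finset.mem_Ioc, max_lt_iff] at hx ⊢
    obtain ⟨⟨h1, h2⟩, ⟨⟨h3, h4⟩, h5⟩, h6⟩ := hx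
    rw [PP_mul m p h1 h6 (by omega), Nat.mul_div_cancel _ h6.pos]
  · intro n hn
    rw [Finset.mem_filter, Finset.mem_Ioc] at hn
    rw [bb, if_pos (two_le n hn.1.1 hn.2)]

theorem inner_bound (c : ℕ → ℝ) (δ : ℝ) (hδ : 0 < δ) (T w M : ℕ) (hw : 1 ≤ w) (hTw : T ≤ w)
    (hT : ∀ n ≥ T, ∀ m ≤ n, |∑ p ∈ Ioc 0 m, if p.Prime then Real.log p * c p else 0| ≤ δ * n) :
    |∑ p ∈ Ioc w M, if p.Prime then c p else 0| ≤ 2 * (δ * M) / Real.log (w + 1) := by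
  have hw1 : (1:ℝ) ≤ w := by exact_mod_cast hw
  have hl : 0 < Real.log (w + 1) := Real.log_pos (by linarith)
  rcases le_or_gt M w with h | h
  · rw [Finset.Ioc_eq_empty_of_le h]
    simp only [Finset.sum_empty, abs_zero]
    positivity
  have hp := hT M (by omega)
  have := abel_bound (fun p => if p.Prime then Real.log p * c p else 0)
    (fun n => (Real.log n)⁻¹) w (2 * (δ * M))
    (fun n hn => by
      have h1 : (1:ℝ) < n := by exact_mod_cast (by omega : 1 < n)
      have := Real.log_pos h1
      apply inv_anti₀ this
      apply Real.log_le_log (by linarith)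
      push_cast; linarith)
    (fun n hn => inv_nonneg.mpr (Real.log_natCast_nonneg n)) M (by positivity)
    (fun m h1 h2 => by
      have h3 := Finset.sum_Ioc_consecutive (fun p => if p.Prime then Real.log p * c p else 0)
        (Nat.zero_le w) h1
      have h4 := abs_le.mp (hp m h2)
      have h5 := abs_le.mp (hp w h.le)
      rw [abs_le]
      constructor <;> linarith [h4.1, h4.2, h5.1, h5.2])
  have e : ∑ p ∈ Ioc w M, (if p.Prime then c p else 0) = ∑ n ∈ Ioc w M, (Real.log n)⁻¹ *
      (if n.Prime then Real.log n * c n else 0) := by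
    apply Finset.sum_congr rfl
    intro n hn
    rw [Finset.mem_Ioc] at hn
    have h1 : (1:ℝ) < n := by exact_mod_cast (by omega : 1 < n)
    have := (Real.log_pos h1).ne'
    split_ifs
    · field_simp
    · simp
  rw [e, div_eq_mul_inv]
  rw [Nat.cast_add_one] at this
  exact this

theorem equidist (c : ℕ → ℝ) (hc : ∀ n, |c n| ≤ 1)
    (hE : Tendsto (fun n : ℕ => (∑ p ∈ Ioc 0 n, if p.Prime then Real.log p * c p else 0) / n)
      atTop (nhds 0)) :
    Tendsto (fun N : ℕ => (∑ n ∈ Ioc 0 N, bb c n) / N) atTop (nhds 0) := by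
  rw [Metric.tendsto_atTop]
  intro η hη
  set ε : ℝ := η / 16 with hεd
  have hε : 0 < ε := by positivity
  set δ : ℝ := η * ε / 16 with hδd
  have hδ : 0 < δ := by positivity
  obtain ⟨T, hT⟩ := eventually_atTop.mp (small_partial _ hE δ hδ)
  have hlogN : Tendsto (fun N : ℕ => Real.log N) atTop atTop :=
    Real.tendsto_log_atTop.comp tendsto_natCast_atTop_atTop
  have t1 : Tendsto (fun N : ℕ => (N:ℝ) ^ ε) atTop atTop :=
    (tendsto_rpow_atTop hε).comp tendsto_natCast_atTop_atTop
  have t2 : Tendsto (fun N : ℕ => 4 * (Real.log 4 + 4) / Real.log N) atTop (nhds 0) :=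
    hlogN.const_div_atTop _
  have t3 : Tendsto (fun N : ℕ => 1 / Real.sqrt N) atTop (nhds 0) :=
    (Real.tendsto_sqrt_atTop.comp tendsto_natCast_atTop_atTop).const_div_atTop _
  have hev := ((eventually_ge_atTop 2).and ((t1.eventually_ge_atTop ((T:ℝ) + 1)).and
    ((hlogN.eventually_ge_atTop 1).and ((t2.eventually_lt_const (show 0 < η / 8 by positivity)).and
      (t3.eventually_lt_const (show 0 < η / 8 by positivity))))))
  obtain ⟨N0, hN0⟩ := eventually_atTop.mp hev
  refine ⟨N0, fun N hN => ?_⟩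
  obtain ⟨h2, hz, hl1, hs2, hs3⟩ := hN0 N hN
  have hNp : (0:ℝ) < N := by exact_mod_cast (by omega : 0 < N)
  have hlp : 0 < Real.log N := by linarith
  rw [Real.dist_eq, sub_zero, abs_div, abs_of_pos hNp, div_lt_iff₀ hNp]
  set z := ⌊(N:ℝ) ^ ε⌋₊ with hzd
  have hzT : T + 1 ≤ z := Nat.le_floor (by exact_mod_cast hz)
  have hzp : 0 < z := by omega
  have hzlog : Real.log z ≤ ε * Real.log N := by
    rw [← Real.log_rpow hNp]
    exact Real.log_le_log (by exact_mod_cast hzp) (Nat.floor_le (by positivity))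
  have hzlog2 : ε * Real.log N ≤ Real.log ((z:ℝ) + 1) := by
    rw [← Real.log_rpow hNp]
    exact Real.log_le_log (by positivity) (Nat.lt_floor_add_one _).le
  rw [← Finset.sum_filter_add_sum_filter_not _ (fun n => PP n ≤ z)]
  have b1 : |∑ n ∈ (Ioc 0 N).filter (fun n => PP n ≤ z), bb c n| ≤ (η / 2) * N := by
    have hb : ∀ n, |bb c n| ≤ 1 := by
      intro n; unfold bb; split_ifs
      · exact hc _
      · simp
    have h1 : |∑ n ∈ (Ioc 0 N).filter (fun n => PP n ≤ z), bb c n| ≤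
        (#{n ∈ Ioc 0 N | PP n ≤ z} : ℝ) := by
      refine (abs_sum_le_sum_abs _ _).trans ?_
      refine (Finset.sum_le_sum (fun n _ => hb n)).trans ?_
      simp
    refine h1.trans ((smooth_count N z h2 hzp).trans ?_)
    have e1 : Real.sqrt N = 1 / Real.sqrt N * N := by
      have := Real.sqrt_pos.mpr hNp
      field_simp
      rw [Real.sq_sqrt hNp.le]
    have e2 : 4 * N * (Real.log z + (Real.log 4 + 4)) / Real.log N =
        4 * N * (Real.log z / Real.log N) + 4 * (Real.log 4 + 4) / Real.log N * N := by
      field_simp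
    have e3 : Real.log z / Real.log N ≤ ε := by rwa [div_le_iff₀ hlp]
    have e4 : 4 * N * (Real.log z / Real.log N) ≤ 4 * N * ε :=
      mul_le_mul_of_nonneg_left e3 (by positivity)
    rw [e2, e1]
    have e5 := mul_le_mul_of_nonneg_right hs2.le hNp.le
    have e6 := mul_le_mul_of_nonneg_right hs3.le hNp.le
    rw [hεd] at e4
    linarith
  have b2 : |∑ n ∈ (Ioc 0 N).filter (fun n => ¬ PP n ≤ z), bb c n| ≤ (η / 4) * N := by
    rw [big_part]
    refine (abs_sum_le_sum_abs _ _).trans ?_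
    calc _ ≤ ∑ m ∈ Ioc 0 N, (2 * δ * N / (ε * Real.log N)) * ((m:ℝ)⁻¹) := by
          apply Finset.sum_le_sum
          intro m hm
          refine (inner_bound c δ hδ T (max z (PP m - 1)) (N / m) (by omega) (by omega)
            hT).trans ?_
          have h1 : ((N / m : ℕ) : ℝ) ≤ N / m := Nat.cast_div_le
          have h3 : ε * Real.log N ≤ Real.log ((max z (PP m - 1) : ℕ) + 1) := by
            refine hzlog2.trans (Real.log_le_log (by positivity) ?_)
            have : (z:ℝ) ≤ (max z (PP m - 1) : ℕ) := by exact_mod_cast le_max_left _ _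
            linarith
          calc _ ≤ 2 * (δ * (N / m)) / (ε * Real.log N) := by
                gcongr
            _ = _ := by ring
      _ = (2 * δ * N / (ε * Real.log N)) * (harmonic N : ℝ) := by
          rw [← Finset.mul_sum, harmonic_eq_sum_Icc]
          push_cast
          rfl
      _ ≤ (2 * δ * N / (ε * Real.log N)) * (2 * Real.log N) := by
          apply mul_le_mul_of_nonneg_left _ (by positivity)
          have := harmonic_le_one_add_log N
          linarith
      _ = 4 * δ / ε * N := by field_simp; ring
      _ = (η / 4) * N := by rw [hδd]; field_simp; ring
  have : 0 < η * N := by positivity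
  refine (abs_add_le _ _).trans_lt ?_
  linarith

theorem main (k : ℕ) (hk : 0 < k) (ℓ : ℕ) (hl : Nat.gcd ℓ k = 1) :
    Tendsto
      (fun x : ℕ =>
        -∑ n ∈ Finset.Icc 2 x,
          (if n.minFac ≡ ℓ [MOD k] then (ArithmeticFunction.moebius n : ℝ) / n else 0))
      atTop (nhds (1 / (Nat.totient k : ℝ))) := by
  set f : ℕ → ℝ := fun p => if p ≡ ℓ [MOD k] then 1 else 0 with hf
  have hf1 : ∀ n, |f n| ≤ 1 := by
    intro n; simp only [hf]; split_ifs <;> simp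
  have h1 := alladi_dual f hf1
  have h2 := equidist (cc k ℓ) (fun n => cc_abs k ℓ n hk) (theta_ap k ℓ hk hl)
  have h3 : Tendsto (fun N : ℕ => (1 / (Nat.totient k : ℝ)) * (1 - 1 / (N:ℝ))) atTop
      (nhds ((1 / (Nat.totient k : ℝ)) * (1 - 0))) :=
    (tendsto_const_nhds.sub (tendsto_natCast_atTop_atTop.const_div_atTop 1)).const_mul _
  have h4 := (h2.add h3).sub h1
  have e : (0:ℝ) + (1 / (Nat.totient k : ℝ)) * (1 - 0) - 0 = 1 / (Nat.totient k : ℝ) := by ring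
  rw [e] at h4
  refine h4.congr' ?_
  filter_upwards [eventually_gt_atTop 0] with N hN
  have hNp : (0:ℝ) < N := by exact_mod_cast hN
  have e1 : ∑ n ∈ Finset.Icc 2 N,
      (if n.minFac ≡ ℓ [MOD k] then (ArithmeticFunction.moebius n : ℝ) / n else 0) =
      ∑ n ∈ Ioc 0 N, aa f n / n := by
    have : Finset.Icc 2 N = (Ioc 0 N).filter (fun n => 2 ≤ n) := by
      ext n; simp only [Finset.mem_Icc, Finset.mem_filter, Finset.mem_Ioc]; omega
    rw [this, Finset.sum_filter]
    apply Finset.sum_congr rfl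
    intro n _
    simp only [aa, hf]
    split_ifs <;> simp
  have e2 : ∑ m ∈ Ioc 0 N, bb f m = ∑ m ∈ Ioc 0 N, bb (cc k ℓ) m +
      (1 / (Nat.totient k : ℝ)) * (N - 1) := by
    have : ∀ m, bb f m = bb (cc k ℓ) m + (1 / (Nat.totient k : ℝ)) * (if 2 ≤ m then 1 else 0) := by
      intro m
      simp only [bb, cc, hf]
      split_ifs <;> simp
    rw [Finset.sum_congr rfl (fun m _ => this m), Finset.sum_add_distrib, ← Finset.mul_sum,
      Finset.sum_boole]
    have hc : (Ioc 0 N).filter (fun n => 2 ≤ n) = Finset.Icc 2 N := by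
      ext n; simp only [Finset.mem_Icc, Finset.mem_filter, Finset.mem_Ioc]; omega
    rw [hc, Nat.card_Icc]
    congr 2
    rw [show N + 1 - 2 = N - 1 by omega, Nat.cast_sub (by omega)]
    simp
  rw [e1, e2]
  field_simp
  ring

end AlladiAux

/-- Alladi's 1977 formula: for `k ≥ 1` and `gcd(ℓ, k) = 1`,
`−∑_{n ≥ 2, p_min(n) ≡ ℓ (mod k)} μ(n)/n = 1/φ(k)`, the sum interpreted as the limit of
partial sums over `n ≤ x`. -/
theorem alladi_1977 (k : ℕ) (hk : 0 < k) (ℓ : ℕ) (hl : Nat.gcd ℓ k = 1) :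
    Tendsto
      (fun x : ℕ =>
        -∑ n ∈ Finset.Icc 2 x,
          (if n.minFac ≡ ℓ [MOD k] then (ArithmeticFunction.moebius n : ℝ) / n else 0))
      atTop (nhds (1 / (Nat.totient k : ℝ))) := by
  exact AlladiAux.main k hk ℓ hl
end
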